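/- Given two rectangular diagrams of a link R_1, R_2 and an oriented type T ∈ {→I, ←I, →II, ←II}, it is decidable whether [R_1]_T = [R_2]_T, i.e. whether R_1 and R_2 are related by a finite sequence of exchange moves and stabilizations/destabilizations of oriented type T. -/

import Mathlib

open Set

noncomputable section

/-- The circle `S¹`, modeled as `ℝ/ℤ`. -/
abbrev 𝕊 : Type := AddCircle (1 : ℝ)

/-- The torus `T² = S¹ × S¹`. -/
abbrev Torus : Type := 𝕊 × 𝕊

instance : Fact ((0:ℝ) < 1) := ⟨one_pos⟩

/-- The representative of a point of `S¹` in `[0,1)`. -/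
noncomputable def toIco (x : 𝕊) : ℝ := (AddCircle.equivIco 1 0 x).1

/-- The closed positively oriented arc `[a;b]` in `S¹`. -/
def closedArc (a b : 𝕊) : Set 𝕊 := {x | toIco (x - a) ≤ toIco (b - a)}

/-- The open positively oriented arc `(a;b)` in `S¹`. -/
def openArc (a b : 𝕊) : Set 𝕊 := {x | 0 < toIco (x - a) ∧ toIco (x - a) < toIco (b - a)}

/-- An oriented rectangular diagram of a link. -/
structure RectDiagram where
  pos : Finset Torus
  neg : Finset Torus
  disj : Disjoint pos neg
  nonempty : (pos ∪ neg).Nonempty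
  thetaEq : pos.image Prod.fst = neg.image Prod.fst
  phiEq : pos.image Prod.snd = neg.image Prod.snd
  thetaInjPos : Set.InjOn Prod.fst (pos : Set Torus)
  thetaInjNeg : Set.InjOn Prod.fst (neg : Set Torus)
  phiInjPos : Set.InjOn Prod.snd (pos : Set Torus)
  phiInjNeg : Set.InjOn Prod.snd (neg : Set Torus)

namespace RectDiagram

/-- The set of vertices of a rectangular diagram. -/
def verts (R : RectDiagram) : Finset Torus := R.pos ∪ R.neg

/-- The projection of the vertex set to the `θ`-circle. -/
def pθ (R : RectDiagram) : Finset 𝕊 := R.verts.image Prod.fst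

/-- The projection of the vertex set to the `φ`-circle. -/
def pφ (R : RectDiagram) : Finset 𝕊 := R.verts.image Prod.snd

/-- Vertical edges: unordered pairs of distinct vertices with equal `θ`-coordinate. -/
def vertEdges (R : RectDiagram) : Set (Finset Torus) :=
  {e | ∃ u ∈ R.verts, ∃ v ∈ R.verts, u ≠ v ∧ u.1 = v.1 ∧ e = {u, v}}

/-- Horizontal edges: unordered pairs of distinct vertices with equal `φ`-coordinate. -/
def horizEdges (R : RectDiagram) : Set (Finset Torus) :=
  {e | ∃ u ∈ R.verts, ∃ v ∈ R.verts, u ≠ v ∧ u.2 = v.2 ∧ e = {u, v}}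

end RectDiagram

/-- A set of one, two, or three consecutive corners of the rectangle
`[θ₁;θ₂] × [φ₁;φ₂]` (in the cyclic order of the corners). -/
def ConsecCorners (θ₁ θ₂ φ₁ φ₂ : 𝕊) (s : Set Torus) : Prop :=
  let c₁ : Torus := (θ₁, φ₁); let c₂ : Torus := (θ₂, φ₁)
  let c₃ : Torus := (θ₂, φ₂); let c₄ : Torus := (θ₁, φ₂)
  s = {c₁} ∨ s = {c₂} ∨ s = {c₃} ∨ s = {c₄} ∨
  s = {c₁, c₂} ∨ s = {c₂, c₃} ∨ s = {c₃, c₄} ∨ s = {c₄, c₁} ∨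
  s = {c₁, c₂, c₃} ∨ s = {c₂, c₃, c₄} ∨ s = {c₃, c₄, c₁} ∨ s = {c₄, c₁, c₂}

/-- An elementary move `R₁ ↦ R₂` with the given data `θ₁, θ₂, φ₁, φ₂`. -/
def ElemMoveData (R₁ R₂ : RectDiagram) (θ₁ θ₂ φ₁ φ₂ : 𝕊) : Prop :=
  θ₁ ≠ θ₂ ∧ φ₁ ≠ φ₂ ∧
  symmDiff (↑R₁.verts : Set Torus) ↑R₂.verts = ({θ₁, θ₂} : Set 𝕊) ×ˢ ({φ₁, φ₂} : Set 𝕊) ∧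
  (closedArc θ₁ θ₂ ×ˢ closedArc φ₁ φ₂) ∩ ((↑R₁.verts : Set Torus) ∪ ↑R₂.verts)
    = symmDiff (↑R₁.verts : Set Torus) ↑R₂.verts ∧
  (∃ s : Set Torus, ConsecCorners θ₁ θ₂ φ₁ φ₂ s ∧
    (↑R₁.verts : Set Torus) ∩ (({θ₁, θ₂} : Set 𝕊) ×ˢ ({φ₁, φ₂} : Set 𝕊)) = s ∧
    (({θ₁, θ₂} : Set 𝕊) ×ˢ ({φ₁, φ₂} : Set 𝕊)) \ s ⊆ (↑R₂.verts : Set Torus)) ∧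
  ((↑R₁.pos : Set Torus) ∩ ↑R₂.verts = (↑R₁.verts : Set Torus) ∩ ↑R₂.pos)

/-- An elementary move of rectangular diagrams. -/
def ElemMove (R₁ R₂ : RectDiagram) : Prop :=
  ∃ θ₁ θ₂ φ₁ φ₂, ElemMoveData R₁ R₂ θ₁ θ₂ φ₁ φ₂

/-- An exchange move. -/
def ExchangeMove (R₁ R₂ : RectDiagram) : Prop :=
  ElemMove R₁ R₂ ∧ R₁.verts.card = R₂.verts.card

/-- A stabilization move. -/
def Stab (R₁ R₂ : RectDiagram) : Prop :=
  ElemMove R₁ R₂ ∧ R₂.verts.card = R₁.verts.card + 2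

/-- A destabilization move. -/
def Destab (R₁ R₂ : RectDiagram) : Prop :=
  ElemMove R₁ R₂ ∧ R₁.verts.card = R₂.verts.card + 2

/-- The four oriented types of stabilizations: `→I`, `←I`, `→II`, `←II`. -/
inductive OType | rI | lI | rII | lII
deriving DecidableEq

/-- A stabilization `R₁ ↦ R₂` with data `θ₁, θ₂, φ₁, φ₂` has oriented type `T`:
`v` is the (unique) vertex of `R₁` in the rectangle, type I means
`v ∈ {(θ₁,φ₁),(θ₂,φ₂)}`, type II means `v ∈ {(θ₁,φ₂),(θ₂,φ₁)}`, and the arrow is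
`→` or `←` according to the sign of `(θ₂,φ₀)` in `R₂`, where
`{θ₁,θ₂} × {φ₀} ⊆ R₂`. -/
def StabTypeData (R₁ R₂ : RectDiagram) (θ₁ θ₂ φ₁ φ₂ : 𝕊) (T : OType) : Prop :=
  ∃ v ∈ (↑R₁.verts : Set Torus) ∩ (closedArc θ₁ θ₂ ×ˢ closedArc φ₁ φ₂),
    ∃ φ₀ ∈ ({φ₁, φ₂} : Set 𝕊), (θ₁, φ₀) ∈ R₂.verts ∧ (θ₂, φ₀) ∈ R₂.verts ∧
    (match T with
     | .rI => (v = (θ₁, φ₁) ∨ v = (θ₂, φ₂)) ∧ (θ₂, φ₀) ∈ R₂.pos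
     | .lI => (v = (θ₁, φ₁) ∨ v = (θ₂, φ₂)) ∧ (θ₂, φ₀) ∈ R₂.neg
     | .rII => (v = (θ₁, φ₂) ∨ v = (θ₂, φ₁)) ∧ (θ₂, φ₀) ∈ R₂.pos
     | .lII => (v = (θ₁, φ₂) ∨ v = (θ₂, φ₁)) ∧ (θ₂, φ₀) ∈ R₂.neg)

/-- A stabilization of oriented type `T`. -/
def StabOfType (R₁ R₂ : RectDiagram) (T : OType) : Prop :=
  ∃ θ₁ θ₂ φ₁ φ₂, ElemMoveData R₁ R₂ θ₁ θ₂ φ₁ φ₂ ∧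
    R₂.verts.card = R₁.verts.card + 2 ∧ StabTypeData R₁ R₂ θ₁ θ₂ φ₁ φ₂ T

/-- A destabilization of oriented type `T` (the type is read off from the inverse
stabilization `R₂ ↦ R₁`). -/
def DestabOfType (R₁ R₂ : RectDiagram) (T : OType) : Prop :=
  ∃ θ₁ θ₂ φ₁ φ₂, ElemMoveData R₁ R₂ θ₁ θ₂ φ₁ φ₂ ∧
    R₁.verts.card = R₂.verts.card + 2 ∧ StabTypeData R₂ R₁ θ₁ θ₂ φ₁ φ₂ T

/-- The union of staircase curves `Γ_→II(R)` on the torus. -/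
def Gamma (R : RectDiagram) : Set Torus :=
  {p | ∃ θ₀ φ₁ φ₂, (θ₀, φ₁) ∈ R.pos ∧ (θ₀, φ₂) ∈ R.neg ∧ p.1 = θ₀ ∧ p.2 ∈ closedArc φ₁ φ₂} ∪
  {p | ∃ θ₁ θ₂ φ₀, (θ₁, φ₀) ∈ R.neg ∧ (θ₂, φ₀) ∈ R.pos ∧ p.2 = φ₀ ∧ p.1 ∈ closedArc θ₁ θ₂}

/-- Number of intersection points of a subset of the torus with the meridian `{θ₀} × S¹`. -/
def merCount (A : Set Torus) (θ₀ : 𝕊) : ℕ := (A ∩ {p | p.1 = θ₀}).ncard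

/-- Number of intersection points of a subset of the torus with the longitude `S¹ × {φ₀}`. -/
def lonCount (A : Set Torus) (φ₀ : 𝕊) : ℕ := (A ∩ {p | p.2 = φ₀}).ncard

/-- `(k,l)` is the homology class of `Γ_→II(R)` in `H₁(T²;ℤ)`: it counts the
intersections of `Γ_→II(R)` with generic meridians and longitudes respectively. -/
def IsHomClass (R : RectDiagram) (k l : ℕ) : Prop :=
  (∀ θ₀ : 𝕊, θ₀ ∉ R.pθ → merCount (Gamma R) θ₀ = k) ∧
  (∀ φ₀ : 𝕊, φ₀ ∉ R.pφ → lonCount (Gamma R) φ₀ = l)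

/-- `p` lies in the relative interior of a vertical segment of `Γ_→II(R)`. -/
def OnVertInt (R : RectDiagram) (p : Torus) : Prop :=
  ∃ θ₀ φ₁ φ₂, (θ₀, φ₁) ∈ R.pos ∧ (θ₀, φ₂) ∈ R.neg ∧ p.1 = θ₀ ∧ p.2 ∈ openArc φ₁ φ₂

/-- `p` lies in the relative interior of a horizontal segment of `Γ_→II(R)`. -/
def OnHorizInt (R : RectDiagram) (p : Torus) : Prop :=
  ∃ θ₁ θ₂ φ₀, (θ₁, φ₀) ∈ R.neg ∧ (θ₂, φ₀) ∈ R.pos ∧ p.2 = φ₀ ∧ p.1 ∈ openArc θ₁ θ₂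

/-- The set of double (self-intersection) points of `Γ_→II(R)`. -/
def DoublePts (R : RectDiagram) : Set Torus := {p | OnVertInt R p ∧ OnHorizInt R p}

/-- An exchange move or a type-`T` stabilization or destabilization. -/
def MoveOfType (T : OType) (R₁ R₂ : RectDiagram) : Prop :=
  ExchangeMove R₁ R₂ ∨ StabOfType R₁ R₂ T ∨ DestabOfType R₁ R₂ T

/-- The equivalence generated by exchange moves and type-`T` (de)stabilizations:
`[R₁]_T = [R₂]_T`. -/
def EquivOfType (T : OType) : RectDiagram → RectDiagram → Prop :=
  Relation.ReflTransGen (MoveOfType T)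

/-- An (ambient) isotopy of the torus: a continuous family of homeomorphisms
starting from the identity. -/
def Isotopy (H : ℝ → Torus ≃ₜ Torus) : Prop :=
  Continuous (fun q : ℝ × Torus => H q.1 q.2) ∧ H 0 = Homeomorph.refl Torus

/-- `A` is isotopic to `B` by an ambient isotopy of `T²` fixed on `X`. -/
def IsotopicRelFixed (A B X : Set Torus) : Prop :=
  ∃ H : ℝ → Torus ≃ₜ Torus, Isotopy H ∧ (∀ t : ℝ, ∀ x ∈ X, H t x = x) ∧ (H 1) '' A = B

/-- `F` is an embedded closed disc in the torus. -/
def IsClosedDisc (F : Set Torus) : Prop :=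
  Nonempty (↥F ≃ₜ ↥(Metric.closedBall (0 : ℝ × ℝ) 1))

/-- `F` is an embedded closed annulus in the torus. -/
def IsClosedAnnulus (F : Set Torus) : Prop :=
  Nonempty (↥F ≃ₜ (𝕊 × ↥(Set.Icc (0:ℝ) 1)))

/-- A self-homeomorphism of `S¹` is orientation-preserving if it preserves the
cyclic order (sends points of open positively oriented arcs to points of the
corresponding open positively oriented arcs). -/
def OrientPres (f : 𝕊 ≃ₜ 𝕊) : Prop :=
  ∀ a b c : 𝕊, b ∈ openArc a c → f b ∈ openArc (f a) (f c)

/-- Combinatorial equivalence of rectangular diagrams: related by a product of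
orientation-preserving self-homeomorphisms of the two circle factors. -/
def CombEquiv (R R' : RectDiagram) : Prop :=
  ∃ f g : 𝕊 ≃ₜ 𝕊, OrientPres f ∧ OrientPres g ∧
    (fun p : Torus => (f p.1, g p.2)) '' ↑R.pos = ↑R'.pos ∧
    (fun p : Torus => (f p.1, g p.2)) '' ↑R.neg = ↑R'.neg

/-- `R` and `R'` have the same `→II`-homology type. -/
def SameHomType (R R' : RectDiagram) : Prop :=
  ∃ R'' : RectDiagram, CombEquiv R' R'' ∧
    IsotopicRelFixed (Gamma R) (Gamma R'') (DoublePts R)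

/-- A point of the standard `1/N`-grid on the circle. -/
def gridPt (N a : ℕ) : 𝕊 := (((a : ℝ) / (N : ℝ) : ℝ) : 𝕊)

/-- `L` is a combinatorial encoding (a list of grid vertices with signs) of the
rectangular diagram `R`. -/
def Realizes (L : List ((ℕ × ℕ) × Bool)) (R : RectDiagram) : Prop :=
  ∃ N : ℕ, (∀ e ∈ L, e.1.1 < N ∧ e.1.2 < N) ∧
    (↑R.pos : Set Torus) =
      {p | ∃ e ∈ L, e.2 = true ∧ p = (gridPt N e.1.1, gridPt N e.1.2)} ∧
    (↑R.neg : Set Torus) =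
      {p | ∃ e ∈ L, e.2 = false ∧ p = (gridPt N e.1.1, gridPt N e.1.2)}

namespace RD
section L
variable {α : Type*} [LinearOrder α]

/-- `x` lies on the open cyclic arc from `a` to `b`. -/
def InOpen (a b x : α) : Prop := (a < x ∧ x < b) ∨ (b < a ∧ (a < x ∨ x < b))

/-- `x` lies on the closed cyclic arc from `a` to `b`. -/
def InClosed (a b x : α) : Prop := InOpen a b x ∨ x = a ∨ x = b

/-- Two jumps with disjoint unlinked ends. -/
def Unlinked (x y : α × α) : Prop :=
  y.1 ≠ x.1 ∧ y.1 ≠ x.2 ∧ y.2 ≠ x.1 ∧ y.2 ≠ x.2 ∧ (InOpen x.1 x.2 y.1 ↔ InOpen x.1 x.2 y.2)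

/-- The heights from which jumps start. -/
def fsts (σ : List (α × α)) : List α := σ.map Prod.fst

/-- The heights at which jumps end. -/
def snds (σ : List (α × α)) : List α := σ.map Prod.snd

/-- Validity of a cyclic list of jumps. -/
def Valid (σ : List (α × α)) : Prop :=
  (fsts σ).Nodup ∧ (fsts σ).Perm (snds σ) ∧ ∀ e ∈ σ, e.1 ≠ e.2

/-- Swap and merge steps, in context. -/
inductive Red1 : List (α × α) → List (α × α) → Prop
  | swap (u v : List (α × α)) (x y : α × α) (h : Unlinked x y) :
      Red1 (u ++ x :: y :: v) (u ++ y :: x :: v)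
  | merge (u v : List (α × α)) (a h b : α) (hh : InOpen a b h) :
      Red1 (u ++ (a, h) :: (h, b) :: v) (u ++ (a, b) :: v)

/-- Reduction. -/
def Red : List (α × α) → List (α × α) → Prop := Relation.ReflTransGen Red1

/-- One-directional basic steps. -/
inductive Step0 : List (α × α) → List (α × α) → Prop
  | red (σ τ) (h : Red1 σ τ) : Step0 σ τ
  | rot (x : α × α) (v : List (α × α)) : Step0 (x :: v) (v ++ [x])
  | bigex (h h' a b : α) (u v : List (α × α))
      (hu : ∀ e ∈ u, ¬ InClosed h h' e.1 ∧ ¬ InClosed h h' e.2)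
      (ha : ¬ InClosed h h' a) (hb : ¬ InClosed h h' b) :
      Step0 ((h, b) :: (u ++ (a, h) :: v)) ((h', b) :: (u ++ (a, h') :: v))

/-- Steps between valid lists, symmetrised. -/
def LStep (σ τ : List (α × α)) : Prop := Valid σ ∧ Valid τ ∧ (Step0 σ τ ∨ Step0 τ σ)

/-- Bounded chains. -/
def BR (B : ℕ) : List (α × α) → List (α × α) → Prop :=
  Relation.ReflTransGen (fun σ τ => LStep σ τ ∧ σ.length ≤ B ∧ τ.length ≤ B)

theorem Unlinked.symm {x y : α × α} (h : Unlinked x y) : Unlinked y x := by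
  obtain ⟨a, b⟩ := x
  obtain ⟨c, d⟩ := y
  unfold Unlinked InOpen at *
  simp only at *
  obtain ⟨h1, h2, h3, h4, h5⟩ := h
  refine ⟨h1.symm, h3.symm, h2.symm, h4.symm, ?_⟩
  grind

theorem LStep.symm {σ τ : List (α × α)} (h : LStep σ τ) : LStep τ σ := ⟨h.2.1, h.1, h.2.2.symm⟩

theorem BR.symm {B : ℕ} {σ τ : List (α × α)} (h : BR B σ τ) : BR B τ σ := by
  induction h with
  | refl => exact .refl
  | tail _ h ih => exact Relation.ReflTransGen.head ⟨h.1.symm, h.2.2, h.2.1⟩ ih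

theorem BR.mono {B B' : ℕ} (hB : B ≤ B') {σ τ : List (α × α)} (h : BR B σ τ) : BR B' σ τ := by
  induction h with
  | refl => exact .refl
  | tail _ h ih => exact ih.tail ⟨h.1, h.2.1.trans hB, h.2.2.trans hB⟩

theorem BR.trans {B : ℕ} {σ τ ρ : List (α × α)} (h : BR B σ τ) (h' : BR B τ ρ) : BR B σ ρ :=
  Relation.ReflTransGen.trans h h'

theorem Red.trans {σ τ ρ : List (α × α)} (h : Red σ τ) (h' : Red τ ρ) : Red σ ρ :=
  Relation.ReflTransGen.trans h h'

theorem Red1.ctx {σ τ : List (α × α)} (h : Red1 σ τ) (p q : List (α × α)) :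
    Red1 (p ++ σ ++ q) (p ++ τ ++ q) := by
  cases h with
  | swap u v x y h => simpa using Red1.swap (p ++ u) (v ++ q) x y h
  | merge u v a m b h => simpa using Red1.merge (p ++ u) (v ++ q) a m b h

theorem Red.ctx {σ τ : List (α × α)} (h : Red σ τ) (p q : List (α × α)) :
    Red (p ++ σ ++ q) (p ++ τ ++ q) := by
  induction h with
  | refl => exact .refl
  | tail _ h ih => exact ih.tail (h.ctx p q)

theorem Red.left {σ τ : List (α × α)} (h : Red σ τ) (p : List (α × α)) :
    Red (p ++ σ) (p ++ τ) := by simpa using h.ctx p []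

theorem Red.right {σ τ : List (α × α)} (h : Red σ τ) (p : List (α × α)) :
    Red (σ ++ p) (τ ++ p) := by simpa using h.ctx [] p

theorem Red.cons {σ τ : List (α × α)} (h : Red σ τ) (x : α × α) :
    Red (x :: σ) (x :: τ) := by simpa using h.ctx [x] []

theorem Red1.length_le {σ τ : List (α × α)} (h : Red1 σ τ) : τ.length ≤ σ.length := by
  cases h <;> simp

theorem Red.length_le {σ τ : List (α × α)} (h : Red σ τ) : τ.length ≤ σ.length := by
  induction h with
  | refl => exact le_rfl
  | tail _ h ih => exact h.length_le.trans ih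

theorem InOpen.ne {a b h : α} (hh : InOpen a b h) : a ≠ b ∧ a ≠ h ∧ b ≠ h := by
  unfold InOpen at hh
  refine ⟨?_, ?_, ?_⟩ <;> rintro rfl <;> simp at hh
  · exact (hh.1.trans hh.2).false
  · exact absurd hh.1 (not_lt.2 hh.2.le)
  · exact absurd hh.1 (not_lt.2 hh.2.le)

theorem Red1.valid {σ τ : List (α × α)} (h : Red1 σ τ) (hv : Valid σ) : Valid τ := by
  obtain ⟨h1, h2, h3⟩ := hv
  cases h with
  | swap u v x y h =>
    have hp : (u ++ x :: y :: v).Perm (u ++ y :: x :: v) :=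
      List.Perm.append_left u (List.Perm.swap y x v)
    refine ⟨(hp.map Prod.fst).nodup_iff.1 h1, ?_, fun e he => h3 e (hp.mem_iff.2 he)⟩
    exact ((hp.map Prod.fst).symm.trans h2).trans (hp.map Prod.snd)
  | merge u v a m b h =>
    refine ⟨?_, ?_, ?_⟩
    · refine h1.sublist ?_
      simp [fsts]
    · have e1 : (fsts (u ++ (a, m) :: (m, b) :: v)).Perm (m :: fsts (u ++ (a, b) :: v)) := by
        simp only [fsts, List.map_append, List.map_cons]
        rw [show List.map Prod.fst u ++ a :: m :: List.map Prod.fst v =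
          (List.map Prod.fst u ++ [a]) ++ m :: List.map Prod.fst v by simp]
        refine List.perm_middle.trans ?_
        simp
      have e2 : (snds (u ++ (a, m) :: (m, b) :: v)).Perm (m :: snds (u ++ (a, b) :: v)) := by
        simp only [snds, List.map_append, List.map_cons]
        exact List.perm_middle
      exact (List.perm_cons m).1 ((e1.symm.trans h2).trans e2)
    · intro e he
      simp only [List.mem_append, List.mem_cons] at he
      rcases he with he | rfl | he
      · exact h3 e (by simp [he])
      · exact h.ne.1
      · exact h3 e (by simp [he])

theorem Red.valid {σ τ : List (α × α)} (h : Red σ τ) (hv : Valid σ) : Valid τ := by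
  induction h with
  | refl => exact hv
  | tail _ h ih => exact h.valid ih

theorem Red.br {B : ℕ} {σ τ : List (α × α)} (h : Red σ τ) (hv : Valid σ) (hB : σ.length ≤ B) :
    BR B σ τ := by
  induction h with
  | refl => exact .refl
  | tail h' h ih =>
    have h1 : Red _ _ := h'
    exact ih.tail ⟨⟨h1.valid hv, h.valid (h1.valid hv), .inl (.red _ _ h)⟩,
      h1.length_le.trans hB, (h.length_le.trans h1.length_le).trans hB⟩

/-- Moving a jump left past a list of unlinked jumps. -/
theorem Red.moveLeft (y : α × α) (l : List (α × α)) (hl : ∀ x ∈ l, Unlinked x y) :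
    Red (l ++ [y]) (y :: l) := by
  induction l with
  | nil => exact .refl
  | cons x l ih =>
    have h1 : Red (x :: (l ++ [y])) (x :: (y :: l)) := (ih fun z hz => hl z (by simp [hz])).cons x
    exact h1.tail (by simpa using Red1.swap [] l x y (hl x (by simp)))

theorem Red.moveRight (y : α × α) (l : List (α × α)) (hl : ∀ x ∈ l, Unlinked x y) :
    Red (y :: l) (l ++ [y]) := by
  induction l with
  | nil => exact .refl
  | cons x l ih =>
    have h1 : Red (x :: (y :: l)) (x :: (l ++ [y])) := (ih fun z hz => hl z (by simp [hz])).cons x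
    exact Relation.ReflTransGen.head (by simpa using Red1.swap [] l y x (hl x (by simp)).symm) h1

/-- The canonical nonspecial path between two configurations given as descending lists. -/
def canonL : List α → List α → List (α × α)
  | x :: X, y :: Y => if x = y then canonL X Y else (x, y) :: canonL X Y
  | _, _ => []

theorem canonL_self (X : List α) : canonL X X = [] := by
  induction X with
  | nil => rfl
  | cons x X ih => simp [canonL, ih]

theorem canonL_length (X Y : List α) : (canonL X Y).length ≤ X.length := by
  induction X generalizing Y with
  | nil => simp [canonL]
  | cons x X ih =>
    cases Y with
    | nil => simp [canonL]
    | cons y Y =>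
      simp only [canonL]
      split_ifs
      · exact (ih Y).trans (by simp)
      · simpa using ih Y

theorem canonL_append (A A' B B' : List α) (h : A.length = A'.length) :
    canonL (A ++ B) (A' ++ B') = canonL A A' ++ canonL B B' := by
  induction A generalizing A' with
  | nil =>
    cases A' with
    | nil => simp [canonL]
    | cons y Y => simp at h
  | cons x X ih =>
    cases A' with
    | nil => simp at h
    | cons y Y =>
      simp only [List.cons_append, canonL]
      split_ifs
      · exact ih Y (by simpa using h)
      · simp [ih Y (by simpa using h)]

theorem canonL_mem {X Y : List α} (h : List.Forall₂ (· ≤ ·) X Y) {e : α × α}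
    (he : e ∈ canonL X Y) : e.1 < e.2 ∧ e.2 ∈ Y := by
  induction h with
  | nil => simp [canonL] at he
  | @cons x y X Y hxy h ih =>
    simp only [canonL] at he
    split_ifs at he with hx
    · exact ⟨(ih he).1, by simp [(ih he).2]⟩
    · rcases List.mem_cons.1 he with rfl | he
      · exact ⟨lt_of_le_of_ne hxy hx, by simp⟩
      · exact ⟨(ih he).1, by simp [(ih he).2]⟩

theorem canonL_trans {X Y Z : List α} (h1 : List.Forall₂ (· ≤ ·) X Y)
    (h2 : List.Forall₂ (· ≤ ·) Y Z) (hY : Y.Pairwise (· > ·)) :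
    Red (canonL X Y ++ canonL Y Z) (canonL X Z) := by
  induction h1 generalizing Z with
  | nil => cases h2; exact .refl
  | @cons x y X Y hxy h ih =>
    cases h2 with
    | @cons _ z _ Z hyz h' =>
    have ih := ih h' (List.pairwise_cons.1 hY).2
    have hlt := (List.pairwise_cons.1 hY).1
    by_cases hyz' : y = z
    · subst hyz'
      by_cases hxy' : x = y
      · subst hxy'
        simpa [canonL] using ih
      · simpa [canonL, hxy'] using ih.cons (x, y)
    · have hyz2 : y < z := lt_of_le_of_ne hyz hyz'
      have hm : Red (canonL X Y ++ [(y, z)]) ((y, z) :: canonL X Y) := by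
        refine Red.moveLeft _ _ fun e he => ?_
        obtain ⟨h3, h4⟩ := canonL_mem h he
        have h5 := hlt _ h4
        obtain ⟨p, q⟩ := e
        simp only [gt_iff_lt] at *
        unfold Unlinked InOpen
        simp only
        have h6 := h3.trans h5
        have h7 := h5.trans hyz2
        refine ⟨h6.ne', h5.ne', (h6.trans hyz2).ne', h7.ne', ?_⟩
        have n1 := not_lt.2 h5.le
        have n2 := not_lt.2 h7.le
        have n3 := not_lt.2 h3.le
        simp [n1, n2, n3]
      have hm2 := hm.right (canonL Y Z)
      by_cases hxy' : x = y
      · subst hxy'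
        simp only [canonL, if_true, if_neg hyz']
        refine Red.trans ?_ (ih.cons (x, z))
        simpa using hm2
      · have hxy2 : x < y := lt_of_le_of_ne hxy hxy'
        have hxz : x ≠ z := (hxy2.trans hyz2).ne
        simp only [canonL, if_neg hxy', if_neg hyz', if_neg hxz]
        refine Red.trans ?_ (ih.cons (x, z))
        have hm3 := hm2.cons (x, y)
        refine Red.trans (by simpa using hm3) (.single ?_)
        simpa using Red1.merge [] (canonL X Y ++ canonL Y Z) x y z (.inl ⟨hxy2, hyz2⟩)

end L
end RD

namespace RD
section L
variable {α : Type*} [LinearOrder α]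

instance (a b : α) : DecidablePred (InOpen a b) := fun x => by unfold InOpen; infer_instance

/-- Configuration after a jump. -/
def after (S : Finset α) (e : α × α) : Finset α := insert e.2 (S.erase e.1)

/-- The list of jumps can be performed starting from `S`. -/
def Path : Finset α → List (α × α) → Prop
  | _, [] => True
  | S, e :: σ => e.1 ∈ S ∧ e.2 ∉ S ∧ Path (after S e) σ

/-- Final configuration. -/
def fin : Finset α → List (α × α) → Finset α
  | S, [] => S
  | S, e :: σ => fin (after S e) σ

/-- Special jumps: crossing something or wrapping. -/
def Spec (S : Finset α) (e : α × α) : Prop := e.2 < e.1 ∨ ∃ x ∈ S, e.1 < x ∧ x < e.2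

/-- All jumps are nonspecial. -/
def NPath : Finset α → List (α × α) → Prop
  | _, [] => True
  | S, e :: σ => ¬ Spec S e ∧ NPath (after S e) σ

/-- Cost: number of crossings plus wraps. -/
def cost : Finset α → List (α × α) → ℕ
  | _, [] => 0
  | S, e :: σ => (S.filter (InOpen e.1 e.2)).card +
      (if e.2 < e.1 then 1 else 0) + cost (after S e) σ

/-- The initial configuration of a valid list. -/
def cfg0 : List (α × α) → Finset α
  | [] => ∅
  | e :: σ => insert e.1 ((cfg0 σ).erase e.2)

/-- Descending sorted list. -/
def srt (S : Finset α) : List α := S.sort (· ≥ ·)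

theorem srt_pairwise (S : Finset α) : (srt S).Pairwise (· > ·) := (Finset.sortedGT_sort S).pairwise

theorem mem_srt {S : Finset α} {x : α} : x ∈ srt S ↔ x ∈ S := Finset.mem_sort _

theorem srt_length (S : Finset α) : (srt S).length = S.card := Finset.length_sort _

theorem srt_unique {S : Finset α} {l : List α} (h : l.Pairwise (· > ·)) (h' : ∀ x, x ∈ l ↔ x ∈ S) :
    srt S = l := by
  refine List.Perm.eq_of_pairwise (le := (· > ·)) ?_ (srt_pairwise S) h ?_
  · intro a b _ _ h1 h2
    exact absurd h1 (not_lt.2 (le_of_lt h2))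
  · refine (List.perm_ext_iff_of_nodup ?_ ?_).2 fun x => ?_
    · exact Finset.sort_nodup _ _
    · exact h.imp fun h => ne_of_gt h
    · rw [mem_srt, h' x]

theorem srt_insert {S : Finset α} {h : α} (hS : h ∉ S) :
    srt (insert h S) = srt (S.filter (h < ·)) ++ h :: srt (S.filter (· < h)) := by
  apply srt_unique
  · rw [List.pairwise_append, List.pairwise_cons]
    refine ⟨srt_pairwise _, ⟨?_, srt_pairwise _⟩, ?_⟩
    · intro x hx
      simp only [mem_srt, Finset.mem_filter] at hx
      exact hx.2
    · intro x hx y hy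
      simp only [mem_srt, Finset.mem_filter, List.mem_cons] at hx hy
      rcases hy with rfl | hy
      · exact hx.2
      · exact hy.2.trans hx.2
  · intro x
    simp only [List.mem_append, List.mem_cons, mem_srt, Finset.mem_filter, Finset.mem_insert]
    rcases lt_trichotomy x h with h1 | h1 | h1
    · simp [h1, h1.ne, not_lt.2 h1.le]
    · simp [h1]
    · simp [h1, h1.ne', not_lt.2 h1.le]

theorem srt_split {S : Finset α} {h : α} (hS : h ∉ S) :
    srt S = srt (S.filter (h < ·)) ++ srt (S.filter (· < h)) := by
  apply srt_unique
  · rw [List.pairwise_append]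
    refine ⟨srt_pairwise _, srt_pairwise _, ?_⟩
    · intro x hx y hy
      simp only [mem_srt, Finset.mem_filter] at hx hy
      exact hy.2.trans hx.2
  · intro x
    simp only [List.mem_append, mem_srt, Finset.mem_filter]
    rcases lt_trichotomy x h with h1 | h1 | h1
    · simp [h1, not_lt.2 h1.le]
    · subst h1; simp [hS]
    · simp [h1, not_lt.2 h1.le]

/-- Componentwise comparison. -/
def Le (S S' : Finset α) : Prop := List.Forall₂ (· ≤ ·) (srt S) (srt S')

def canonF (S S' : Finset α) : List (α × α) := canonL (srt S) (srt S')

theorem Le.refl (S : Finset α) : Le S S := List.forall₂_refl _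

theorem Le.trans {S T U : Finset α} (h : Le S T) (h' : Le T U) : Le S U := by
  unfold Le at *
  revert h h'
  generalize srt S = a
  generalize srt T = b
  generalize srt U = c
  intro h h'
  induction h generalizing c with
  | nil => exact h'
  | cons h1 h2 ih =>
    cases h' with
    | cons h3 h4 => exact .cons (h1.trans h3) (ih _ h4)

theorem canonF_self (S : Finset α) : canonF S S = [] := canonL_self _

theorem canonF_length (S T : Finset α) : (canonF S T).length ≤ S.card := by
  rw [← srt_length]; exact canonL_length _ _

theorem canonF_trans {S T U : Finset α} (h1 : Le S T) (h2 : Le T U) :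
    Red (canonF S T ++ canonF T U) (canonF S U) :=
  canonL_trans h1 h2 (srt_pairwise _)

theorem step_srt {S : Finset α} {e : α × α} (h1 : e.1 ∈ S) (h2 : e.2 ∉ S) (h3 : ¬ Spec S e) :
    Le S (after S e) ∧ canonF S (after S e) = [e] := by
  obtain ⟨c, d⟩ := e
  simp only [Spec, not_or, not_lt, not_exists, not_and] at h1 h2 h3
  obtain ⟨h3, h4⟩ := h3
  have hcd : c < d := lt_of_le_of_ne h3 (by rintro rfl; exact h2 h1)
  have hc : c ∉ S.erase c := by simp
  have hd : d ∉ S.erase c := by simp [h2]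
  have e1 : (S.erase c).filter (d < ·) = (S.erase c).filter (c < ·) := by
    ext x
    simp only [Finset.mem_filter, Finset.mem_erase]
    constructor
    · rintro ⟨h, h'⟩
      exact ⟨h, hcd.trans h'⟩
    · rintro ⟨h, h'⟩
      exact ⟨h, lt_of_le_of_ne (h4 x h.2 h') (by rintro rfl; exact h2 h.2)⟩
  have e2 : (S.erase c).filter (· < d) = (S.erase c).filter (· < c) := by
    ext x
    simp only [Finset.mem_filter, Finset.mem_erase]
    constructor
    · rintro ⟨h, h'⟩
      refine ⟨h, lt_of_le_of_ne (not_lt.1 fun h5 => absurd (h4 x h.2 h5) (not_le.2 h')) h.1⟩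
    · rintro ⟨h, h'⟩
      exact ⟨h, h'.trans hcd⟩
  have f1 := srt_insert hc
  have f2 := srt_insert hd
  rw [Finset.insert_erase h1] at f1
  rw [e1, e2] at f2
  unfold Le canonF after
  simp only
  rw [f1, f2]
  constructor
  · exact List.rel_append (List.forall₂_refl _) (.cons hcd.le (List.forall₂_refl _))
  · rw [canonL_append _ _ _ _ rfl, canonL_self]
    simp [canonL, hcd.ne, canonL_self]

theorem Path_append {S : Finset α} {σ τ : List (α × α)} :
    Path S (σ ++ τ) ↔ Path S σ ∧ Path (fin S σ) τ := by
  induction σ generalizing S with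
  | nil => simp [Path, fin]
  | cons e σ ih => simp [Path, fin, ih, and_assoc]

theorem NPath_append {S : Finset α} {σ τ : List (α × α)} :
    NPath S (σ ++ τ) ↔ NPath S σ ∧ NPath (fin S σ) τ := by
  induction σ generalizing S with
  | nil => simp [NPath, fin]
  | cons e σ ih => simp [NPath, fin, ih, and_assoc]

theorem fin_append {S : Finset α} {σ τ : List (α × α)} :
    fin S (σ ++ τ) = fin (fin S σ) τ := by
  induction σ generalizing S with
  | nil => simp [fin]
  | cons e σ ih => simp [fin, ih]

theorem cost_append {S : Finset α} {σ τ : List (α × α)} :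
    cost S (σ ++ τ) = cost S σ + cost (fin S σ) τ := by
  induction σ generalizing S with
  | nil => simp [fin, cost]
  | cons e σ ih => simp [fin, cost, ih, add_assoc]

theorem NPath_le {S : Finset α} {β : List (α × α)} (h : Path S β) (h' : NPath S β) :
    Le S (fin S β) := by
  induction β generalizing S with
  | nil => exact Le.refl _
  | cons e β ih => exact (step_srt h.1 h.2.1 h'.1).1.trans (ih h.2.2 h'.2)

theorem NPath_red {S : Finset α} {β : List (α × α)} (h : Path S β) (h' : NPath S β) :
    Red β (canonF S (fin S β)) := by
  induction β generalizing S with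
  | nil => rw [fin, canonF_self]; exact .refl
  | cons e β ih =>
    have h1 := step_srt h.1 h.2.1 h'.1
    have h2 := canonF_trans h1.1 (NPath_le h.2.2 h'.2)
    rw [h1.2] at h2
    exact ((ih h.2.2 h'.2).cons e).trans h2

open Classical in
/-- Normal form, with accumulator. -/
def nfAux : Finset α → Finset α → List (α × α) → List (α × α)
  | S₀, S, [] => canonF S₀ S
  | S₀, S, e :: σ => if Spec S e then canonF S₀ S ++ e :: nfAux (after S e) (after S e) σ
      else nfAux S₀ (after S e) σ

/-- `τ` is obtained from `σ` by replacing some nonspecial blocks by canonical ones. -/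
inductive Rep : Finset α → List (α × α) → List (α × α) → Prop
  | nil (S) : Rep S [] []
  | single (S e σ τ) (h : Rep (after S e) σ τ) : Rep S (e :: σ) (e :: τ)
  | block (S β σ τ) (hβ : NPath S β) (h : Rep (fin S β) σ τ) :
      Rep S (β ++ σ) (canonF S (fin S β) ++ τ)

theorem Rep.append {S : Finset α} {σ τ σ' τ' : List (α × α)} (h : Rep S σ τ)
    (h' : Rep (fin S σ) σ' τ') : Rep S (σ ++ σ') (τ ++ τ') := by
  induction h with
  | nil S => simpa [fin] using h'
  | single S e σ τ h ih => exact .single _ _ _ _ (ih h')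
  | block S β σ τ hβ h ih =>
    rw [fin_append] at h'
    simpa using Rep.block S β _ _ hβ (ih h')

theorem nfAux_npath {S₀ S : Finset α} {β σ : List (α × α)} (h : NPath S β) :
    nfAux S₀ S (β ++ σ) = nfAux S₀ (fin S β) σ := by
  induction β generalizing S with
  | nil => rfl
  | cons e β ih =>
    simp only [List.cons_append, nfAux, if_neg h.1, fin]
    exact ih h.2

theorem Rep.toNF {S : Finset α} {σ τ : List (α × α)} (h : Rep S σ τ) (hp : Path S σ)
    {S₀ : Finset α} (hS : Le S₀ S) : Red (canonF S₀ S ++ τ) (nfAux S₀ S σ) := by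
  induction h generalizing S₀ with
  | nil S => rw [nfAux, List.append_nil]; exact .refl
  | single S e σ τ h ih =>
    by_cases he : Spec S e
    · rw [nfAux, if_pos he]
      have := ih hp.2.2 (Le.refl _)
      rw [canonF_self, List.nil_append] at this
      exact (this.cons e).left _
    · rw [nfAux, if_neg he]
      obtain ⟨h1, h2⟩ := step_srt hp.1 hp.2.1 he
      have h3 := canonF_trans hS h1
      rw [h2] at h3
      have h4 := (h3.right τ).trans (ih hp.2.2 (hS.trans h1))
      simpa using h4
  | block S β σ τ hβ h ih =>
    rw [Path_append] at hp
    rw [nfAux_npath hβ]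
    have h1 := NPath_le hp.1 hβ
    have h3 := ((canonF_trans hS h1).right τ).trans (ih hp.2 (hS.trans h1))
    simpa using h3

theorem Rep.red {S : Finset α} {σ τ : List (α × α)} (h : Rep S σ τ) (hp : Path S σ) :
    Red σ τ := by
  induction h with
  | nil S => exact .refl
  | single S e σ τ h ih => exact (ih hp.2.2).cons e
  | block S β σ τ hβ h ih =>
    rw [Path_append] at hp
    exact ((ih hp.2).left β).trans ((NPath_red hp.1 hβ).right τ)

theorem Rep.refl (S : Finset α) (σ : List (α × α)) : Rep S σ σ := by
  induction σ generalizing S with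
  | nil => exact .nil _
  | cons e σ ih => exact .single _ _ _ _ (ih _)

theorem after_card {S : Finset α} {e : α × α} (h1 : e.1 ∈ S) (h2 : e.2 ∉ S) :
    (after S e).card = S.card := by
  unfold after
  rw [Finset.card_insert_of_notMem (by simp [h2]), Finset.card_erase_of_mem h1]
  have := Finset.card_pos.2 ⟨_, h1⟩
  omega

theorem fin_card {S : Finset α} {σ : List (α × α)} (h : Path S σ) : (fin S σ).card = S.card := by
  induction σ generalizing S with
  | nil => rfl
  | cons e σ ih => rw [fin, ih h.2.2, after_card h.1 h.2.1]

theorem spec_cost {S : Finset α} {e : α × α} {σ : List (α × α)} (h : Spec S e) :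
    1 + cost (after S e) σ ≤ cost S (e :: σ) := by
  rw [cost]
  rcases h with h | ⟨x, hx, h⟩
  · rw [if_pos h]; omega
  · have : 0 < (S.filter (InOpen e.1 e.2)).card := by
      rw [Finset.card_pos]
      exact ⟨x, Finset.mem_filter.2 ⟨hx, .inl h⟩⟩
    omega

/-- Simultaneous bounded representation for two synchronised configurations. -/
theorem exists_rep_pair (P : Finset α → Finset α → List (α × α) → Prop)
    (hP1 : ∀ S T e σ, P S T (e :: σ) → P (after S e) (after T e) σ)
    (hP2 : ∀ S T β γ, P S T (β ++ γ) → NPath S β → NPath T β →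
      canonF S (fin S β) = canonF T (fin T β))
    (k : ℕ) (v : List (α × α)) (S T : Finset α) (hPst : P S T v) (hS : Path S v)
    (hk : S.card = k) :
    ∃ β γ τ, v = β ++ γ ∧ NPath S β ∧ NPath T β ∧ Rep (fin S β) γ τ ∧ Rep (fin T β) γ τ ∧
      τ.length ≤ (cost S v + cost T v) * (k + 1) := by
  induction v generalizing S T with
  | nil => exact ⟨[], [], [], rfl, trivial, trivial, .nil _, .nil _, by simp⟩
  | cons e v ih =>
    have hk' : (after S e).card = k := by rw [after_card hS.1 hS.2.1, hk]
    obtain ⟨β, γ, τ, h1, h2, h3, h4, h5, h6⟩ := ih _ _ (hP1 _ _ _ _ hPst) hS.2.2 hk'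
    by_cases he : Spec S e ∨ Spec T e
    · refine ⟨[], e :: v, e :: (canonF (after S e) (fin (after S e) β) ++ τ), rfl, trivial, trivial,
        .single _ _ _ _ ?_, .single _ _ _ _ ?_, ?_⟩
      · rw [h1]; exact .block _ _ _ _ h2 h4
      · rw [h1, hP2 _ _ β γ (h1 ▸ hP1 _ _ _ _ hPst) h2 h3]; exact .block _ _ _ _ h3 h5
      · have h7 := canonF_length (after S e) (fin (after S e) β)
        rw [hk'] at h7
        have h8 : 1 + (cost (after S e) v + cost (after T e) v) ≤
            cost S (e :: v) + cost T (e :: v) := by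
          have a1 : cost (after S e) v ≤ cost S (e :: v) := by simp [cost]
          have a2 : cost (after T e) v ≤ cost T (e :: v) := by simp [cost]
          rcases he with he | he
          · have := spec_cost (σ := v) he
            omega
          · have := spec_cost (σ := v) he
            omega
        have h9 := Nat.mul_le_mul_right (k + 1) h8
        simp only [List.length_cons, List.length_append]
        rw [add_mul, one_mul] at h9
        omega
    · rw [not_or] at he
      refine ⟨e :: β, γ, τ, by simp [h1], ⟨he.1, h2⟩, ⟨he.2, h3⟩, h4, h5, h6.trans ?_⟩
      refine Nat.mul_le_mul_right _ (Nat.add_le_add ?_ ?_) <;> simp [cost]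

theorem exists_rep_pair' (P : Finset α → Finset α → List (α × α) → Prop)
    (hP1 : ∀ S T e σ, P S T (e :: σ) → P (after S e) (after T e) σ)
    (hP2 : ∀ S T β γ, P S T (β ++ γ) → NPath S β → NPath T β →
      canonF S (fin S β) = canonF T (fin T β))
    (v : List (α × α)) (S T : Finset α) (hPst : P S T v) (hS : Path S v) :
    ∃ τ, Rep S v τ ∧ Rep T v τ ∧
      τ.length ≤ (cost S v + cost T v) * (S.card + 1) + S.card := by
  obtain ⟨β, γ, τ, h1, h2, h3, h4, h5, h6⟩ := exists_rep_pair P hP1 hP2 _ v S T hPst hS rfl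
  refine ⟨canonF S (fin S β) ++ τ, ?_, ?_, ?_⟩
  · rw [h1]; exact .block _ _ _ _ h2 h4
  · rw [h1, hP2 _ _ β γ (h1 ▸ hPst) h2 h3]; exact .block _ _ _ _ h3 h5
  · have h7 := canonF_length S (fin S β)
    rw [List.length_append]
    omega

theorem exists_rep {v : List (α × α)} {S : Finset α} (hS : Path S v) :
    ∃ τ, Rep S v τ ∧ τ.length ≤ (cost S v + cost S v) * (S.card + 1) + S.card := by
  obtain ⟨τ, h1, _, h2⟩ := exists_rep_pair' (fun S T _ => S = T)
    (by rintro S T e σ rfl; rfl) (by rintro S T β γ rfl _ _; rfl) v S S rfl hS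
  exact ⟨τ, h1, h2⟩

theorem path_count {S : Finset α} {σ : List (α × α)} (h : Path S σ) (x : α) :
    (if x ∈ S then 1 else 0) + (snds σ).count x = (if x ∈ fin S σ then 1 else 0) + (fsts σ).count x := by
  induction σ generalizing S with
  | nil => rfl
  | cons e σ ih =>
    obtain ⟨a, b⟩ := e
    obtain ⟨h1, h2, h3⟩ := h
    have ih := ih h3
    rw [fin]
    generalize fin (after S (a, b)) σ = F at *
    simp only [snds, fsts, List.map_cons, List.count_cons, beq_iff_eq] at *
    have hab : a ≠ b := by rintro rfl; exact h2 h1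
    simp only [after, Finset.mem_insert, Finset.mem_erase] at ih
    by_cases hxa : a = x
    · subst hxa
      simp [h1, hab, hab.symm] at ih ⊢
      omega
    · by_cases hxb : b = x
      · subst hxb
        simp [h2, hab] at ih ⊢
        omega
      · simp [hxa, hxb, Ne.symm hxa, Ne.symm hxb] at ih ⊢
        exact ih

theorem fin_eq_self {S : Finset α} {σ : List (α × α)} (h : Path S σ) (hv : Valid σ) :
    fin S σ = S := by
  ext x
  have h1 := path_count h x
  rw [hv.2.1.count_eq x] at h1
  by_cases h2 : x ∈ S <;> by_cases h3 : x ∈ fin S σ <;> simp [h2, h3] at h1 ⊢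

theorem cfg0_sub (σ : List (α × α)) : ∀ x ∈ cfg0 σ, x ∈ fsts σ := by
  induction σ with
  | nil => simp [cfg0]
  | cons e σ ih =>
    intro x hx
    simp only [cfg0, Finset.mem_insert, Finset.mem_erase] at hx
    simp only [fsts, List.map_cons, List.mem_cons]
    rcases hx with rfl | hx
    · exact .inl rfl
    · exact .inr (ih x hx.2)

theorem mem_iff_cfg0 {S : Finset α} {σ : List (α × α)} (h : Path S σ) :
    ∀ x ∈ fsts σ, (x ∈ S ↔ x ∈ cfg0 σ) := by
  induction σ generalizing S with
  | nil => simp [fsts]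
  | cons e σ ih =>
    obtain ⟨a, b⟩ := e
    obtain ⟨h1, h2, h3⟩ := h
    intro x hx
    simp only [fsts, List.map_cons, List.mem_cons] at hx
    simp only [cfg0, Finset.mem_insert, Finset.mem_erase] at *
    by_cases hxa : x = a
    · subst hxa; simp [h1]
    · have := ih h3 x (hx.resolve_left hxa)
      simp only [after, Finset.mem_insert, Finset.mem_erase] at this
      by_cases hxb : x = b
      · subst hxb; simp [h2, hxa]
      · simpa [hxa, hxb] using this

theorem path_unique {S : Finset α} {σ : List (α × α)} (h : Path S σ) (hs : ∀ x ∈ S, x ∈ fsts σ) :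
    S = cfg0 σ := by
  ext x
  by_cases hx : x ∈ fsts σ
  · exact mem_iff_cfg0 h x hx
  · exact iff_of_false (fun h => hx (hs x h)) (fun h => hx (cfg0_sub σ x h))

theorem path_of_cfg0 {S : Finset α} {σ : List (α × α)} (h1 : (fsts σ).Nodup) (h2 : (snds σ).Nodup)
    (h3 : ∀ e ∈ σ, e.1 ≠ e.2) (hS : cfg0 σ ⊆ S) (hS' : ∀ x ∈ S, x ∈ snds σ → x ∈ cfg0 σ) :
    Path S σ := by
  induction σ generalizing S with
  | nil => trivial
  | cons e σ ih =>
    obtain ⟨a, b⟩ := e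
    have hab : a ≠ b := h3 (a, b) (by simp)
    simp only [fsts, snds, List.map_cons, List.nodup_cons, cfg0] at *
    refine ⟨hS (by simp), ?_, ?_⟩
    · intro hb
      have := hS' b hb (by simp)
      simp [hab.symm] at this
    · refine ih h1.2 h2.2 (fun e he => h3 e (by simp [he])) ?_ ?_
      · intro x hx
        have hxa : x ≠ a := by
          rintro rfl
          exact h1.1 (cfg0_sub σ _ hx)
        simp only [after, Finset.mem_insert, Finset.mem_erase]
        by_cases hxb : x = b
        · exact .inl hxb
        · exact .inr ⟨hxa, hS (by simp [hxb, hx])⟩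
      · intro x hx hx'
        simp only [after, Finset.mem_insert, Finset.mem_erase] at hx
        rcases hx with rfl | ⟨h4, h5⟩
        · exact absurd hx' h2.1
        · have := hS' x h5 (by simp [hx'])
          simp only [Finset.mem_insert, Finset.mem_erase] at this
          exact (this.resolve_left h4).2

theorem Valid.path {σ : List (α × α)} (h : Valid σ) : Path (cfg0 σ) σ :=
  path_of_cfg0 h.1 (h.2.1.nodup_iff.1 h.1) h.2.2 subset_rfl fun _ h _ => h

/-- Normal form. -/
def nf (σ : List (α × α)) : List (α × α) := nfAux (cfg0 σ) (cfg0 σ) σ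

theorem Rep.nf {σ τ : List (α × α)} (h : Rep (cfg0 σ) σ τ) (hv : Valid σ) : Red τ (nf σ) := by
  have := h.toNF hv.path (Le.refl _)
  rwa [canonF_self, List.nil_append] at this

end L
end RD

namespace RD
section L
variable {α : Type*} [LinearOrder α]
set_option linter.unusedSectionVars false

theorem card_filter_after (p : α → Prop) [DecidablePred p] {S : Finset α} {e : α × α}
    (h1 : e.1 ∈ S) (h2 : e.2 ∉ S) :
    ((after S e).filter p).card + (if p e.1 then 1 else 0) =
      (S.filter p).card + (if p e.2 then 1 else 0) := by
  obtain ⟨a, b⟩ := e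
  simp only [after] at *
  have e1 : (S.filter p).card = ((S.erase a).filter p).card + (if p a then 1 else 0) := by
    conv_lhs => rw [← Finset.insert_erase h1, Finset.filter_insert]
    split_ifs
    · rw [Finset.card_insert_of_notMem (by simp)]
    · simp
  have e2 : ((insert b (S.erase a)).filter p).card =
      ((S.erase a).filter p).card + (if p b then 1 else 0) := by
    rw [Finset.filter_insert]
    split_ifs
    · rw [Finset.card_insert_of_notMem (by simp [h2])]
    · simp
  omega

theorem card_filter_insert (p : α → Prop) [DecidablePred p] {S : Finset α} {x : α} (h : x ∉ S) :
    ((insert x S).filter p).card = (S.filter p).card + (if p x then 1 else 0) := by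
  rw [Finset.filter_insert]
  split_ifs
  · rw [Finset.card_insert_of_notMem (by simp [h])]
  · simp

theorem InOpen.iff_of {a b h x : α} (hh : InOpen a b h) (hx : x ≠ h) :
    InOpen a b x ↔ (InOpen a h x ∨ InOpen h b x) := by
  unfold InOpen at *; grind

theorem InOpen.excl {a b h x : α} (hh : InOpen a b h) :
    ¬ (InOpen a h x ∧ InOpen h b x) := by
  unfold InOpen at *; grind

theorem arc_card {a b h : α} (hh : InOpen a b h) {S : Finset α} (hS : h ∉ S) :
    (S.filter (InOpen a b)).card = (S.filter (InOpen a h)).card + (S.filter (InOpen h b)).card := by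
  rw [← Finset.card_union_of_disjoint, ← Finset.filter_or]
  · congr 1
    apply Finset.filter_congr
    intro x hx
    exact hh.iff_of (by rintro rfl; exact hS hx)
  · rw [Finset.disjoint_filter]
    intro x _ h1 h2
    exact hh.excl ⟨h1, h2⟩

theorem wrap_add {a b h : α} (hh : InOpen a b h) :
    (if b < a then 1 else 0) = (if h < a then 1 else 0) + (if b < h then 1 else 0) := by
  unfold InOpen at hh
  split_ifs <;> grind

theorem mem_fin_of {S : Finset α} {u : List (α × α)} {x : α} (h : x ∈ S) (hu : x ∉ fsts u) :
    x ∈ fin S u := by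
  induction u generalizing S with
  | nil => exact h
  | cons e u ih =>
    simp only [fsts, List.map_cons, List.mem_cons, not_or] at hu
    exact ih (by simp [after, h, hu.1]) hu.2

theorem mem_of_fin {S : Finset α} {u : List (α × α)} {x : α} (h : x ∈ fin S u) :
    x ∈ S ∨ x ∈ snds u := by
  induction u generalizing S with
  | nil => exact .inl h
  | cons e u ih =>
    simp only [snds, List.map_cons, List.mem_cons]
    rcases ih h with h | h
    · simp only [after, Finset.mem_insert, Finset.mem_erase] at h
      tauto
    · exact .inr (.inr h)

/-- The height is not touched by the list. -/
def Unt (x : α) (v : List (α × α)) : Prop := ∀ e ∈ v, e.1 ≠ x ∧ e.2 ≠ x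

theorem Unt.mk' {x : α} {v : List (α × α)} (h1 : x ∉ fsts v) (h2 : x ∉ snds v) : Unt x v := by
  intro e he
  constructor
  · rintro rfl; exact h1 (List.mem_map_of_mem he)
  · rintro rfl; exact h2 (List.mem_map_of_mem he)

theorem after_insert {P : Finset α} {x : α} {e : α × α} (h : e.1 ≠ x) :
    after (insert x P) e = insert x (after P e) := by
  unfold after
  rw [Finset.erase_insert_of_ne h.symm, Finset.insert_comm]

theorem path_insert {P : Finset α} {x : α} {v : List (α × α)} (hx : x ∉ P) (h : Unt x v) :
    (Path (insert x P) v ↔ Path P v) ∧ fin (insert x P) v = insert x (fin P v) ∧ x ∉ fin P v := by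
  induction v generalizing P with
  | nil => simp [Path, fin, hx]
  | cons e v ih =>
    have h1 := h e (by simp)
    have hx' : x ∉ after P e := by simp [after, h1.2.symm, hx]
    have := ih hx' (fun e he => h e (by simp [he]))
    simp only [Path, fin, after_insert h1.1, this, Finset.mem_insert, h1.1, h1.2, false_or, true_and]
    exact not_false

theorem path_filter (p : α → Prop) [DecidablePred p] {S : Finset α} {u : List (α × α)}
    (hu : Path S u) (h : ∀ e ∈ u, ¬ p e.1 ∧ ¬ p e.2) :
    ((fin S u).filter p).card = (S.filter p).card := by
  induction u generalizing S with
  | nil => rfl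
  | cons e u ih =>
    have h1 := h e (by simp)
    have h2 := card_filter_after p hu.1 hu.2.1
    rw [if_neg h1.1, if_neg h1.2] at h2
    rw [fin, ih hu.2.2 (fun e he => h e (by simp [he]))]
    exact h2

theorem four_pt {c d h h' : α} (h1 : c ≠ d) (h2 : c ≠ h) (h3 : c ≠ h') (h4 : d ≠ h) (h5 : d ≠ h') :
    (if InOpen c d h then 1 else 0) + (if InOpen h h' c then 1 else 0) =
    (if InOpen c d h' then 1 else 0) + (if InOpen h h' d then 1 else 0) := by
  unfold InOpen
  rcases lt_or_gt_of_ne h1 with h1 | h1 <;> rcases lt_or_gt_of_ne h2 with h2 | h2 <;>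
  rcases lt_or_gt_of_ne h3 with h3 | h3 <;> rcases lt_or_gt_of_ne h4 with h4 | h4 <;>
  rcases lt_or_gt_of_ne h5 with h5 | h5 <;> rcases lt_trichotomy h h' with h6 | h6 | h6 <;>
  first
  | (exfalso; order)
  | simp [*, not_lt_of_gt]

theorem cost_insert {h h' : α} {P : Finset α} {v : List (α × α)} (hP : h ∉ P) (hP' : h' ∉ P)
    (hv : Path P v) (hu : Unt h v) (hu' : Unt h' v) :
    cost (insert h P) v + (P.filter (InOpen h h')).card =
      cost (insert h' P) v + ((fin P v).filter (InOpen h h')).card := by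
  induction v generalizing P with
  | nil => simp [cost, fin]
  | cons e v ih =>
    have h1 := hu e (by simp)
    have h1' := hu' e (by simp)
    have hx : h ∉ after P e := by simp [after, h1.2.symm, hP]
    have hx' : h' ∉ after P e := by simp [after, h1'.2.symm, hP']
    have ih := ih hx hx' hv.2.2 (fun e he => hu e (by simp [he])) (fun e he => hu' e (by simp [he]))
    have h2 := card_filter_after (InOpen h h') hv.1 hv.2.1
    have h3 := four_pt (c := e.1) (d := e.2) (h := h) (h' := h')
      (fun h => hv.2.1 (h ▸ hv.1)) h1.1 h1'.1 h1.2 h1'.2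
    simp only [cost, fin, after_insert h1.1, after_insert h1'.1,
      card_filter_insert _ hP, card_filter_insert _ hP']
    omega

theorem canonF_insert {h : α} {Q : Finset α} {β : List (α × α)} (hQ : h ∉ Q) (hp : Path Q β)
    (hu : Unt h β) (hn : NPath (insert h Q) β) :
    canonF (insert h Q) (fin (insert h Q) β) = canonF Q (fin Q β) := by
  obtain ⟨-, h2, h3⟩ := path_insert hQ hu
  have key : ((fin Q β).filter (h < ·)).card = (Q.filter (h < ·)).card := by
    clear h2 h3
    induction β generalizing Q with
    | nil => rfl
    | cons e β ih =>
      have h1 := hu e (by simp)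
      have hx : h ∉ after Q e := by simp [after, h1.2.symm, hQ]
      have hn2 := hn.2
      rw [after_insert h1.1] at hn2
      rw [fin, ih hx hp.2.2 (fun e he => hu e (by simp [he])) hn2]
      have h2 := card_filter_after (h < ·) hp.1 hp.2.1
      have h3 := hn.1
      simp only [Spec, not_or, not_lt, not_exists, not_and] at h3
      have h4 := h3.2 h (by simp)
      have h5 : (h < e.1) ↔ (h < e.2) := by
        constructor
        · intro h5; exact lt_of_lt_of_le h5 h3.1
        · intro h5
          by_contra h6
          exact absurd (h4 (lt_of_le_of_ne (not_lt.1 h6) h1.1)) (not_le.2 h5)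
      simp only [h5] at h2
      omega
  unfold canonF
  rw [h2, srt_insert hQ, srt_insert h3, srt_split hQ, srt_split h3]
  rw [canonL_append, canonL_append]
  · simp [canonL]
  · rw [srt_length, srt_length, key]
  · rw [srt_length, srt_length, key]

theorem exists_rep_ins {h h' : α} {P : Finset α} {v : List (α × α)} (hP : h ∉ P) (hP' : h' ∉ P)
    (hv : Path P v) (hu : Unt h v) (hu' : Unt h' v) :
    ∃ τ, Rep (insert h P) v τ ∧ Rep (insert h' P) v τ ∧
      τ.length ≤ (cost (insert h P) v + cost (insert h' P) v) * (P.card + 1 + 1) + (P.card + 1) := by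
  have := exists_rep_pair' (fun S T v => ∃ Q, h ∉ Q ∧ h' ∉ Q ∧ S = insert h Q ∧ T = insert h' Q ∧
    Unt h v ∧ Unt h' v ∧ Path Q v) ?_ ?_ v (insert h P) (insert h' P) ?_ ?_
  · rwa [Finset.card_insert_of_notMem hP] at this
  · rintro S T e σ ⟨Q, h1, h2, rfl, rfl, h3, h4, h5⟩
    have a1 := h3 e (by simp)
    have a2 := h4 e (by simp)
    refine ⟨after Q e, ?_, ?_, after_insert a1.1, after_insert a2.1,
      fun e he => h3 e (by simp [he]), fun e he => h4 e (by simp [he]), h5.2.2⟩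
    · simp [after, h1, a1.2.symm]
    · simp [after, h2, a2.2.symm]
  · rintro S T β γ ⟨Q, h1, h2, rfl, rfl, h3, h4, h5⟩ n1 n2
    rw [Path_append] at h5
    rw [canonF_insert h1 h5.1 (fun e he => h3 e (by simp [he])) n1,
      canonF_insert h2 h5.1 (fun e he => h4 e (by simp [he])) n2]
  · exact ⟨P, hP, hP', rfl, rfl, hu, hu', hv⟩
  · exact (path_insert hP hu).1.2 hv

theorem Red1.heights {σ τ : List (α × α)} (h : Red1 σ τ) (p : α → Prop)
    (hp : ∀ e ∈ σ, p e.1 ∧ p e.2) : ∀ e ∈ τ, p e.1 ∧ p e.2 := by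
  cases h with
  | swap u v x y h =>
    intro e he
    simp only [List.mem_append, List.mem_cons] at he hp
    exact hp e (by tauto)
  | merge u v a m b h =>
    intro e he
    simp only [List.mem_append, List.mem_cons] at he hp
    rcases he with he | rfl | he
    · exact hp e (.inl he)
    · exact ⟨(hp (a, m) (by simp)).1, (hp (m, b) (by simp)).2⟩
    · exact hp e (by tauto)

theorem Red.heights {σ τ : List (α × α)} (h : Red σ τ) (p : α → Prop)
    (hp : ∀ e ∈ σ, p e.1 ∧ p e.2) : ∀ e ∈ τ, p e.1 ∧ p e.2 := by
  induction h with
  | refl => exact hp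
  | tail _ h ih => exact h.heights p ih

/-- Length bound. -/
def bnd (C k : ℕ) : ℕ := 4 * (C * (k + 1)) + 2 * k + 3

theorem bnd_aux {C k c1 c2 l1 l2 : ℕ} (h1 : l1 ≤ c1 * (k + 1) + k) (h2 : l2 ≤ c2 * (k + 1) + k)
    (hc1 : c1 ≤ 2 * C) (hc2 : c2 ≤ 2 * C) {n : ℕ} (hn : n ≤ 3) : l1 + l2 + n ≤ bnd C k := by
  have a1 := Nat.mul_le_mul_right (k + 1) hc1
  have a2 := Nat.mul_le_mul_right (k + 1) hc2
  unfold bnd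
  rw [mul_assoc] at a1 a2
  omega

/-- The conclusion of the step theorem. -/
def Conn (σ σ' : List (α × α)) : Prop :=
  ∃ τ τ', Rep (cfg0 σ) σ τ ∧ Rep (cfg0 σ') σ' τ' ∧ Step0 τ τ' ∧
    cost (cfg0 σ) σ = cost (cfg0 σ') σ' ∧ (cfg0 σ).card = (cfg0 σ').card ∧
    τ.length ≤ bnd (cost (cfg0 σ) σ) (cfg0 σ).card ∧
    τ'.length ≤ bnd (cost (cfg0 σ) σ) (cfg0 σ).card

theorem conn_swap (u v : List (α × α)) (x y : α × α) (h : Unlinked x y)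
    (hv : Valid (u ++ x :: y :: v)) : Conn (u ++ x :: y :: v) (u ++ y :: x :: v) := by
  have hp := hv.path
  have hsub := cfg0_sub (u ++ x :: y :: v)
  set S := cfg0 (u ++ x :: y :: v) with hS
  have hp0 := hp
  rw [Path_append] at hp
  obtain ⟨pu, x1, x2, y1, y2, pv⟩ := hp
  obtain ⟨n1, n2, n3, n4, n5⟩ := id h
  have y1' : y.1 ∈ fin S u := by
    simp only [after, Finset.mem_insert, Finset.mem_erase] at y1; tauto
  have y2' : y.2 ∉ fin S u := by
    simp only [after, Finset.mem_insert, Finset.mem_erase] at y2; tauto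
  have hc : after (after (fin S u) y) x = after (after (fin S u) x) y := by
    ext z
    simp only [after, Finset.mem_insert, Finset.mem_erase]
    grind
  have pv' := pv
  rw [← hc] at pv'
  have x1' : x.1 ∈ after (fin S u) y := by simp [after, x1, n1.symm]
  have x2' : x.2 ∉ after (fin S u) y := by simp [after, x2, n4.symm]
  have hp' : Path S (u ++ y :: x :: v) := by
    rw [Path_append]
    exact ⟨pu, y1', y2', x1', x2', pv'⟩
  have hS' : S = cfg0 (u ++ y :: x :: v) := by
    refine path_unique hp' fun z hz => ?_
    have := hsub z hz
    simp only [fsts, List.map_append, List.map_cons, List.mem_append, List.mem_cons] at this ⊢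
    tauto
  have hcost : cost S (u ++ x :: y :: v) = cost S (u ++ y :: x :: v) := by
    rw [cost_append, cost_append]
    simp only [cost]
    rw [hc]
    have c1 := card_filter_after (InOpen x.1 x.2) y1' y2'
    have c2 := card_filter_after (InOpen y.1 y.2) x1 x2
    simp only [n5] at c1
    simp only [h.symm.2.2.2.2] at c2
    omega
  obtain ⟨τu, ru, lu⟩ := exists_rep pu
  obtain ⟨τv, rv, lv⟩ := exists_rep pv
  have hkv : (after (after (fin S u) x) y).card = S.card := by
    rw [after_card y1 y2, after_card x1 x2, fin_card pu]
  rw [hkv] at lv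
  have hlen : τu.length + τv.length + 2 ≤ bnd (cost S (u ++ x :: y :: v)) S.card := by
    refine bnd_aux lu lv ?_ ?_ (by norm_num)
    · rw [cost_append]; omega
    · rw [cost_append]; simp only [cost]; omega
  unfold Conn
  rw [← hS, ← hS']
  refine ⟨τu ++ x :: y :: τv, τu ++ y :: x :: τv, ru.append (.single _ _ _ _ (.single _ _ _ _ rv)),
    ru.append (.single _ _ _ _ (.single _ _ _ _ (hc ▸ rv))), .red _ _ (.swap _ _ _ _ h), hcost, rfl,
    ?_, ?_⟩
  · simp only [List.length_append, List.length_cons]; omega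
  · simp only [List.length_append, List.length_cons]; omega

theorem conn_merge (u v : List (α × α)) (a m b : α) (h : InOpen a b m)
    (hv : Valid (u ++ (a, m) :: (m, b) :: v)) :
    Conn (u ++ (a, m) :: (m, b) :: v) (u ++ (a, b) :: v) := by
  have hp := hv.path
  have hsub := cfg0_sub (u ++ (a, m) :: (m, b) :: v)
  set S := cfg0 (u ++ (a, m) :: (m, b) :: v) with hS
  have hp0 := hp
  rw [Path_append] at hp
  obtain ⟨pu, x1, x2, y1, y2, pv⟩ := hp
  obtain ⟨n1, n2, n3⟩ := h.ne
  simp only at x1 x2 y1 y2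
  have y2' : b ∉ fin S u := by
    simp only [after, Finset.mem_insert, Finset.mem_erase] at y2; tauto
  have hc : after (after (fin S u) (a, m)) (m, b) = after (fin S u) (a, b) := by
    ext z
    simp only [after, Finset.mem_insert, Finset.mem_erase]
    grind
  have pv' := pv
  rw [hc] at pv'
  have hp' : Path S (u ++ (a, b) :: v) := by
    rw [Path_append]
    exact ⟨pu, x1, y2', pv'⟩
  have hS' : S = cfg0 (u ++ (a, b) :: v) := by
    refine path_unique hp' fun z hz => ?_
    have h1 := hsub z hz
    have h2 := hv.1
    simp only [fsts, List.map_append, List.map_cons, List.mem_append, List.mem_cons] at h1 ⊢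
    have h3 : z ≠ m := by
      rintro rfl
      refine x2 (mem_fin_of hz ?_)
      simp only [fsts, List.map_append, List.map_cons] at h2 ⊢
      rw [List.nodup_append] at h2
      intro h3
      exact h2.2.2 _ h3 z (by simp) rfl
    tauto
  have hcost : cost S (u ++ (a, m) :: (m, b) :: v) = cost S (u ++ (a, b) :: v) := by
    rw [cost_append, cost_append]
    simp only [cost]
    rw [hc]
    have c1 := card_filter_after (e := (a, m)) (InOpen m b) x1 x2
    have c2 := arc_card h x2
    have c3 := wrap_add h
    have c4 : ¬ InOpen m b m := by unfold InOpen; grind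
    have c5 : ¬ InOpen m b a := by unfold InOpen at *; grind
    simp only [c4, c5] at c1
    eta_reduce at *
    simp only [if_false] at c1
    omega
  obtain ⟨τu, ru, lu⟩ := exists_rep pu
  obtain ⟨τv, rv, lv⟩ := exists_rep pv
  have hkv : (after (after (fin S u) (a, m)) (m, b)).card = S.card := by
    rw [after_card y1 y2, after_card x1 x2, fin_card pu]
  rw [hkv] at lv
  have hlen : τu.length + τv.length + 2 ≤ bnd (cost S (u ++ (a, m) :: (m, b) :: v)) S.card := by
    refine bnd_aux lu lv ?_ ?_ (by norm_num)
    · rw [cost_append]; omega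
    · rw [cost_append]; simp only [cost]; omega
  unfold Conn
  rw [← hS, ← hS']
  refine ⟨τu ++ (a, m) :: (m, b) :: τv, τu ++ (a, b) :: τv,
    ru.append (.single _ _ _ _ (.single _ _ _ _ rv)),
    ru.append (.single _ _ _ _ (hc ▸ rv)), .red _ _ (.merge _ _ _ _ _ h), hcost, rfl,
    ?_, ?_⟩
  · simp only [List.length_append, List.length_cons]; omega
  · simp only [List.length_append, List.length_cons]; omega

theorem conn_rot (x : α × α) (v : List (α × α)) (hv : Valid (x :: v)) :
    Conn (x :: v) (v ++ [x]) := by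
  have hp := hv.path
  have hsub := cfg0_sub (x :: v)
  have hfin := fin_eq_self hp hv
  set S := cfg0 (x :: v) with hS
  obtain ⟨x1, x2, pv⟩ := id hp
  rw [fin] at hfin
  have hp' : Path (after S x) (v ++ [x]) := by
    rw [Path_append, hfin]
    exact ⟨pv, x1, x2, trivial⟩
  have hS' : after S x = cfg0 (v ++ [x]) := by
    refine path_unique hp' fun z hz => ?_
    have h1 : z ∈ fsts (x :: v) := by
      simp only [after, Finset.mem_insert, Finset.mem_erase] at hz
      rcases hz with rfl | hz
      · rw [hv.2.1.mem_iff]; simp [snds]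
      · exact hsub z hz.2
    simp only [fsts, List.map_append, List.map_cons, List.mem_append, List.mem_cons] at h1 ⊢
    tauto
  have hcost : cost S (x :: v) = cost (after S x) (v ++ [x]) := by
    rw [cost_append, hfin]
    simp only [cost]
    omega
  obtain ⟨τv, rv, lv⟩ := exists_rep pv
  have hkv : (after S x).card = S.card := after_card x1 x2
  rw [hkv] at lv
  have hlen : 0 + τv.length + 1 ≤ bnd (cost S (x :: v)) S.card := by
    refine bnd_aux (c1 := 0) (by simp) lv (by simp) ?_ (by norm_num)
    simp only [cost]; omega
  unfold Conn
  rw [← hS, ← hS']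
  refine ⟨x :: τv, τv ++ [x], .single _ _ _ _ rv, rv.append (Rep.refl _ _), .rot _ _, hcost, hkv.symm,
    ?_, ?_⟩
  · simp only [List.length_cons]; omega
  · simp only [List.length_append, List.length_singleton]; omega

set_option maxHeartbeats 1000000 in
theorem conn_bigex (h h' a b : α) (u v : List (α × α))
      (hu : ∀ e ∈ u, ¬ InClosed h h' e.1 ∧ ¬ InClosed h h' e.2)
      (ha : ¬ InClosed h h' a) (hb : ¬ InClosed h h' b)
      (hv : Valid ((h, b) :: (u ++ (a, h) :: v))) (hv' : Valid ((h', b) :: (u ++ (a, h') :: v))) :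
    Conn ((h, b) :: (u ++ (a, h) :: v)) ((h', b) :: (u ++ (a, h') :: v)) := by
  have hp := hv.path
  have hsub := cfg0_sub ((h, b) :: (u ++ (a, h) :: v))
  have hfin := fin_eq_self hp hv
  set S := cfg0 ((h, b) :: (u ++ (a, h) :: v)) with hS
  obtain ⟨x1, x2, pv⟩ := id hp
  simp only at x1 x2
  rw [Path_append] at pv
  obtain ⟨pu, y1, y2, pv⟩ := pv
  simp only [fin, fin_append] at hfin
  simp only at y1 y2
  have hN := hv.1
  have hN' := hv'.1
  have hM := hv.2.1.nodup_iff.1 hN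
  have hM' := hv'.2.1.nodup_iff.1 hN'
  simp only [fsts, snds, List.map_append, List.map_cons, List.nodup_cons, List.nodup_append,
    List.mem_append, List.mem_cons] at hN hN' hM hM'
  have uth : Unt h u := Unt.mk' (by unfold fsts; tauto) (by
    unfold snds; intro h1; exact hM.2.2.2 _ h1 _ (.inl rfl) rfl)
  have uth' : Unt h' u := Unt.mk' (by unfold fsts; tauto) (by
    unfold snds; intro h1; exact hM'.2.2.2 _ h1 _ (.inl rfl) rfl)
  have vth : Unt h v := Unt.mk' (by unfold fsts; tauto) (by unfold snds; tauto)
  have vth' : Unt h' v := Unt.mk' (by unfold fsts; tauto) (by unfold snds; tauto)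
  have hba : b ≠ h := by rintro rfl; exact x2 x1
  have hb' : b ≠ h' := by rintro rfl; exact hb (.inr (.inr rfl))
  have hah : a ≠ h := by rintro rfl; exact y2 y1
  have hah' : a ≠ h' := by rintro rfl; exact ha (.inr (.inr rfl))
  set Q := S.erase h with hQ
  have hSQ : S = insert h Q := (Finset.insert_erase x1).symm
  have hhQ : h ∉ Q := by simp [hQ]
  have hbQ : b ∉ Q := by simp [hQ, x2]
  have hh'Q : h' ∉ Q := by
    intro h1
    rw [hQ, Finset.mem_erase] at h1
    have := hsub _ h1.2
    simp only [fsts, List.map_append, List.map_cons, List.mem_append, List.mem_cons] at this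
    tauto
  have hS1 : after S (h, b) = insert b Q := rfl
  rw [hS1] at pu y1 y2 pv hfin
  set S2 := fin (insert b Q) u with hS2
  set P := S2.erase a with hP
  have hS2P : S2 = insert a P := (Finset.insert_erase y1).symm
  have hhP : h ∉ P := by simp [hP, y2]
  have hh'S2 : h' ∉ S2 := by
    intro h1
    rcases mem_of_fin h1 with h1 | h1
    · simp only [Finset.mem_insert] at h1
      rcases h1 with h1 | h1
      · exact hb' h1.symm
      · exact hh'Q h1
    · obtain ⟨e, he, rfl⟩ := List.mem_map.1 h1
      exact (uth' e he).2 rfl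
  have hh'P : h' ∉ P := by simp [hP, hh'S2]
  have haP : a ∉ P := by simp [hP]
  have hS3 : after S2 (a, h) = insert h P := rfl
  have hS3' : after S2 (a, h') = insert h' P := rfl
  rw [hS3] at pv hfin
  obtain ⟨i1, i2, i3⟩ := path_insert hhP vth
  have pP := i1.1 pv
  have hfinP : fin P v = Q := by
    have : insert h (fin P v) = insert h Q := by rw [← i2, hfin, hSQ]
    rw [← Finset.erase_insert i3, this, Finset.erase_insert hhQ]
  have pv' := (path_insert hh'P vth').1.2 pP
  have hS1' : after (insert h' Q) (h', b) = insert b Q := by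
    unfold after
    simp only
    rw [Finset.erase_insert hh'Q]
  have hp' : Path (insert h' Q) ((h', b) :: (u ++ (a, h') :: v)) := by
    refine ⟨by simp, by simp [hb', hbQ], ?_⟩
    rw [hS1', Path_append]
    exact ⟨pu, y1, hh'S2, pv'⟩
  have hS' : insert h' Q = cfg0 ((h', b) :: (u ++ (a, h') :: v)) := by
    refine path_unique hp' fun z hz => ?_
    simp only [Finset.mem_insert, hQ, Finset.mem_erase] at hz
    rcases hz with rfl | hz
    · simp [fsts]
    · have h1 := hsub z hz.2
      simp only [fsts, List.map_append, List.map_cons, List.mem_append, List.mem_cons] at h1 ⊢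
      tauto
  have hSc : S.card = Q.card + 1 := by rw [hSQ, Finset.card_insert_of_notMem hhQ]
  have hPc : P.card + 1 = S.card := by
    have h1 := fin_card pu
    rw [← hS2, hS2P, Finset.card_insert_of_notMem haP, Finset.card_insert_of_notMem hbQ] at h1
    omega
  have hcost : cost S ((h, b) :: (u ++ (a, h) :: v)) =
      cost (insert h' Q) ((h', b) :: (u ++ (a, h') :: v)) := by
    by_cases hhh : h = h'
    · subst hhh; rw [← hSQ]
    · simp only [cost, cost_append, hS1, hS1']
      rw [← hS2, hS3, hS3']
      have o1 : InOpen h b h' := by unfold InClosed InOpen at *; grind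
      have o2 : InOpen a h' h := by unfold InClosed InOpen at *; grind
      have n1 : ¬ InOpen h b h := fun h => (InOpen.ne h).2.1 rfl
      have n2 : ¬ InOpen h' b h' := fun h => (InOpen.ne h).2.1 rfl
      have n3 : ¬ InOpen a h a := fun h => (InOpen.ne h).2.1 rfl
      have n4 : ¬ InOpen a h' a := fun h => (InOpen.ne h).2.1 rfl
      have c1 := arc_card o1 hh'Q
      have c2 := arc_card o2 hhP
      have c3 := wrap_add o1
      have c4 := wrap_add o2
      have c5 := cost_insert hhP hh'P pP vth vth'
      rw [hfinP] at c5
      have hnb : ¬ InOpen h h' b := fun h => hb (.inl h)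
      have hna : ¬ InOpen h h' a := fun h => ha (.inl h)
      have c6 := path_filter (InOpen h h') pu (fun e he =>
        ⟨fun h => (hu e he).1 (.inl h), fun h => (hu e he).2 (.inl h)⟩)
      rw [← hS2, hS2P, card_filter_insert _ haP, card_filter_insert _ hbQ, if_neg hnb,
        if_neg hna] at c6
      rw [hSQ, hS2P, card_filter_insert _ hhQ, card_filter_insert _ hh'Q, card_filter_insert _ haP,
        card_filter_insert _ haP, if_neg n1, if_neg n2, if_neg n3, if_neg n4]
      eta_reduce at *
      omega
  obtain ⟨τu, ru, lu⟩ := exists_rep pu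
  obtain ⟨τv, rv, rv', lv⟩ := exists_rep_ins hhP hh'P pP vth vth'
  rw [Finset.card_insert_of_notMem hbQ, ← hSc] at lu
  rw [hPc] at lv
  have e1 : cost S ((h, b) :: (u ++ (a, h) :: v)) ≥ cost (insert b Q) u + cost (insert h P) v := by
    simp only [cost, cost_append, hS1]; rw [← hS2, hS3]; omega
  have e2 : cost (insert h' Q) ((h', b) :: (u ++ (a, h') :: v)) ≥ cost (insert h' P) v := by
    simp only [cost, cost_append, hS1']; rw [← hS2, hS3']; omega
  have hlen : τu.length + τv.length + 2 ≤ bnd (cost S ((h, b) :: (u ++ (a, h) :: v))) S.card := by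
    refine bnd_aux lu lv ?_ ?_ (by norm_num)
    · omega
    · omega
  unfold Conn
  rw [← hS, ← hS']
  refine ⟨(h, b) :: (τu ++ (a, h) :: τv), (h', b) :: (τu ++ (a, h') :: τv),
    .single _ _ _ _ (ru.append (.single _ _ _ _ rv)), .single _ _ _ _ (?_),
    .bigex _ _ _ _ _ _ ?_ ha hb, hcost, ?_, ?_, ?_⟩
  · rw [hS1']
    exact ru.append (.single _ _ _ _ rv')
  · exact (ru.red pu).heights (fun z => ¬ InClosed h h' z) hu
  · rw [Finset.card_insert_of_notMem hh'Q]; omega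
  · simp only [List.length_append, List.length_cons]; omega
  · simp only [List.length_append, List.length_cons]; omega

theorem step_conn {σ σ' : List (α × α)} (h : Step0 σ σ') (hv : Valid σ) (hv' : Valid σ') :
    Conn σ σ' := by
  cases h with
  | red _ _ h =>
    cases h with
    | swap u v x y h => exact conn_swap u v x y h hv
    | merge u v a m b h => exact conn_merge u v a m b h hv
  | rot x v => exact conn_rot x v hv
  | bigex h h' a b u v hu ha hb => exact conn_bigex h h' a b u v hu ha hb hv hv'

def bd (σ : List (α × α)) : ℕ := bnd (cost (cfg0 σ) σ) (cfg0 σ).card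

theorem step0_nf {σ σ' : List (α × α)} (h : Step0 σ σ') (hv : Valid σ) (hv' : Valid σ') :
    bd σ = bd σ' ∧ BR (bd σ) (nf σ) (nf σ') := by
  obtain ⟨τ, τ', r, r', s, hc, hk, l, l'⟩ := step_conn h hv hv'
  have w := (r.red hv.path).valid hv
  have w' := (r'.red hv'.path).valid hv'
  refine ⟨by unfold bd; rw [hc, hk], ?_⟩
  exact (((r.nf hv).br w l).symm.trans (.single ⟨⟨w, w', .inl s⟩, l, l'⟩)).trans ((r'.nf hv').br w' l')

theorem lstep_nf {σ σ' : List (α × α)} (h : LStep σ σ') :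
    bd σ = bd σ' ∧ BR (bd σ) (nf σ) (nf σ') := by
  obtain ⟨hv, hv', h | h⟩ := h
  · exact step0_nf h hv hv'
  · obtain ⟨h1, h2⟩ := step0_nf h hv' hv
    exact ⟨h1.symm, h1 ▸ h2.symm⟩

theorem chain_nf {σ σ' : List (α × α)} (h : Relation.ReflTransGen LStep σ σ') :
    bd σ = bd σ' ∧ BR (bd σ) (nf σ) (nf σ') := by
  induction h with
  | refl => exact ⟨rfl, .refl⟩
  | tail _ h ih =>
    have := lstep_nf h
    exact ⟨ih.1.trans this.1, ih.2.trans (ih.1 ▸ this.2)⟩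

theorem cost_le {S : Finset α} {σ : List (α × α)} (h : Path S σ) :
    cost S σ ≤ σ.length * (S.card + 1) := by
  induction σ generalizing S with
  | nil => simp [cost]
  | cons e σ ih =>
    have h1 := ih h.2.2
    rw [after_card h.1 h.2.1] at h1
    have h2 := Finset.card_filter_le S (InOpen e.1 e.2)
    have h3 : (if e.2 < e.1 then 1 else 0) ≤ 1 := by split_ifs <;> simp
    simp only [cost, List.length_cons, add_mul, one_mul] at *
    omega

theorem cfg0_card (σ : List (α × α)) : (cfg0 σ).card ≤ σ.length := by
  induction σ with
  | nil => simp [cfg0]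
  | cons e σ ih =>
    rw [cfg0, List.length_cons]
    exact (Finset.card_insert_le _ _).trans
      (Nat.add_le_add_right ((Finset.card_erase_le).trans ih) 1)

/-- The computable bound. -/
def bigB (m : ℕ) : ℕ := bnd (m * (m + 1)) m + m

theorem bd_le {σ : List (α × α)} {m : ℕ} (hv : Valid σ) (h : σ.length ≤ m) : bd σ ≤ bigB m := by
  have h1 := cost_le hv.path
  have h2 := (cfg0_card σ).trans h
  have h3 : cost (cfg0 σ) σ ≤ m * (m + 1) :=
    h1.trans (Nat.mul_le_mul h (Nat.add_le_add_right h2 1))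
  unfold bd bigB bnd
  have := Nat.mul_le_mul h3 (Nat.add_le_add_right h2 1)
  omega

theorem nf_br {σ : List (α × α)} (hv : Valid σ) {B : ℕ} (h : σ.length ≤ B) : BR B σ (nf σ) :=
  ((Rep.refl _ σ).nf hv).br hv h

/-- Main theorem of the list part. -/
theorem chain_bounded {σ σ' : List (α × α)} {m : ℕ} (hv : Valid σ) (hv' : Valid σ')
    (h1 : σ.length ≤ m) (h2 : σ'.length ≤ m) (h : Relation.ReflTransGen LStep σ σ') :
    BR (bigB m) σ σ' := by
  have hm : m ≤ bigB m := Nat.le_add_left _ _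
  exact ((nf_br hv (h1.trans hm)).trans ((chain_nf h).2.mono (bd_le hv h1))).trans
    (nf_br hv' (h2.trans hm)).symm

end L
end RD

namespace RD

theorem toIco_mem (x : 𝕊) : toIco x ∈ Ico (0:ℝ) 1 := by
  have := (AddCircle.equivIco 1 0 x).2
  simpa [toIco] using this

theorem toIco_nonneg (x : 𝕊) : 0 ≤ toIco x := (toIco_mem x).1
theorem toIco_lt (x : 𝕊) : toIco x < 1 := (toIco_mem x).2

theorem coe_toIco (x : 𝕊) : ((toIco x : ℝ) : 𝕊) = x := AddCircle.coe_equivIco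

theorem toIco_coe {t : ℝ} (ht : t ∈ Ico (0:ℝ) 1) : toIco (t : 𝕊) = t := by
  unfold toIco
  exact AddCircle.equivIco_coe_of_mem (by simpa using ht)

theorem toIco_inj {x y : 𝕊} : toIco x = toIco y ↔ x = y := by
  constructor
  · intro h
    rw [← coe_toIco x, ← coe_toIco y, h]
  · rintro rfl
    rfl

theorem coe_inj {s t : ℝ} (hs : s ∈ Ico (0:ℝ) 1) (ht : t ∈ Ico (0:ℝ) 1) :
    (s : 𝕊) = t ↔ s = t := by
  rw [← toIco_inj, toIco_coe hs, toIco_coe ht]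

theorem toIco_zero : toIco 0 = 0 := by
  have := toIco_coe (t := 0) (by simp)
  simpa using this

theorem toIco_sub (x a : 𝕊) :
    toIco (x - a) = if toIco a ≤ toIco x then toIco x - toIco a else toIco x - toIco a + 1 := by
  have hx := toIco_mem x
  have ha := toIco_mem a
  simp only [mem_Ico] at hx ha
  split_ifs with h
  · rw [← toIco_coe (t := toIco x - toIco a) ⟨by linarith, by linarith⟩]
    rw [AddCircle.coe_sub, coe_toIco, coe_toIco]
  · rw [← toIco_coe (t := toIco x - toIco a + 1) ⟨by linarith, by linarith⟩]
    rw [AddCircle.coe_add, AddCircle.coe_sub, coe_toIco, coe_toIco, AddCircle.coe_period, add_zero]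

theorem mem_arc {a b x : 𝕊} : x ∈ closedArc a b ↔ InClosed (toIco a) (toIco b) (toIco x) := by
  have hx := toIco_mem x
  have ha := toIco_mem a
  have hb := toIco_mem b
  simp only [mem_Ico] at hx ha hb
  unfold closedArc InClosed InOpen
  simp only [mem_ofPred_eq, toIco_sub]
  split_ifs <;> grind

theorem mem_arc_left (a b : 𝕊) : a ∈ closedArc a b := by
  rw [mem_arc]; right; left; rfl

theorem mem_arc_right (a b : 𝕊) : b ∈ closedArc a b := by
  rw [mem_arc]; right; right; rfl

section diag
variable (R : RectDiagram)

theorem mem_verts {p : Torus} : p ∈ R.verts ↔ p ∈ R.pos ∨ p ∈ R.neg := by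
  simp [RectDiagram.verts]

theorem not_both {p : Torus} (h : p ∈ R.pos) (h' : p ∈ R.neg) : False :=
  Finset.disjoint_left.1 R.disj h h'

theorem col_pos {p q : Torus} (h : p ∈ R.pos) (h' : q ∈ R.pos) (e : p.1 = q.1) : p = q :=
  R.thetaInjPos h h' e
theorem col_neg {p q : Torus} (h : p ∈ R.neg) (h' : q ∈ R.neg) (e : p.1 = q.1) : p = q :=
  R.thetaInjNeg h h' e
theorem row_pos {p q : Torus} (h : p ∈ R.pos) (h' : q ∈ R.pos) (e : p.2 = q.2) : p = q :=
  R.phiInjPos h h' e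
theorem row_neg {p q : Torus} (h : p ∈ R.neg) (h' : q ∈ R.neg) (e : p.2 = q.2) : p = q :=
  R.phiInjNeg h h' e

theorem col_ex {t y : 𝕊} (h : (t, y) ∈ R.verts) : ∃ a b, (t, a) ∈ R.pos ∧ (t, b) ∈ R.neg := by
  rw [mem_verts] at h
  have hp : t ∈ R.pos.image Prod.fst := by
    rcases h with h | h
    · exact Finset.mem_image_of_mem _ h
    · rw [R.thetaEq]; exact Finset.mem_image_of_mem _ h
  have hn : t ∈ R.neg.image Prod.fst := by rw [← R.thetaEq]; exact hp
  obtain ⟨⟨t1, a⟩, h1, rfl⟩ := Finset.mem_image.1 hp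
  obtain ⟨⟨t2, b⟩, h2, h3⟩ := Finset.mem_image.1 hn
  simp only at h3
  subst h3
  exact ⟨a, b, h1, h2⟩

theorem row_ex {t y : 𝕊} (h : (t, y) ∈ R.verts) : ∃ a b, (a, y) ∈ R.pos ∧ (b, y) ∈ R.neg := by
  rw [mem_verts] at h
  have hp : y ∈ R.pos.image Prod.snd := by
    rcases h with h | h
    · exact Finset.mem_image_of_mem _ h
    · rw [R.phiEq]; exact Finset.mem_image_of_mem _ h
  have hn : y ∈ R.neg.image Prod.snd := by rw [← R.phiEq]; exact hp
  obtain ⟨⟨a, t1⟩, h1, rfl⟩ := Finset.mem_image.1 hp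
  obtain ⟨⟨b, t2⟩, h2, h3⟩ := Finset.mem_image.1 hn
  simp only at h3
  subst h3
  exact ⟨a, b, h1, h2⟩

end diag

/-- Consecutive sets of corners, as conditions on the four membership propositions. -/
def Consec (p1 p2 p3 p4 : Prop) : Prop :=
  ¬ (p1 ∧ p2 ∧ p3 ∧ p4) ∧ ¬ (¬p1 ∧ ¬p2 ∧ ¬p3 ∧ ¬p4) ∧ ¬ (p1 ∧ ¬p2 ∧ p3 ∧ ¬p4) ∧
    ¬ (¬p1 ∧ p2 ∧ ¬p3 ∧ p4)

/-- Elementary moves, in a symmetric pointwise form. -/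
def EM (R R' : RectDiagram) (t1 t2 y1 y2 : 𝕊) : Prop :=
  t1 ≠ t2 ∧ y1 ≠ y2 ∧
  ((t1, y1) ∈ R'.verts ↔ (t1, y1) ∉ R.verts) ∧ ((t2, y1) ∈ R'.verts ↔ (t2, y1) ∉ R.verts) ∧
  ((t2, y2) ∈ R'.verts ↔ (t2, y2) ∉ R.verts) ∧ ((t1, y2) ∈ R'.verts ↔ (t1, y2) ∉ R.verts) ∧
  (∀ t y, ¬ ((t = t1 ∨ t = t2) ∧ (y = y1 ∨ y = y2)) →
    (((t, y) ∈ R.pos ↔ (t, y) ∈ R'.pos) ∧ ((t, y) ∈ R.neg ↔ (t, y) ∈ R'.neg) ∧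
      ((t, y) ∈ R.verts → ¬ (t ∈ closedArc t1 t2 ∧ y ∈ closedArc y1 y2)))) ∧
  Consec ((t1, y1) ∈ R.verts) ((t2, y1) ∈ R.verts) ((t2, y2) ∈ R.verts) ((t1, y2) ∈ R.verts)

theorem EM.symm {R R' : RectDiagram} {t1 t2 y1 y2 : 𝕊} (h : EM R R' t1 t2 y1 y2) :
    EM R' R t1 t2 y1 y2 := by
  obtain ⟨h1, h2, h3, h4, h5, h6, h7, h8⟩ := h
  refine ⟨h1, h2, by rw [h3, not_not], by rw [h4, not_not], by rw [h5, not_not], by rw [h6, not_not], ?_, ?_⟩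
  · intro t y hh
    obtain ⟨k1, k2, k3⟩ := h7 t y hh
    refine ⟨k1.symm, k2.symm, fun h => k3 ?_⟩
    rw [mem_verts] at h ⊢
    grind
  · unfold Consec at *
    rw [h3, h4, h5, h6]
    grind

theorem elem_iff {R R' : RectDiagram} {t1 t2 y1 y2 : 𝕊} :
    ElemMoveData R R' t1 t2 y1 y2 ↔ EM R R' t1 t2 y1 y2 := by
  constructor
  · rintro ⟨h1, h2, h3, h4, ⟨s, hs, hs1, hs2⟩, h6⟩
    have e1 : ∀ p : Torus, p ∈ symmDiff (↑R.verts : Set Torus) ↑R'.verts ↔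
      (p.1 = t1 ∨ p.1 = t2) ∧ (p.2 = y1 ∨ p.2 = y2) := by
      intro p; rw [h3]; simp
    have e2 : ∀ p : Torus, (p.1 ∈ closedArc t1 t2 ∧ p.2 ∈ closedArc y1 y2) ∧ (p ∈ R.verts ∨ p ∈ R'.verts) ↔
      (p.1 = t1 ∨ p.1 = t2) ∧ (p.2 = y1 ∨ p.2 = y2) := by
      intro p
      rw [← e1, ← h4]; simp
    simp only [Set.mem_symmDiff, Finset.mem_coe] at e1
    have e3 : ∀ p : Torus, (p ∈ R.pos ∧ p ∈ R'.verts) ↔ (p ∈ R.verts ∧ p ∈ R'.pos) := by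
      intro p
      have := Set.ext_iff.1 h6 p
      simpa using this
    have e4 : ∀ p : Torus, p ∈ R.verts ∧ ((p.1 = t1 ∨ p.1 = t2) ∧ (p.2 = y1 ∨ p.2 = y2)) ↔ p ∈ s := by
      intro p
      have := Set.ext_iff.1 hs1 p
      simpa using this
    refine ⟨h1, h2, ?_, ?_, ?_, ?_, ?_, ?_⟩
    · have := e1 (t1, y1); simp at this; grind
    · have := e1 (t2, y1); simp at this; grind
    · have := e1 (t2, y2); simp at this; grind
    · have := e1 (t1, y2); simp at this; grind
    · intro t y hn
      have k1 := e1 (t, y)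
      have k2 := e2 (t, y)
      have k3 := e3 (t, y)
      simp only at k1 k2 k3
      have n1 := not_both R (p := (t, y))
      have n2 := not_both R' (p := (t, y))
      rw [mem_verts, mem_verts] at *
      grind
    · have k1 := e4 (t1, y1)
      have k2 := e4 (t2, y1)
      have k3 := e4 (t2, y2)
      have k4 := e4 (t1, y2)
      simp only [true_or, or_true, and_true] at k1 k2 k3 k4
      rw [k1, k2, k3, k4]
      unfold ConsecCorners at hs
      unfold Consec
      rcases hs with rfl | rfl | rfl | rfl | rfl | rfl | rfl | rfl | rfl | rfl | rfl | rfl <;>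
        simp [h1, h2, h1.symm, h2.symm]
  · rintro ⟨h1, h2, h3, h4, h5, h6, h7, h8⟩
    have e1 : ∀ p : Torus, p ∈ symmDiff (↑R.verts : Set Torus) ↑R'.verts ↔
      (p.1 = t1 ∨ p.1 = t2) ∧ (p.2 = y1 ∨ p.2 = y2) := by
      rintro ⟨t, y⟩
      simp only [Set.mem_symmDiff, Finset.mem_coe]
      constructor
      · intro h
        by_contra hn
        have k := h7 t y hn
        rw [mem_verts, mem_verts] at h
        grind
      · rintro ⟨rfl | rfl, rfl | rfl⟩ <;> grind
    have e1' : symmDiff (↑R.verts : Set Torus) ↑R'.verts =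
        ({t1, t2} : Set 𝕊) ×ˢ ({y1, y2} : Set 𝕊) := by
      ext p; rw [e1]; simp
    refine ⟨h1, h2, e1', ?_, ?_, ?_⟩
    · ext ⟨t, y⟩
      rw [e1]
      simp only [mem_inter_iff, mem_prod, mem_union, Finset.mem_coe]
      constructor
      · rintro ⟨h, h'⟩
        by_contra hn
        have k := h7 t y hn
        rw [mem_verts] at h' k
        rw [mem_verts] at h'
        grind
      · have := mem_arc_left t1 t2
        have := mem_arc_right t1 t2
        have := mem_arc_left y1 y2
        have := mem_arc_right y1 y2
        rintro ⟨rfl | rfl, rfl | rfl⟩ <;> grind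
    · refine ⟨_, ?_, rfl, ?_⟩
      · have key : ∀ s : Set Torus, (∀ p : Torus, p ∈ s ↔ p ∈ R.verts ∧ ((p.1 = t1 ∨ p.1 = t2) ∧ (p.2 = y1 ∨ p.2 = y2))) →
          ConsecCorners t1 t2 y1 y2 s := by
          intro s hs
          have hs' : s = {p | (p = (t1, y1) ∧ (t1, y1) ∈ R.verts) ∨ (p = (t2, y1) ∧ (t2, y1) ∈ R.verts) ∨
            (p = (t2, y2) ∧ (t2, y2) ∈ R.verts) ∨ (p = (t1, y2) ∧ (t1, y2) ∈ R.verts)} := by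
            ext ⟨t, y⟩
            rw [hs]
            simp only [mem_ofPred_eq, Prod.mk.injEq]
            constructor
            · rintro ⟨h, rfl | rfl, rfl | rfl⟩ <;> grind
            · rintro (⟨⟨rfl, rfl⟩, h⟩ | ⟨⟨rfl, rfl⟩, h⟩ | ⟨⟨rfl, rfl⟩, h⟩ | ⟨⟨rfl, rfl⟩, h⟩) <;> grind
          unfold ConsecCorners
          unfold Consec at h8
          have tr : ∀ a b : Set Torus, (∀ p, p ∈ a ↔ p ∈ b) → a = b := fun a b h => Set.ext h
          by_cases a1 : (t1, y1) ∈ R.verts <;> by_cases a2 : (t2, y1) ∈ R.verts <;>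
          by_cases a3 : (t2, y2) ∈ R.verts <;> by_cases a4 : (t1, y2) ∈ R.verts <;>
          simp only [a1, a2, a3, a4, not_true_eq_false, not_false_eq_true, and_true, and_false, false_and, true_and, and_self, or_false, false_or] at h8 hs'
          · iterate 8 right
            left; rw [hs']; ext; simp
          · iterate 11 right
            rw [hs']; ext; simp; grind
          · iterate 4 right
            left; rw [hs']; ext; simp
          · iterate 10 right
            left; rw [hs']; ext; simp; grind
          · iterate 7 right
            left; rw [hs']; ext; simp; grind
          · left; rw [hs']; ext; simp
          · iterate 9 right
            left; rw [hs']; ext; simp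
          · iterate 5 right
            left; rw [hs']; ext; simp
          · iterate 1 right
            left; rw [hs']; ext; simp
          · iterate 6 right
            left; rw [hs']; ext; simp
          · iterate 2 right
            left; rw [hs']; ext; simp
          · iterate 3 right
            left; rw [hs']; ext; simp
        apply key
        intro p
        simp
      · rintro ⟨t, y⟩ ⟨hp, hq⟩
        simp only [mem_prod, mem_insert_iff, mem_singleton_iff, mem_inter_iff, Finset.mem_coe] at hp hq
        simp only [Finset.mem_coe]
        obtain ⟨rfl | rfl, rfl | rfl⟩ := hp <;> grind
    · ext ⟨t, y⟩
      simp only [mem_inter_iff, Finset.mem_coe]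
      by_cases hn : (t = t1 ∨ t = t2) ∧ (y = y1 ∨ y = y2)
      · have : (t, y) ∈ R'.verts ↔ (t, y) ∉ R.verts := by
          obtain ⟨rfl | rfl, rfl | rfl⟩ := hn <;> grind
        rw [mem_verts, mem_verts] at *
        grind
      · have k := h7 t y hn
        rw [mem_verts, mem_verts] at *
        grind

end RD

namespace RD

open Classical in
theorem EM.card {R R' : RectDiagram} {t1 t2 y1 y2 : 𝕊} (h : EM R R' t1 t2 y1 y2) :
    ∃ k : ℕ, R.verts.card = k + ((if (t1, y1) ∈ R.verts then 1 else 0) + (if (t2, y1) ∈ R.verts then 1 else 0)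
      + (if (t2, y2) ∈ R.verts then 1 else 0) + (if (t1, y2) ∈ R.verts then 1 else 0)) ∧
     R'.verts.card = k + ((if (t1, y1) ∈ R.verts then 0 else 1) + (if (t2, y1) ∈ R.verts then 0 else 1)
      + (if (t2, y2) ∈ R.verts then 0 else 1) + (if (t1, y2) ∈ R.verts then 0 else 1)) := by
  obtain ⟨h1, h2, h3, h4, h5, h6, h7, h8⟩ := h
  let C : Finset Torus := {(t1, y1), (t2, y1), (t2, y2), (t1, y2)}
  have key : ∀ Q : RectDiagram, Q.verts.card = (Q.verts \ C).card +
     ((if (t1, y1) ∈ Q.verts then 1 else 0) + (if (t2, y1) ∈ Q.verts then 1 else 0)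
      + (if (t2, y2) ∈ Q.verts then 1 else 0) + (if (t1, y2) ∈ Q.verts then 1 else 0)) := by
    intro Q
    rw [← Finset.card_sdiff_add_card_inter Q.verts C]
    congr 1
    rw [Finset.inter_comm, ← Finset.filter_mem_eq_inter, Finset.card_filter]
    simp only [C]
    rw [Finset.sum_insert, Finset.sum_insert, Finset.sum_insert, Finset.sum_singleton]
    · ring
    · simp [h1.symm]
    · simp [h2]
    · simp [h1, h2]
  have e : R.verts \ C = R'.verts \ C := by
    ext ⟨t, y⟩
    simp only [C, Finset.mem_sdiff, Finset.mem_insert, Finset.mem_singleton, Prod.mk.injEq]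
    by_cases hn : (t = t1 ∨ t = t2) ∧ (y = y1 ∨ y = y2)
    · grind
    · have := h7 t y hn
      rw [mem_verts, mem_verts]
      grind
  refine ⟨(R.verts \ C).card, key R, ?_⟩
  rw [key R', ← e]
  simp only [h3, h4, h5, h6, ite_not]

theorem exch_iff {R R' : RectDiagram} : ExchangeMove R R' ↔
    ∃ t1 t2 y1 y2, EM R R' t1 t2 y1 y2 ∧
     (((t1, y1) ∈ R.verts ∧ (t1, y2) ∈ R.verts ∧ (t2, y1) ∉ R.verts ∧ (t2, y2) ∉ R.verts) ∨
      ((t1, y1) ∉ R.verts ∧ (t1, y2) ∉ R.verts ∧ (t2, y1) ∈ R.verts ∧ (t2, y2) ∈ R.verts) ∨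
      ((t1, y1) ∈ R.verts ∧ (t1, y2) ∉ R.verts ∧ (t2, y1) ∈ R.verts ∧ (t2, y2) ∉ R.verts) ∨
      ((t1, y1) ∉ R.verts ∧ (t1, y2) ∈ R.verts ∧ (t2, y1) ∉ R.verts ∧ (t2, y2) ∈ R.verts)) := by
  unfold ExchangeMove ElemMove
  constructor
  · rintro ⟨⟨t1, t2, y1, y2, h⟩, hc⟩
    rw [elem_iff] at h
    refine ⟨t1, t2, y1, y2, h, ?_⟩
    obtain ⟨k, k1, k2⟩ := h.card
    have h8 := h.2.2.2.2.2.2.2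
    unfold Consec at h8
    rw [k1, k2] at hc
    clear h k1 k2
    by_cases p1 : (t1, y1) ∈ R.verts <;> by_cases p2 : (t2, y1) ∈ R.verts <;>
    by_cases p3 : (t2, y2) ∈ R.verts <;> by_cases p4 : (t1, y2) ∈ R.verts <;>
    simp [p1, p2, p3, p4] at hc h8 ⊢
  · rintro ⟨t1, t2, y1, y2, h, h'⟩
    refine ⟨⟨t1, t2, y1, y2, elem_iff.2 h⟩, ?_⟩
    obtain ⟨k, k1, k2⟩ := h.card
    rw [k1, k2]
    clear h k1 k2
    rcases h' with h | h | h | h <;> simp [h.1, h.2]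

/-- three vertices in a column -/
theorem col3 (R : RectDiagram) {t a b c : 𝕊} (ha : (t, a) ∈ R.verts) (hb : (t, b) ∈ R.verts)
    (hc : (t, c) ∈ R.verts) (hab : a ≠ b) : c = a ∨ c = b := by
  have k1 := @col_pos R
  have k2 := @col_neg R
  rw [mem_verts] at *
  rcases ha with ha | ha <;> rcases hb with hb | hb <;> rcases hc with hc | hc
  · exact absurd (congrArg Prod.snd (k1 ha hb rfl)) hab
  · exact absurd (congrArg Prod.snd (k1 ha hb rfl)) hab
  · exact .inl (congrArg Prod.snd (k1 hc ha rfl))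
  · exact .inr (congrArg Prod.snd (k2 hc hb rfl))
  · exact .inr (congrArg Prod.snd (k1 hc hb rfl))
  · exact .inl (congrArg Prod.snd (k2 hc ha rfl))
  · exact absurd (congrArg Prod.snd (k2 ha hb rfl)) hab
  · exact absurd (congrArg Prod.snd (k2 ha hb rfl)) hab

theorem row3 (R : RectDiagram) {t a b c : 𝕊} (ha : (a, t) ∈ R.verts) (hb : (b, t) ∈ R.verts)
    (hc : (c, t) ∈ R.verts) (hab : a ≠ b) : c = a ∨ c = b := by
  have k1 := @row_pos R
  have k2 := @row_neg R
  rw [mem_verts] at *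
  rcases ha with ha | ha <;> rcases hb with hb | hb <;> rcases hc with hc | hc
  · exact absurd (congrArg Prod.fst (k1 ha hb rfl)) hab
  · exact absurd (congrArg Prod.fst (k1 ha hb rfl)) hab
  · exact .inl (congrArg Prod.fst (k1 hc ha rfl))
  · exact .inr (congrArg Prod.fst (k2 hc hb rfl))
  · exact .inr (congrArg Prod.fst (k1 hc hb rfl))
  · exact .inl (congrArg Prod.fst (k2 hc ha rfl))
  · exact absurd (congrArg Prod.fst (k2 ha hb rfl)) hab
  · exact absurd (congrArg Prod.fst (k2 ha hb rfl)) hab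

/-- opposite signs in a column -/
theorem col_opp (R : RectDiagram) {t a b : 𝕊} (ha : (t, a) ∈ R.verts) (hb : (t, b) ∈ R.verts)
    (hab : a ≠ b) : ((t, a) ∈ R.pos ∧ (t, b) ∈ R.neg) ∨ ((t, a) ∈ R.neg ∧ (t, b) ∈ R.pos) := by
  rw [mem_verts] at *
  rcases ha with ha | ha <;> rcases hb with hb | hb
  · exact absurd (congrArg Prod.snd (col_pos R ha hb rfl)) hab
  · exact .inl ⟨ha, hb⟩
  · exact .inr ⟨ha, hb⟩
  · exact absurd (congrArg Prod.snd (col_neg R ha hb rfl)) hab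

theorem row_opp (R : RectDiagram) {t a b : 𝕊} (ha : (a, t) ∈ R.verts) (hb : (b, t) ∈ R.verts)
    (hab : a ≠ b) : ((a, t) ∈ R.pos ∧ (b, t) ∈ R.neg) ∨ ((a, t) ∈ R.neg ∧ (b, t) ∈ R.pos) := by
  rw [mem_verts] at *
  rcases ha with ha | ha <;> rcases hb with hb | hb
  · exact absurd (congrArg Prod.fst (row_pos R ha hb rfl)) hab
  · exact .inl ⟨ha, hb⟩
  · exact .inr ⟨ha, hb⟩
  · exact absurd (congrArg Prod.fst (row_neg R ha hb rfl)) hab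

theorem col_partner (R : RectDiagram) {t a : 𝕊} (ha : (t, a) ∈ R.verts) :
    ∃ b, b ≠ a ∧ (t, b) ∈ R.verts := by
  obtain ⟨x, y, hx, hy⟩ := col_ex R ha
  have hn := @not_both R
  by_cases e : x = a
  · refine ⟨y, ?_, by rw [mem_verts]; exact .inr hy⟩
    rintro rfl
    subst e
    exact hn hx hy
  · exact ⟨x, e, by rw [mem_verts]; exact .inl hx⟩

theorem row_partner (R : RectDiagram) {t a : 𝕊} (ha : (a, t) ∈ R.verts) :
    ∃ b, b ≠ a ∧ (b, t) ∈ R.verts := by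
  obtain ⟨x, y, hx, hy⟩ := row_ex R ha
  have hn := @not_both R
  by_cases e : x = a
  · refine ⟨y, ?_, by rw [mem_verts]; exact .inr hy⟩
    rintro rfl
    subst e
    exact hn hx hy
  · exact ⟨x, e, by rw [mem_verts]; exact .inl hx⟩

/-- The movie of a diagram, seen from the base point `β`. -/
def RepB (β : 𝕊) (R : RectDiagram) (l : List (ℝ × (ℝ × ℝ))) : Prop :=
  l.Pairwise (fun e f => e.1 < f.1) ∧ ∀ t a b, (t, (a, b)) ∈ l ↔
    (t ∈ Ico (0:ℝ) 1 ∧ a ∈ Ico (0:ℝ) 1 ∧ b ∈ Ico (0:ℝ) 1) ∧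
      ((t : 𝕊) + β, (a : 𝕊)) ∈ R.pos ∧ ((t : 𝕊) + β, (b : 𝕊)) ∈ R.neg

theorem sorted_ext {l l' : List (ℝ × (ℝ × ℝ))} (h : l.Pairwise (fun e f => e.1 < f.1))
    (h' : l'.Pairwise (fun e f => e.1 < f.1)) (hm : ∀ e, e ∈ l ↔ e ∈ l') : l = l' := by
  have n : ∀ {l : List (ℝ × (ℝ × ℝ))}, l.Pairwise (fun e f => e.1 < f.1) → l.Nodup := by
    intro l h
    refine h.imp ?_
    rintro a _ h rfl
    exact lt_irrefl _ h
  refine List.Perm.eq_of_pairwise ?_ h h' ((List.perm_ext_iff_of_nodup (n h) (n h')).2 hm)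
  intro a b _ _ h1 h2
  exact absurd h1 (not_lt.2 h2.le)

theorem RepB.unique {β : 𝕊} {R : RectDiagram} {l l' : List (ℝ × (ℝ × ℝ))} (h : RepB β R l)
    (h' : RepB β R l') : l = l' :=
  sorted_ext h.1 h'.1 (fun e => by rw [h.2 e.1 e.2.1 e.2.2, h'.2 e.1 e.2.1 e.2.2])

theorem exists_sorted (F : Finset (ℝ × (ℝ × ℝ))) (hF : Set.InjOn Prod.fst (F : Set (ℝ × (ℝ × ℝ)))) :
    ∃ l : List (ℝ × (ℝ × ℝ)), l.Pairwise (fun e f => e.1 < f.1) ∧ ∀ e, e ∈ l ↔ e ∈ F := by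
  induction F using Finset.strongInduction with
  | H F ih =>
    rcases F.eq_empty_or_nonempty with rfl | hne
    · exact ⟨[], by simp, by simp⟩
    · obtain ⟨x, hx, hmin⟩ := F.exists_min_image Prod.fst hne
      obtain ⟨l, h1, h2⟩ := ih (F.erase x) (Finset.erase_ssubset hx)
        (hF.mono (by intro y hy; exact Finset.mem_of_mem_erase (Finset.mem_coe.1 hy)))
      refine ⟨x :: l, ?_, ?_⟩
      · rw [List.pairwise_cons]
        refine ⟨fun y hy => ?_, h1⟩
        rw [h2, Finset.mem_erase] at hy
        refine lt_of_le_of_ne (hmin y hy.2) ?_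
        intro e
        exact hy.1 (hF hy.2 hx e.symm)
      · intro e
        rw [List.mem_cons, h2, Finset.mem_erase]
        by_cases e = x <;> grind

theorem RepB.exists (β : 𝕊) (R : RectDiagram) : ∃ l, RepB β R l := by
  classical
  let F : Finset (ℝ × (ℝ × ℝ)) :=
    ((R.pos ×ˢ R.neg).filter (fun p => p.1.1 = p.2.1)).image
      (fun p => (toIco (p.1.1 - β), (toIco p.1.2, toIco p.2.2)))
  have hF : ∀ t a b, (t, (a, b)) ∈ F ↔
    (t ∈ Ico (0:ℝ) 1 ∧ a ∈ Ico (0:ℝ) 1 ∧ b ∈ Ico (0:ℝ) 1) ∧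
      ((t : 𝕊) + β, (a : 𝕊)) ∈ R.pos ∧ ((t : 𝕊) + β, (b : 𝕊)) ∈ R.neg := by
    intro t a b
    simp only [F, Finset.mem_image, Finset.mem_filter, Finset.mem_product, Prod.mk.injEq, Prod.exists]
    constructor
    · rintro ⟨t', a', s', b', ⟨⟨h1, h2⟩, rfl⟩, rfl, rfl, rfl⟩
      refine ⟨⟨toIco_mem _, toIco_mem _, toIco_mem _⟩, ?_⟩
      simp only [coe_toIco, sub_add_cancel]
      exact ⟨h1, h2⟩
    · rintro ⟨⟨ht, ha, hb⟩, h1, h2⟩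
      refine ⟨_, _, _, _, ⟨⟨h1, h2⟩, rfl⟩, ?_, ?_, ?_⟩
      · rw [add_sub_cancel_right, toIco_coe ht]
      · exact toIco_coe ha
      · exact toIco_coe hb
  obtain ⟨l, h1, h2⟩ := exists_sorted F (by
    rintro ⟨t, a, b⟩ h ⟨t', a', b'⟩ h' (rfl : t = t')
    rw [Finset.mem_coe, hF] at h h'
    have e1 := congrArg Prod.snd (col_pos R h.2.1 h'.2.1 rfl)
    have e2 := congrArg Prod.snd (col_neg R h.2.2 h'.2.2 rfl)
    simp only at e1 e2
    rw [coe_inj h.1.2.1 h'.1.2.1] at e1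
    rw [coe_inj h.1.2.2 h'.1.2.2] at e2
    rw [e1, e2])
  exact ⟨l, h1, fun t a b => by rw [h2, hF]⟩

theorem RepB.mem_of {β : 𝕊} {R : RectDiagram} {l : List (ℝ × (ℝ × ℝ))} (h : RepB β R l) {t a b : 𝕊}
    (ha : (t, a) ∈ R.pos) (hb : (t, b) ∈ R.neg) : (toIco (t - β), (toIco a, toIco b)) ∈ l := by
  rw [h.2]
  simp only [coe_toIco, sub_add_cancel]
  exact ⟨⟨toIco_mem _, toIco_mem _, toIco_mem _⟩, ha, hb⟩

theorem RepB.pos_iff {β : 𝕊} {R : RectDiagram} {l : List (ℝ × (ℝ × ℝ))} (h : RepB β R l) {t a : 𝕊} :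
    (t, a) ∈ R.pos ↔ ∃ b, (toIco (t - β), (toIco a, b)) ∈ l := by
  constructor
  · intro ha
    obtain ⟨_, b, _, hb⟩ := col_ex R (t := t) (y := a) (by rw [mem_verts]; exact .inl ha)
    exact ⟨_, h.mem_of ha hb⟩
  · rintro ⟨b, hb⟩
    rw [h.2] at hb
    simpa only [coe_toIco, sub_add_cancel] using hb.2.1

theorem RepB.neg_iff {β : 𝕊} {R : RectDiagram} {l : List (ℝ × (ℝ × ℝ))} (h : RepB β R l) {t b : 𝕊} :
    (t, b) ∈ R.neg ↔ ∃ a, (toIco (t - β), (a, toIco b)) ∈ l := by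
  constructor
  · intro hb
    obtain ⟨a, _, ha, _⟩ := col_ex R (t := t) (y := b) (by rw [mem_verts]; exact .inr hb)
    exact ⟨_, h.mem_of ha hb⟩
  · rintro ⟨a, ha⟩
    rw [h.2] at ha
    simpa only [coe_toIco, sub_add_cancel] using ha.2.2

theorem RepB.bds {β : 𝕊} {R : RectDiagram} {l : List (ℝ × (ℝ × ℝ))} (h : RepB β R l) {e}
    (he : e ∈ l) : e.1 ∈ Ico (0:ℝ) 1 ∧ e.2.1 ∈ Ico (0:ℝ) 1 ∧ e.2.2 ∈ Ico (0:ℝ) 1 :=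
  ((h.2 e.1 e.2.1 e.2.2).1 he).1

/-- The heights of a movie. -/
def hts (l : List (ℝ × (ℝ × ℝ))) : List (ℝ × ℝ) := l.map Prod.snd

theorem RepB.valid {β : 𝕊} {R : RectDiagram} {l : List (ℝ × (ℝ × ℝ))} (h : RepB β R l) :
    Valid (hts l) := by
  have n1 : (fsts (hts l)).Nodup := by
    unfold fsts hts List.Nodup
    rw [List.pairwise_map, List.pairwise_map]
    refine h.1.imp_of_mem ?_
    rintro ⟨t, a, b⟩ ⟨t', a', b'⟩ h1 h2 hlt (rfl : a = a')
    rw [h.2] at h1 h2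
    have := congrArg Prod.fst (row_pos R h1.2.1 h2.2.1 rfl)
    simp only [add_left_inj] at this
    rw [coe_inj h1.1.1 h2.1.1] at this
    exact hlt.ne this
  have n2 : (snds (hts l)).Nodup := by
    unfold snds hts List.Nodup
    rw [List.pairwise_map, List.pairwise_map]
    refine h.1.imp_of_mem ?_
    rintro ⟨t, a, b⟩ ⟨t', a', b'⟩ h1 h2 hlt (rfl : b = b')
    rw [h.2] at h1 h2
    have := congrArg Prod.fst (row_neg R h1.2.2 h2.2.2 rfl)
    simp only [add_left_inj] at this
    rw [coe_inj h1.1.1 h2.1.1] at this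
    exact hlt.ne this
  refine ⟨n1, ?_, ?_⟩
  · rw [List.perm_ext_iff_of_nodup n1 n2]
    intro x
    simp only [fsts, snds, hts, List.map_map, List.mem_map, Function.comp]
    constructor
    · rintro ⟨⟨t, a, b⟩, he, rfl⟩
      have h1 := (h.2 _ _ _).1 he
      obtain ⟨c, d, hc, hd⟩ := row_ex R (by rw [mem_verts]; exact .inl h1.2.1)
      rw [h.neg_iff] at hd
      obtain ⟨a', ha'⟩ := hd
      exact ⟨_, ha', toIco_coe h1.1.2.1⟩
    · rintro ⟨⟨t, a, b⟩, he, rfl⟩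
      have h1 := (h.2 _ _ _).1 he
      obtain ⟨c, d, hc, hd⟩ := row_ex R (by rw [mem_verts]; exact .inr h1.2.2)
      rw [h.pos_iff] at hc
      obtain ⟨a', ha'⟩ := hc
      exact ⟨_, ha', toIco_coe h1.1.2.2⟩
  · intro e he
    obtain ⟨⟨t, a, b⟩, hf, rfl⟩ := List.mem_map.1 he
    have he := hf
    have h1 := (h.2 _ _ _).1 he
    rintro (rfl : a = b)
    exact not_both R h1.2.1 h1.2.2

theorem RepB.ne_nil {β : 𝕊} {R : RectDiagram} {l : List (ℝ × (ℝ × ℝ))} (h : RepB β R l) :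
    l ≠ [] := by
  rintro rfl
  obtain ⟨⟨t, y⟩, hp⟩ := R.nonempty
  obtain ⟨a, b, ha, hb⟩ := col_ex R hp
  have := h.mem_of ha hb
  simp at this

/-- Base change. -/
theorem RepB.base {β β' : 𝕊} {R : RectDiagram} {l l' : List (ℝ × (ℝ × ℝ))} (h : RepB β R l)
    (h' : RepB β' R l') : ∃ l1 l2, hts l = l1 ++ l2 ∧ hts l' = l2 ++ l1 := by
  set c := toIco (β' - β) with hc
  have hc0 := toIco_nonneg (β' - β)
  have hc1 := toIco_lt (β' - β)
  have hcb : (c : 𝕊) + β = β' := by rw [hc, coe_toIco]; abel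
  rw [← hc] at hc0 hc1
  let l1 := l.filter (fun e => e.1 < c)
  let l2 := l.filter (fun e => ¬ e.1 < c)
  have e1 : l = l1 ++ l2 := by
    refine sorted_ext h.1 ?_ ?_
    · rw [List.pairwise_append]
      refine ⟨h.1.filter _, h.1.filter _, ?_⟩
      intro a ha b hb
      simp only [l1, l2, List.mem_filter, decide_eq_true_eq, not_lt] at ha hb
      exact ha.2.trans_le hb.2
    · intro e
      simp only [l1, l2, List.mem_append, List.mem_filter, decide_eq_true_eq]
      tauto
  let m : List (ℝ × (ℝ × ℝ)) := l2.map (fun e => (e.1 - c, e.2)) ++ l1.map (fun e => (e.1 - c + 1, e.2))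
  have e2 : l' = m := by
    refine sorted_ext h'.1 ?_ ?_
    · rw [List.pairwise_append, List.pairwise_map, List.pairwise_map]
      refine ⟨(h.1.filter _).imp (by intro a b h; simpa using h), (h.1.filter _).imp (by intro a b h; simpa using h), ?_⟩
      intro a ha b hb
      obtain ⟨a, ha', rfl⟩ := List.mem_map.1 ha
      obtain ⟨b, hb', rfl⟩ := List.mem_map.1 hb
      have h1 := h.bds (List.mem_of_mem_filter ha')
      have h2 := h.bds (List.mem_of_mem_filter hb')
      simp only [mem_Ico] at h1 h2
      show a.1 - c < b.1 - c + 1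
      linarith
    · rintro ⟨t, a, b⟩
      rw [h'.2]
      simp only [m, List.mem_append, List.mem_map, l1, l2, List.mem_filter, decide_eq_true_eq, not_lt,
        Prod.mk.injEq, Prod.exists, h.2]
      rw [← hcb]
      constructor
      · rintro ⟨⟨ht, ha, hb⟩, h1, h2⟩
        rw [mem_Ico] at ht
        by_cases htc : t + c < 1
        · left
          refine ⟨t + c, a, b, ⟨⟨⟨⟨by linarith, htc⟩, ha, hb⟩, ?_⟩, by linarith⟩, by ring, rfl, rfl⟩
          rw [AddCircle.coe_add, add_assoc]
          exact ⟨h1, h2⟩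
        · right
          refine ⟨t + c - 1, a, b, ⟨⟨⟨⟨by linarith, by linarith⟩, ha, hb⟩, ?_⟩, by linarith⟩, by ring, rfl, rfl⟩
          rw [AddCircle.coe_sub, AddCircle.coe_add, AddCircle.coe_period, sub_zero, add_assoc]
          exact ⟨h1, h2⟩
      · rintro (⟨s, a', b', ⟨⟨⟨hs, ha, hb⟩, h1, h2⟩, hsc⟩, rfl, rfl, rfl⟩ | ⟨s, a', b', ⟨⟨⟨hs, ha, hb⟩, h1, h2⟩, hsc⟩, rfl, rfl, rfl⟩)
        · rw [mem_Ico] at hs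
          refine ⟨⟨⟨by linarith, by linarith⟩, ha, hb⟩, ?_⟩
          rw [AddCircle.coe_sub, ← add_assoc, sub_add_cancel]
          exact ⟨h1, h2⟩
        · rw [mem_Ico] at hs
          refine ⟨⟨⟨by linarith, by linarith⟩, ha, hb⟩, ?_⟩
          rw [AddCircle.coe_add, AddCircle.coe_sub, AddCircle.coe_period, add_zero, ← add_assoc, sub_add_cancel]
          exact ⟨h1, h2⟩
  refine ⟨hts l1, hts l2, ?_, ?_⟩
  · rw [e1]; simp [hts]
  · rw [e2]; simp [hts, m, Function.comp_def]

end RD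

namespace RD

/-- `(a, b)` is the column of `R` over `θ`. -/
def col (R : RectDiagram) (θ a b : 𝕊) : Prop := (θ, a) ∈ R.pos ∧ (θ, b) ∈ R.neg

/-- The list of columns over `θ`. -/
def IsCol (R : RectDiagram) (θ : 𝕊) (o : List (ℝ × ℝ)) : Prop :=
  (o = [] ∧ ∀ y, (θ, y) ∉ R.verts) ∨ ∃ A B, col R θ A B ∧ o = [(toIco A, toIco B)]

theorem sorted_split {l : List (ℝ × (ℝ × ℝ))} (h : l.Pairwise (fun e f => e.1 < f.1)) (T : ℝ) (hT : 0 < T)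
    (h0 : ∀ e ∈ l, 0 ≤ e.1) :
    l = l.filter (fun e => e.1 = 0) ++ l.filter (fun e => 0 < e.1 ∧ e.1 < T) ++
      l.filter (fun e => e.1 = T) ++ l.filter (fun e => T < e.1) := by
  refine sorted_ext h ?_ ?_
  · simp only [List.pairwise_append, List.mem_append, List.mem_filter, decide_eq_true_eq]
    refine ⟨⟨⟨h.filter _, h.filter _, ?_⟩, h.filter _, ?_⟩, h.filter _, ?_⟩ <;> grind
  · intro e
    simp only [List.mem_append, List.mem_filter, decide_eq_true_eq]
    have := h0 e
    rcases lt_trichotomy e.1 0 with h | h | h <;> rcases lt_trichotomy e.1 T with h' | h' | h' <;> grind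

theorem IsCol.filter {β : 𝕊} {R : RectDiagram} {l : List (ℝ × (ℝ × ℝ))} (h : RepB β R l) {θ : 𝕊}
    {o : List (ℝ × ℝ)} (ho : IsCol R θ o) (T : ℝ) (hT : toIco (θ - β) = T) :
    hts (l.filter (fun e => e.1 = T)) = o := by
  subst hT
  rcases ho with ⟨rfl, ho⟩ | ⟨A, B, ⟨hA, hB⟩, rfl⟩
  · have : l.filter (fun e => e.1 = toIco (θ - β)) = [] := by
      rw [List.filter_eq_nil_iff]
      rintro ⟨t, a, b⟩ he
      simp only [decide_eq_true_eq]
      rintro rfl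
      rw [h.2] at he
      simp only [coe_toIco, sub_add_cancel] at he
      exact ho _ ((mem_verts R).2 (.inl he.2.1))
    rw [this]; rfl
  · have : l.filter (fun e => e.1 = toIco (θ - β)) = [(toIco (θ - β), (toIco A, toIco B))] := by
      refine sorted_ext (h.1.filter _) (by simp) ?_
      rintro ⟨t, a, b⟩
      simp only [List.mem_filter, decide_eq_true_eq, List.mem_singleton, Prod.mk.injEq]
      constructor
      · rintro ⟨he, rfl⟩
        rw [h.2] at he
        simp only [coe_toIco, sub_add_cancel] at he
        have e1 := congrArg Prod.snd (col_pos R he.2.1 hA rfl)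
        have e2 := congrArg Prod.snd (col_neg R he.2.2 hB rfl)
        simp only at e1 e2
        rw [← e1, ← e2, toIco_coe he.1.2.1, toIco_coe he.1.2.2]
        simp
      · rintro ⟨rfl, rfl, rfl⟩
        exact ⟨h.mem_of hA hB, rfl⟩
    rw [this]; rfl

theorem EM.frame {R R' : RectDiagram} {t1 t2 y1 y2 : 𝕊} (h : EM R R' t1 t2 y1 y2) :
    ∃ u w : List (ℝ × ℝ), (∀ e ∈ u, ¬ InClosed (toIco y1) (toIco y2) e.1 ∧ ¬ InClosed (toIco y1) (toIco y2) e.2) ∧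
      (∀ l o0 o1, RepB t1 R l → IsCol R t1 o0 → IsCol R t2 o1 → hts l = o0 ++ u ++ o1 ++ w) ∧
      (∀ l o0 o1, RepB t1 R' l → IsCol R' t1 o0 → IsCol R' t2 o1 → hts l = o0 ++ u ++ o1 ++ w) := by
  obtain ⟨l, hl⟩ := RepB.exists t1 R
  obtain ⟨l', hl'⟩ := RepB.exists t1 R'
  obtain ⟨h1, h2, h3, h4, h5, h6, h7, h8⟩ := h
  set T := toIco (t2 - t1) with hT
  have hT0 : 0 < T := by
    refine lt_of_le_of_ne (toIco_nonneg _) ?_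
    rw [← toIco_zero, hT, ne_eq, toIco_inj]
    exact fun e => h1 (sub_eq_zero.1 e.symm).symm
  have h00 : toIco (t1 - t1) = 0 := by rw [sub_self, toIco_zero]
  have hneq : ∀ t : ℝ, t ∈ Ico (0:ℝ) 1 → t ≠ 0 → t ≠ T → ((t:𝕊) + t1 ≠ t1 ∧ (t:𝕊) + t1 ≠ t2) := by
    intro t ht a b
    constructor
    · intro e
      apply a
      have : (t : 𝕊) = (0:ℝ) := by simpa using e
      rwa [coe_inj ht (by simp)] at this
    · intro e
      apply b
      rw [hT, ← e, add_sub_cancel_right, toIco_coe ht]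
  have hm : ∀ e : ℝ × (ℝ × ℝ), e.1 ≠ 0 → e.1 ≠ T → (e ∈ l' ↔ e ∈ l) := by
    rintro ⟨t, a, b⟩ k1 k2
    rw [hl.2, hl'.2]
    refine and_congr_right ?_
    rintro ⟨ht, -, -⟩
    obtain ⟨n1, n2⟩ := hneq t ht k1 k2
    rw [(h7 ((t:𝕊) + t1) a (by rintro ⟨e | e, -⟩ <;> contradiction)).1,
      (h7 ((t:𝕊) + t1) b (by rintro ⟨e | e, -⟩ <;> contradiction)).2.1]
  have eu : l'.filter (fun e => 0 < e.1 ∧ e.1 < T) = l.filter (fun e => 0 < e.1 ∧ e.1 < T) := by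
    refine sorted_ext (hl'.1.filter _) (hl.1.filter _) ?_
    intro e
    simp only [List.mem_filter, decide_eq_true_eq]
    refine and_congr_left ?_
    rintro ⟨k1, k2⟩
    exact hm e k1.ne' k2.ne
  have ew : l'.filter (fun e => T < e.1) = l.filter (fun e => T < e.1) := by
    refine sorted_ext (hl'.1.filter _) (hl.1.filter _) ?_
    intro e
    simp only [List.mem_filter, decide_eq_true_eq]
    refine and_congr_left ?_
    intro k1
    exact hm e (hT0.trans k1).ne' k1.ne'
  refine ⟨hts (l.filter (fun e => 0 < e.1 ∧ e.1 < T)), hts (l.filter (fun e => T < e.1)), ?_, ?_, ?_⟩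
  · intro e he
    obtain ⟨⟨t, a, b⟩, he', rfl⟩ := List.mem_map.1 he
    simp only [List.mem_filter, decide_eq_true_eq] at he'
    obtain ⟨k1, k2, k3⟩ := he'
    rw [hl.2] at k1
    obtain ⟨⟨ht, ha, hb⟩, hp, hn⟩ := k1
    obtain ⟨n1, n2⟩ := hneq t ht k2.ne' k3.ne
    have harc : (t : 𝕊) + t1 ∈ closedArc t1 t2 := by
      show toIco _ ≤ toIco _
      rw [add_sub_cancel_right, toIco_coe ht]
      exact k3.le
    constructor
    · intro hc
      refine (h7 ((t:𝕊) + t1) a (by rintro ⟨e | e, -⟩ <;> contradiction)).2.2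
        ((mem_verts R).2 (.inl hp)) ⟨harc, ?_⟩
      rw [mem_arc, toIco_coe ha]; exact hc
    · intro hc
      refine (h7 ((t:𝕊) + t1) b (by rintro ⟨e | e, -⟩ <;> contradiction)).2.2
        ((mem_verts R).2 (.inr hn)) ⟨harc, ?_⟩
      rw [mem_arc, toIco_coe hb]; exact hc
  · intro m o0 o1 hm h0 h1
    obtain rfl := hm.unique hl
    conv_lhs => rw [sorted_split hl.1 T hT0 (fun e he => (hl.bds he).1.1)]
    rw [← h0.filter hl 0 h00, ← h1.filter hl T rfl]
    simp [hts]
  · intro m o0 o1 hm h0 h1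
    obtain rfl := hm.unique hl'
    conv_lhs => rw [sorted_split hl'.1 T hT0 (fun e he => (hl'.bds he).1.1)]
    rw [← h0.filter hl' 0 h00, ← h1.filter hl' T rfl, eu, ew]
    simp [hts]

/-- Chains of steps. -/
abbrev Ch : List (ℝ × ℝ) → List (ℝ × ℝ) → Prop := Relation.ReflTransGen LStep

theorem Ch.symm {σ τ : List (ℝ × ℝ)} (h : Ch σ τ) : Ch τ σ := by
  induction h with
  | refl => exact .refl
  | tail _ h ih => exact Relation.ReflTransGen.head h.symm ih

theorem Ch.of_red {σ τ : List (ℝ × ℝ)} (hv : Valid σ) (h : Red σ τ) : Ch σ τ := by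
  induction h with
  | refl => exact .refl
  | tail h1 h2 ih => 
    have v1 := Red.valid h1 hv
    exact ih.tail ⟨v1, h2.valid v1, .inl (.red _ _ h2)⟩

theorem Valid.of_perm {σ τ : List (ℝ × ℝ)} (hv : Valid σ) (hp : σ.Perm τ) : Valid τ := by
  obtain ⟨h1, h2, h3⟩ := hv
  refine ⟨(hp.map Prod.fst).nodup_iff.1 h1, ?_, fun e he => h3 e (hp.mem_iff.2 he)⟩
  exact ((hp.map Prod.fst).symm.trans h2).trans (hp.map Prod.snd)

theorem Ch.rot {l1 l2 : List (ℝ × ℝ)} (hv : Valid (l1 ++ l2)) : Ch (l1 ++ l2) (l2 ++ l1) := by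
  induction l1 generalizing l2 with
  | nil => simpa using Relation.ReflTransGen.refl
  | cons x v ih =>
    have hv' : Valid (v ++ (l2 ++ [x])) := hv.of_perm (by
      rw [List.cons_append, ← List.append_assoc]
      exact (List.perm_append_singleton x (v ++ l2)).symm)
    refine Relation.ReflTransGen.head (b := v ++ (l2 ++ [x])) ⟨hv, hv', .inl ?_⟩ ?_
    · have := Step0.rot x (v ++ l2)
      simpa using this
    · simpa using ih hv'

theorem Ch.base {β β' : 𝕊} {R : RectDiagram} {l l' : List (ℝ × (ℝ × ℝ))} (h : RepB β R l)
    (h' : RepB β' R l') : Ch (hts l) (hts l') := by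
  obtain ⟨l1, l2, e1, e2⟩ := h.base h'
  have := h.valid
  rw [e1] at this
  rw [e1, e2]
  exact Ch.rot this

/-- Movies of the two diagrams are related. -/
def ChR (R R' : RectDiagram) : Prop := ∀ β β' l l', RepB β R l → RepB β' R' l' → Ch (hts l) (hts l')

theorem ChR.of {R R' : RectDiagram} {β : 𝕊} (h : ∀ l l', RepB β R l → RepB β R' l' → Ch (hts l) (hts l')) :
    ChR R R' := by
  intro β1 β2 l l' hl hl'
  obtain ⟨m, hm⟩ := RepB.exists β R
  obtain ⟨m', hm'⟩ := RepB.exists β R'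
  exact ((Ch.base hl hm).trans (h m m' hm hm')).trans (Ch.base hm' hl')

theorem ChR.symm {R R' : RectDiagram} (h : ChR R R') : ChR R' R :=
  fun β β' l l' hl hl' => (h β' β l' l hl' hl).symm

theorem ChR.trans {R R' R'' : RectDiagram} (h : ChR R R') (h' : ChR R' R'') : ChR R R'' := by
  intro β β' l l' hl hl'
  obtain ⟨m, hm⟩ := RepB.exists β R'
  exact (h _ _ _ _ hl hm).trans (h' _ _ _ _ hm hl')

theorem ChR.refl (R : RectDiagram) : ChR R R := fun _ _ _ _ h h' => Ch.base h h'

end RD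

namespace RD

theorem row_transfer {R R' : RectDiagram} {t t' y : 𝕊}
    (hs : ∀ s, s ≠ t → s ≠ t' → (((s, y) ∈ R.pos ↔ (s, y) ∈ R'.pos) ∧ ((s, y) ∈ R.neg ↔ (s, y) ∈ R'.neg)))
    (h : (t, y) ∈ R.verts) (h' : (t', y) ∉ R.verts) (k : (t', y) ∈ R'.verts) :
    ((t, y) ∈ R.pos → (t', y) ∈ R'.pos) ∧ ((t, y) ∈ R.neg → (t', y) ∈ R'.neg) := by
  obtain ⟨b, hb, hb'⟩ := row_partner R h
  have hbt : b ≠ t' := by rintro rfl; exact h' hb'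
  have o1 := row_opp R h hb' hb.symm
  have s1 := hs b hb hbt
  have k' : (b, y) ∈ R'.verts := by rw [mem_verts] at hb' ⊢; rwa [← s1.1, ← s1.2]
  have o2 := row_opp R' k k' hbt.symm
  have n1 := @not_both R (t, y)
  have n3 := @not_both R (b, y)
  have n2 := @not_both R' (b, y)
  grind

theorem col_transfer {R R' : RectDiagram} {t t' y : 𝕊}
    (hs : ∀ s, s ≠ t → s ≠ t' → (((y, s) ∈ R.pos ↔ (y, s) ∈ R'.pos) ∧ ((y, s) ∈ R.neg ↔ (y, s) ∈ R'.neg)))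
    (h : (y, t) ∈ R.verts) (h' : (y, t') ∉ R.verts) (k : (y, t') ∈ R'.verts) :
    ((y, t) ∈ R.pos → (y, t') ∈ R'.pos) ∧ ((y, t) ∈ R.neg → (y, t') ∈ R'.neg) := by
  obtain ⟨b, hb, hb'⟩ := col_partner R h
  have hbt : b ≠ t' := by rintro rfl; exact h' hb'
  have o1 := col_opp R h hb' hb.symm
  have s1 := hs b hb hbt
  have k' : (y, b) ∈ R'.verts := by rw [mem_verts] at hb' ⊢; rwa [← s1.1, ← s1.2]
  have o2 := col_opp R' k k' hbt.symm
  have n1 := @not_both R (y, t)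
  have n3 := @not_both R (y, b)
  have n2 := @not_both R' (y, b)
  grind

/-- If a full column of `R'` consists of corners, then `R` has no other vertex there. -/
theorem col_empty {R R' : RectDiagram} {t y1 y2 : 𝕊} (hy : y1 ≠ y2)
    (hs : ∀ s, s ≠ y1 → s ≠ y2 → (((t, s) ∈ R.pos ↔ (t, s) ∈ R'.pos) ∧ ((t, s) ∈ R.neg ↔ (t, s) ∈ R'.neg)))
    (k1 : (t, y1) ∈ R'.verts) (k2 : (t, y2) ∈ R'.verts) (h1 : (t, y1) ∉ R.verts) (h2 : (t, y2) ∉ R.verts) :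
    ∀ y, (t, y) ∉ R.verts := by
  intro y hy'
  have a1 : y ≠ y1 := by rintro rfl; exact h1 hy'
  have a2 : y ≠ y2 := by rintro rfl; exact h2 hy'
  have s1 := hs y a1 a2
  have k' : (t, y) ∈ R'.verts := by rw [mem_verts] at hy' ⊢; rwa [← s1.1, ← s1.2]
  rcases col3 R' k1 k2 k' hy with h | h <;> contradiction

section arcs
variable {α : Type*} [LinearOrder α]

theorem unl_of_avoid {h1 h2 : α} {e : α × α} (hne : h1 ≠ h2) (he : ¬ InClosed h1 h2 e.1 ∧ ¬ InClosed h1 h2 e.2) :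
    Unlinked e (h1, h2) ∧ Unlinked e (h2, h1) := by
  obtain ⟨a, b⟩ := e
  unfold Unlinked InClosed InOpen at *
  simp only at *
  constructor <;> grind

theorem open_of_avoid {h1 h2 a : α} (hne : h1 ≠ h2) (ha : ¬ InClosed h1 h2 a) :
    InOpen a h2 h1 ∧ InOpen h1 a h2 := by
  unfold InClosed InOpen at *
  constructor <;> grind

end arcs

variable {R R' : RectDiagram} {t1 t2 y1 y2 : 𝕊}

theorem EM.same (h : EM R R' t1 t2 y1 y2) {t y : 𝕊} (hn : (t ≠ t1 ∧ t ≠ t2) ∨ (y ≠ y1 ∧ y ≠ y2)) :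
    ((t, y) ∈ R.pos ↔ (t, y) ∈ R'.pos) ∧ ((t, y) ∈ R.neg ↔ (t, y) ∈ R'.neg) := by
  have := h.2.2.2.2.2.2.1 t y (by grind)
  exact ⟨this.1, this.2.1⟩

theorem EM.avoid (h : EM R R' t1 t2 y1 y2) {y : 𝕊} {t : 𝕊} (ht : t = t1 ∨ t = t2) (h1 : y ≠ y1) (h2 : y ≠ y2)
    (hv : (t, y) ∈ R.verts) : ¬ InClosed (toIco y1) (toIco y2) (toIco y) := by
  have := (h.2.2.2.2.2.2.1 t y (by grind)).2.2 hv
  rw [← mem_arc]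
  intro hc
  refine this ⟨?_, hc⟩
  rcases ht with rfl | rfl
  · exact mem_arc_left _ _
  · exact mem_arc_right _ _

theorem chR_V (h : EM R R' t1 t2 y1 y2) (c1 : (t1, y1) ∈ R.verts) (c4 : (t1, y2) ∈ R.verts)
    (c2 : (t2, y1) ∉ R.verts) (c3 : (t2, y2) ∉ R.verts) : ChR R R' := by
  obtain ⟨u, w, hu, hl, hl'⟩ := h.frame
  have hh := h
  obtain ⟨h1, h2, h3, h4, h5, h6, h7, h8⟩ := hh
  have k2 := h4.2 c2
  have k3 := h5.2 c3
  have k1 : (t1, y1) ∉ R'.verts := fun e => (h3.1 e) c1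
  have k4 : (t1, y2) ∉ R'.verts := fun e => (h6.1 e) c4
  have hne : toIco y1 ≠ toIco y2 := by rwa [ne_eq, toIco_inj]
  have i2 : IsCol R t2 [] := .inl ⟨rfl, col_empty h2 (fun s a b => h.same (.inr ⟨a, b⟩)) k2 k3 c2 c3⟩
  have i1 : IsCol R' t1 [] := .inl ⟨rfl, col_empty h2 (fun s a b => h.symm.same (.inr ⟨a, b⟩)) c1 c4 k1 k4⟩
  have r1 := row_transfer (fun s a b => h.same (y := y1) (.inl ⟨a, b⟩)) c1 c2 k2
  have r2 := row_transfer (fun s a b => h.same (y := y2) (.inl ⟨a, b⟩)) c4 c3 k3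
  refine ChR.of (β := t1) fun l l' k k' => ?_
  have hv := k.valid
  rcases col_opp R c1 c4 h2 with ⟨o1, o2⟩ | ⟨o1, o2⟩
  · rw [hl l _ _ k (.inr ⟨_, _, ⟨o1, o2⟩, rfl⟩) i2] at hv ⊢
    rw [hl' l' _ _ k' i1 (.inr ⟨_, _, ⟨r1.1 o1, r2.2 o2⟩, rfl⟩)]
    refine Ch.of_red hv ?_
    have := (Red.moveRight (toIco y1, toIco y2) u (fun e he => (unl_of_avoid hne (hu e he)).1)).right w
    simpa using this
  · rw [hl l _ _ k (.inr ⟨_, _, ⟨o2, o1⟩, rfl⟩) i2] at hv ⊢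
    rw [hl' l' _ _ k' i1 (.inr ⟨_, _, ⟨r2.1 o2, r1.2 o1⟩, rfl⟩)]
    refine Ch.of_red hv ?_
    have := (Red.moveRight (toIco y2, toIco y1) u (fun e he => (unl_of_avoid hne (hu e he)).2)).right w
    simpa using this

theorem chR_H (h : EM R R' t1 t2 y1 y2) (c1 : (t1, y1) ∈ R.verts) (c4 : (t1, y2) ∉ R.verts)
    (c2 : (t2, y1) ∈ R.verts) (c3 : (t2, y2) ∉ R.verts) : ChR R R' := by
  obtain ⟨u, w, hu, hl, hl'⟩ := h.frame
  have hh := h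
  obtain ⟨h1, h2, h3, h4, h5, h6, h7, h8⟩ := hh
  have k4 := h6.2 c4
  have k3 := h5.2 c3
  have k1 : (t1, y1) ∉ R'.verts := fun e => (h3.1 e) c1
  have k2 : (t2, y1) ∉ R'.verts := fun e => (h4.1 e) c2
  have hne : toIco y1 ≠ toIco y2 := by rwa [ne_eq, toIco_inj]
  have r1 := col_transfer (fun s a b => h.same (t := t1) (.inr ⟨a, b⟩)) c1 c4 k4
  have r2 := col_transfer (fun s a b => h.same (t := t2) (.inr ⟨a, b⟩)) c2 c3 k3
  obtain ⟨A, hA, hA'⟩ := col_partner R c1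
  obtain ⟨B, hB, hB'⟩ := col_partner R c2
  have hA2 : A ≠ y2 := by rintro rfl; exact c4 hA'
  have hB2 : B ≠ y2 := by rintro rfl; exact c3 hB'
  have aA := h.avoid (.inl rfl) hA hA2 hA'
  have aB := h.avoid (.inr rfl) hB hB2 hB'
  have sA := h.same (t := t1) (.inr ⟨hA, hA2⟩)
  have sB := h.same (t := t2) (.inr ⟨hB, hB2⟩)
  have oA := col_opp R c1 hA' hA.symm
  have oB := col_opp R c2 hB' hB.symm
  refine ChR.of (β := t1) fun l l' k k' => ?_
  have hv := k.valid
  have hv' := k'.valid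
  rcases row_opp R c1 c2 h1 with ⟨o1, o2⟩ | ⟨o1, o2⟩
  · have p1 : (t1, A) ∈ R.neg := by
      rcases oA with e | e
      · exact e.2
      · exact absurd e.1 (not_both R o1)
    have p2 : (t2, B) ∈ R.pos := by
      rcases oB with e | e
      · exact absurd o2 (not_both R e.1)
      · exact e.2
    have q1 := hl l _ _ k (.inr ⟨_, _, ⟨o1, p1⟩, rfl⟩) (.inr ⟨_, _, ⟨p2, o2⟩, rfl⟩)
    have q2 := hl' l' _ _ k' (.inr ⟨_, _, ⟨r1.1 o1, sA.2.1 p1⟩, rfl⟩) (.inr ⟨_, _, ⟨sB.1.1 p2, r2.2 o2⟩, rfl⟩)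
    refine .single ⟨hv, hv', .inl ?_⟩
    rw [q1, q2]
    have := Step0.bigex (toIco y1) (toIco y2) (toIco B) (toIco A) u w hu aB aA
    simpa using this
  · have p1 : (t1, A) ∈ R.pos := by
      rcases oA with e | e
      · exact absurd o1 (not_both R e.1)
      · exact e.2
    have p2 : (t2, B) ∈ R.neg := by
      rcases oB with e | e
      · exact e.2
      · exact absurd e.1 (not_both R o2)
    have q1 := hl l _ _ k (.inr ⟨_, _, ⟨p1, o1⟩, rfl⟩) (.inr ⟨_, _, ⟨o2, p2⟩, rfl⟩)
    have q2 := hl' l' _ _ k' (.inr ⟨_, _, ⟨sA.1.1 p1, r1.2 o1⟩, rfl⟩) (.inr ⟨_, _, ⟨r2.1 o2, sB.2.1 p2⟩, rfl⟩)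
    rw [q1, q2]
    rw [q1] at hv
    rw [q2] at hv'
    generalize toIco y1 = g1, toIco y2 = g2, toIco A = a, toIco B = b at *
    -- common expansion
    let M : List (ℝ × ℝ) := (a, g1) :: u ++ (g1, g2) :: (g2, b) :: w
    have m1 : Red M ([(a, g1)] ++ u ++ [(g1, b)] ++ w) := by
      refine Relation.ReflTransGen.single ?_
      have := Red1.merge ((a, g1) :: u) w g1 g2 b (open_of_avoid hne aB).2
      simpa [M] using this
    have m2 : Red M ([(a, g2)] ++ u ++ [(g2, b)] ++ w) := by
      have s1 : Red M ((a, g1) :: (g1, g2) :: (u ++ (g2, b) :: w)) := by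
        have := (Red.moveLeft (g1, g2) u (fun e he => (unl_of_avoid hne (hu e he)).1)).ctx [(a, g1)] ((g2, b) :: w)
        simpa [M] using this
      refine s1.trans (Relation.ReflTransGen.single ?_)
      have := Red1.merge [] (u ++ (g2, b) :: w) a g1 g2 (open_of_avoid hne aA).1
      simpa using this
    have hM : Valid M := by
      obtain ⟨v1, v2, v3⟩ := hv
      obtain ⟨v1', v2', v3'⟩ := hv'
      have perm1 : M.Perm ((g1, g2) :: ((a, g1) :: u ++ (g2, b) :: w)) := by
        exact List.perm_middle
      have perm2 : (([(a, g2)] ++ u ++ [(g2, b)] ++ w)).Perm ((a, g2) :: (u ++ (g2, b) :: w)) := by simp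
      refine Valid.of_perm ?_ perm1.symm
      simp only [fsts, snds, List.map_append, List.map_cons, List.map_nil, List.cons_append, List.nil_append, List.append_assoc, List.singleton_append] at v1 v2 v1' v2'
      refine ⟨?_, ?_, ?_⟩
      · simp only [fsts, List.map_cons, List.map_append, List.nodup_cons, List.cons_append]
        refine ⟨?_, List.nodup_cons.1 v1'⟩
        have q : (g1 :: (a :: List.map Prod.fst u ++ List.map Prod.fst w)).Nodup :=
          (List.Perm.nodup_iff List.perm_middle).1 (by simpa using v1)
        have q1 := (List.nodup_cons.1 q).1
        intro hmem
        apply q1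
        rw [List.mem_cons, List.mem_append, List.mem_cons] at hmem
        rw [List.mem_append, List.mem_cons]
        rcases hmem with h | h | h | h
        · exact Or.inl (Or.inl h)
        · exact Or.inl (Or.inr h)
        · exact absurd h hne
        · exact Or.inr h
      · simp only [fsts, snds, List.map_cons, List.map_append, List.cons_append]
        refine List.Perm.trans ?_ (List.Perm.swap g2 g1 _)
        exact List.Perm.cons g1 v2'
      · intro e he
        rcases List.mem_cons.1 he with rfl | he
        · exact hne
        · rcases List.mem_append.1 he with he | he
          · exact v3 e (by simp at he ⊢; grind)
          · exact v3' e (by simp at he ⊢; grind)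
    exact (Ch.of_red hM m1).symm.trans (Ch.of_red hM m2)

theorem chR_exch (h : ExchangeMove R R') : ChR R R' := by
  rw [exch_iff] at h
  obtain ⟨t1, t2, y1, y2, h, hc | hc | hc | hc⟩ := h
  · exact chR_V h hc.1 hc.2.1 hc.2.2.1 hc.2.2.2
  · obtain ⟨h1, h2, h3, h4, h5, h6, h7, h8⟩ := id h
    exact (chR_V h.symm (by grind) (by grind) (by grind) (by grind)).symm
  · exact chR_H h hc.1 hc.2.1 hc.2.2.1 hc.2.2.2
  · obtain ⟨h1, h2, h3, h4, h5, h6, h7, h8⟩ := id h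
    exact (chR_H h.symm (by grind) (by grind) (by grind) (by grind)).symm

theorem chR_S4 (h : EM R R' t1 t2 y1 y2) (c1 : (t1, y1) ∉ R.verts) (c4 : (t1, y2) ∈ R.verts)
    (c2 : (t2, y1) ∉ R.verts) (c3 : (t2, y2) ∉ R.verts) (hp : (t2, y1) ∈ R'.pos) : ChR R R' := by
  obtain ⟨u, w, hu, hl, hl'⟩ := h.frame
  have hh := h
  obtain ⟨h1, h2, h3, h4, h5, h6, h7, h8⟩ := hh
  have k1 := h3.2 c1
  have k2 := h4.2 c2
  have k3 := h5.2 c3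
  have hne : toIco y1 ≠ toIco y2 := by rwa [ne_eq, toIco_inj]
  have i2 : IsCol R t2 [] := .inl ⟨rfl, col_empty h2 (fun s a b => h.same (.inr ⟨a, b⟩)) k2 k3 c2 c3⟩
  have n1 : (t1, y1) ∈ R'.neg := by
    rcases row_opp R' k1 k2 h1 with e | e
    · exact absurd e.2 (not_both R' hp)
    · exact e.1
  have n3 : (t2, y2) ∈ R'.neg := by
    rcases col_opp R' k2 k3 h2 with e | e
    · exact e.2
    · exact absurd e.1 (not_both R' hp)
  have r := row_transfer (fun s a b => h.same (y := y2) (.inl ⟨a, b⟩)) c4 c3 k3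
  have n4 : (t1, y2) ∈ R.neg := by
    rcases (mem_verts R).1 c4 with e | e
    · exact absurd n3 (not_both R' (r.1 e))
    · exact e
  obtain ⟨A, hA, hA'⟩ := col_partner R c4
  have hA1 : A ≠ y1 := by rintro rfl; exact c1 hA'
  have aA := h.avoid (.inl rfl) hA1 hA hA'
  have sA := h.same (t := t1) (.inr ⟨hA1, hA⟩)
  have pA : (t1, A) ∈ R.pos := by
    rcases col_opp R c4 hA' hA.symm with e | e
    · exact absurd n4 (not_both R e.1)
    · exact e.2
  refine ChR.of (β := t1) fun l l' k k' => ?_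
  have hv' := k'.valid
  have q1 := hl l _ _ k (.inr ⟨_, _, ⟨pA, n4⟩, rfl⟩) i2
  have q2 := hl' l' _ _ k' (.inr ⟨_, _, ⟨sA.1.1 pA, n1⟩, rfl⟩) (.inr ⟨_, _, ⟨hp, n3⟩, rfl⟩)
  rw [q1, q2]
  rw [q2] at hv'
  refine (Ch.of_red hv' ?_).symm
  have s1 := (Red.moveLeft (toIco y1, toIco y2) u (fun e he => (unl_of_avoid hne (hu e he)).1)).ctx
    [(toIco A, toIco y1)] w
  have s2 := Red1.merge [] (u ++ w) _ _ _ (open_of_avoid hne aA).1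
  have := s1.trans (.single (by simpa using s2))
  simpa using this

theorem chR_S2 (h : EM R R' t1 t2 y1 y2) (c1 : (t1, y1) ∉ R.verts) (c4 : (t1, y2) ∉ R.verts)
    (c2 : (t2, y1) ∈ R.verts) (c3 : (t2, y2) ∉ R.verts) (hp : (t2, y2) ∈ R'.pos) : ChR R R' := by
  obtain ⟨u, w, hu, hl, hl'⟩ := h.frame
  have hh := h
  obtain ⟨h1, h2, h3, h4, h5, h6, h7, h8⟩ := hh
  have k1 := h3.2 c1
  have k4 := h6.2 c4
  have k3 := h5.2 c3
  have hne : toIco y1 ≠ toIco y2 := by rwa [ne_eq, toIco_inj]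
  have i1 : IsCol R t1 [] := .inl ⟨rfl, col_empty h2 (fun s a b => h.same (.inr ⟨a, b⟩)) k1 k4 c1 c4⟩
  have n4 : (t1, y2) ∈ R'.neg := by
    rcases row_opp R' k4 k3 h1 with e | e
    · exact absurd e.2 (not_both R' hp)
    · exact e.1
  have n1 : (t1, y1) ∈ R'.pos := by
    rcases col_opp R' k1 k4 h2 with e | e
    · exact e.1
    · exact absurd n4 (not_both R' e.2)
  have r := row_transfer (fun s a b => h.same (y := y1) (.inl ⟨b, a⟩)) c2 c1 k1
  have n2 : (t2, y1) ∈ R.pos := by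
    rcases (mem_verts R).1 c2 with e | e
    · exact e
    · exact absurd (r.2 e) (not_both R' n1)
  obtain ⟨A, hA, hA'⟩ := col_partner R c2
  have hA1 : A ≠ y2 := by rintro rfl; exact c3 hA'
  have aA := h.avoid (.inr rfl) hA hA1 hA'
  have sA := h.same (t := t2) (.inr ⟨hA, hA1⟩)
  have pA : (t2, A) ∈ R.neg := by
    rcases col_opp R c2 hA' hA.symm with e | e
    · exact e.2
    · exact absurd e.1 (not_both R n2)
  refine ChR.of (β := t1) fun l l' k k' => ?_
  have hv' := k'.valid
  have q1 := hl l _ _ k i1 (.inr ⟨_, _, ⟨n2, pA⟩, rfl⟩)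
  have q2 := hl' l' _ _ k' (.inr ⟨_, _, ⟨n1, n4⟩, rfl⟩) (.inr ⟨_, _, ⟨hp, sA.2.1 pA⟩, rfl⟩)
  rw [q1, q2]
  rw [q2] at hv'
  refine (Ch.of_red hv' ?_).symm
  have s1 := (Red.moveRight (toIco y1, toIco y2) u (fun e he => (unl_of_avoid hne (hu e he)).1)).right
    ((toIco y2, toIco A) :: w)
  have s2 := Red1.merge u w _ _ _ (open_of_avoid hne aA).2
  have := s1.trans (.single (by simpa using s2))
  simpa using this

theorem stab_corners (h : EM R R' t1 t2 y1 y2) (hc : R'.verts.card = R.verts.card + 2) :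
    ∀ v, (v = (t1, y1) ∨ v = (t2, y1) ∨ v = (t2, y2) ∨ v = (t1, y2)) → v ∈ R.verts →
     ∀ v', (v' = (t1, y1) ∨ v' = (t2, y1) ∨ v' = (t2, y2) ∨ v' = (t1, y2)) → v' ∈ R.verts → v = v' := by
  obtain ⟨k, k1, k2⟩ := h.card
  rw [k1, k2] at hc
  clear k1 k2
  by_cases p1 : (t1, y1) ∈ R.verts <;> by_cases p2 : (t2, y1) ∈ R.verts <;>
    by_cases p3 : (t2, y2) ∈ R.verts <;> by_cases p4 : (t1, y2) ∈ R.verts <;>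
    simp only [p1, p2, p3, p4, if_true, if_false] at hc <;> first | omega | grind

theorem chR_stab (h : StabOfType R R' .rII) : ChR R R' := by
  obtain ⟨t1, t2, y1, y2, h, hc, ⟨v, ⟨hv, -⟩, y0, hy0, k1, k2, hvc, hp⟩⟩ := h
  rw [elem_iff] at h
  have hs := stab_corners h hc
  have h1 := h.1
  have h2 := h.2.1
  simp only [mem_insert_iff, mem_singleton_iff] at hy0
  obtain ⟨-, -, h3, h4, h5, h6, -, -⟩ := id h
  have hv : v ∈ R.verts := hv
  rcases hvc with rfl | rfl
  · have hy : y0 = y1 := by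
      rcases hy0 with e | e
      · exact e
      · subst e; exact absurd hv (h6.1 k1)
    subst hy
    refine chR_S4 h (fun e => ?_) hv (fun e => ?_) (fun e => ?_) hp
    · have := hs _ (by simp) hv _ (by simp) e; simp only [Prod.mk.injEq] at this; exact h2 this.2.symm
    · have := hs _ (by simp) hv _ (by simp) e; simp only [Prod.mk.injEq] at this; exact h1 this.1
    · have := hs _ (by simp) hv _ (by simp) e; simp only [Prod.mk.injEq] at this; exact h1 this.1
  · have hy : y0 = y2 := by
      rcases hy0 with e | e
      · subst e; exact absurd hv (h4.1 k2)
      · exact e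
    subst hy
    refine chR_S2 h (fun e => ?_) (fun e => ?_) hv (fun e => ?_) hp
    · have := hs _ (by simp) hv _ (by simp) e; simp only [Prod.mk.injEq] at this; exact h1 this.1.symm
    · have := hs _ (by simp) hv _ (by simp) e; simp only [Prod.mk.injEq] at this; exact h1 this.1.symm
    · have := hs _ (by simp) hv _ (by simp) e; simp only [Prod.mk.injEq] at this; exact h2 this.2

theorem destab_iff {T : OType} : DestabOfType R R' T ↔ StabOfType R' R T := by
  unfold DestabOfType StabOfType
  simp only [elem_iff]
  constructor <;> rintro ⟨t1, t2, y1, y2, h, k⟩ <;> exact ⟨t1, t2, y1, y2, h.symm, k⟩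

theorem exch_symm (h : ExchangeMove R R') : ExchangeMove R' R := by
  obtain ⟨⟨t1, t2, y1, y2, h⟩, hc⟩ := h
  exact ⟨⟨t1, t2, y1, y2, elem_iff.2 (elem_iff.1 h).symm⟩, hc.symm⟩

theorem move_symm {T : OType} (h : MoveOfType T R R') : MoveOfType T R' R := by
  rcases h with h | h | h
  · exact .inl (exch_symm h)
  · exact .inr (.inr (destab_iff.2 h))
  · exact .inr (.inl (destab_iff.1 h))

theorem equiv_symm {T : OType} (h : EquivOfType T R R') : EquivOfType T R' R := by
  induction h with
  | refl => exact .refl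
  | tail _ h ih => exact Relation.ReflTransGen.head (move_symm h) ih

/-- Equivalent diagrams have related movies. -/
theorem chR_equiv (h : EquivOfType .rII R R') : ChR R R' := by
  induction h with
  | refl => exact ChR.refl _
  | tail _ h ih =>
    refine ih.trans ?_
    rcases h with h | h | h
    · exact chR_exch h
    · exact chR_stab h
    · exact (chR_stab (destab_iff.1 h)).symm

end RD

namespace RD
section M
set_option linter.unusedSectionVars false
variable {α β : Type*} [LinearOrder α] [LinearOrder β]

/-- Apply a map to all heights. -/
def mapL {α β : Type*} (f : α → β) (σ : List (α × α)) : List (β × β) := σ.map (Prod.map f f)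

/-- All heights belong to `s`. -/
def HIn {α : Type*} (s : Set α) (σ : List (α × α)) : Prop := ∀ e ∈ σ, e.1 ∈ s ∧ e.2 ∈ s

/-- Chains with bounded length and heights in `I`. -/
def CH (I : Set α) (B : ℕ) : List (α × α) → List (α × α) → Prop :=
  Relation.ReflTransGen (fun σ τ => LStep σ τ ∧ (σ.length ≤ B ∧ HIn I σ) ∧ (τ.length ≤ B ∧ HIn I τ))

theorem CH.symm {I : Set α} {B : ℕ} {σ τ : List (α × α)} (h : CH I B σ τ) : CH I B τ σ := by
  induction h with
  | refl => exact .refl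
  | tail _ h ih => exact Relation.ReflTransGen.head ⟨h.1.symm, h.2.2, h.2.1⟩ ih

theorem CH.trans {I : Set α} {B : ℕ} {σ τ ρ : List (α × α)} (h : CH I B σ τ) (h' : CH I B τ ρ) :
    CH I B σ ρ := Relation.ReflTransGen.trans h h'

theorem HIn.append {s : Set α} {u v : List (α × α)} : HIn s (u ++ v) ↔ HIn s u ∧ HIn s v := by
  simp only [HIn, List.mem_append, or_imp, forall_and]
  tauto

theorem HIn.cons {s : Set α} {x : α × α} {v : List (α × α)} :
    HIn s (x :: v) ↔ (x.1 ∈ s ∧ x.2 ∈ s) ∧ HIn s v := by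
  simp only [HIn, List.mem_cons, or_imp, forall_and, forall_eq]
  tauto

theorem inOpen_map {f : α → β} {s : Set α} (hf : StrictMonoOn f s) {a b x : α} (ha : a ∈ s)
    (hb : b ∈ s) (hx : x ∈ s) : InOpen (f a) (f b) (f x) ↔ InOpen a b x := by
  unfold InOpen
  rw [hf.lt_iff_lt ha hx, hf.lt_iff_lt hx hb, hf.lt_iff_lt hb ha]

theorem inClosed_map {f : α → β} {s : Set α} (hf : StrictMonoOn f s) {a b x : α} (ha : a ∈ s)
    (hb : b ∈ s) (hx : x ∈ s) : InClosed (f a) (f b) (f x) ↔ InClosed a b x := by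
  unfold InClosed
  rw [inOpen_map hf ha hb hx, hf.injOn.eq_iff hx ha, hf.injOn.eq_iff hx hb]

theorem Valid.map {f : α → β} {s : Set α} (hf : StrictMonoOn f s) {σ : List (α × α)} (h : Valid σ)
    (hs : HIn s σ) : Valid (mapL f σ) := by
  obtain ⟨h1, h2, h3⟩ := h
  have e1 : fsts (mapL f σ) = (fsts σ).map f := by simp [fsts, mapL]
  have e2 : snds (mapL f σ) = (snds σ).map f := by simp [snds, mapL]
  refine ⟨?_, ?_, ?_⟩
  · rw [e1]
    refine List.Nodup.map_on ?_ h1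
    intro x hx y hy hxy
    simp only [fsts, List.mem_map] at hx hy
    obtain ⟨e, he, rfl⟩ := hx
    obtain ⟨g, hg, rfl⟩ := hy
    exact hf.injOn (hs e he).1 (hs g hg).1 hxy
  · rw [e1, e2]
    exact h2.map f
  · intro e he
    simp only [mapL, List.mem_map] at he
    obtain ⟨g, hg, rfl⟩ := he
    exact fun hh => h3 g hg (hf.injOn (hs g hg).1 (hs g hg).2 hh)

theorem Step0.map {f : α → β} {s : Set α} (hf : StrictMonoOn f s) {σ τ : List (α × α)}
    (h : Step0 σ τ) (hs : HIn s σ) (ht : HIn s τ) : Step0 (mapL f σ) (mapL f τ) := by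
  cases h with
  | red _ _ h =>
    refine Step0.red _ _ ?_
    cases h with
    | swap u v x y h =>
      simp only [HIn.append, HIn.cons] at hs
      obtain ⟨x1, x2⟩ := x
      obtain ⟨y1, y2⟩ := y
      obtain ⟨_, ⟨p1, p2⟩, ⟨q1, q2⟩, _⟩ := hs
      have := Red1.swap (mapL f u) (mapL f v) (f x1, f x2) (f y1, f y2) (by
        obtain ⟨k1, k2, k3, k4, k5⟩ := h
        refine ⟨?_, ?_, ?_, ?_, ?_⟩
        · exact fun hh => k1 (hf.injOn q1 p1 hh)
        · exact fun hh => k2 (hf.injOn q1 p2 hh)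
        · exact fun hh => k3 (hf.injOn q2 p1 hh)
        · exact fun hh => k4 (hf.injOn q2 p2 hh)
        · simp only
          rw [inOpen_map hf p1 p2 q1, inOpen_map hf p1 p2 q2]
          exact k5)
      simpa [mapL] using this
    | merge u v a m b h =>
      simp only [HIn.append, HIn.cons] at hs
      obtain ⟨_, ⟨p1, p2⟩, ⟨q1, q2⟩, _⟩ := hs
      have := Red1.merge (mapL f u) (mapL f v) (f a) (f m) (f b) ((inOpen_map hf p1 q2 p2).2 h)
      simpa [mapL] using this
  | rot x v => simpa [mapL] using Step0.rot (Prod.map f f x) (mapL f v)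
  | bigex h h' a b u v hu ha hb =>
    simp only [HIn.append, HIn.cons] at hs ht
    obtain ⟨⟨p1, p2⟩, p3, ⟨p4, p5⟩, p6⟩ := hs
    obtain ⟨⟨q1, q2⟩, q3, ⟨q4, q5⟩, q6⟩ := ht
    have := Step0.bigex (f h) (f h') (f a) (f b) (mapL f u) (mapL f v) (by
      intro e he
      simp only [mapL, List.mem_map] at he
      obtain ⟨g, hg, rfl⟩ := he
      simp only [Prod.map]
      rw [inClosed_map hf p1 q1 (p3 g hg).1, inClosed_map hf p1 q1 (p3 g hg).2]
      exact hu g hg) (by rw [inClosed_map hf p1 q1 p4]; exact ha)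
      (by rw [inClosed_map hf p1 q1 p2]; exact hb)
    simpa [mapL] using this

theorem LStep.map {f : α → β} {s : Set α} (hf : StrictMonoOn f s) {σ τ : List (α × α)}
    (h : LStep σ τ) (hs : HIn s σ) (ht : HIn s τ) : LStep (mapL f σ) (mapL f τ) :=
  ⟨h.1.map hf hs, h.2.1.map hf ht, h.2.2.imp (fun k => k.map hf hs ht) (fun k => k.map hf ht hs)⟩

theorem Valid.perm {σ τ : List (α × α)} (h : Valid σ) (hp : σ.Perm τ) : Valid τ := by
  obtain ⟨h1, h2, h3⟩ := h
  refine ⟨?_, ?_, fun e he => h3 e (hp.mem_iff.2 he)⟩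
  · exact (List.Perm.nodup_iff (hp.map _)).1 h1
  · exact ((hp.map Prod.fst).symm.trans h2).trans (hp.map Prod.snd)

theorem CH.rot {I : Set α} {B : ℕ} (p : List (α × α)) : ∀ {q : List (α × α)}, Valid (p ++ q) →
    HIn I (p ++ q) → (p ++ q).length ≤ B → CH I B (p ++ q) (q ++ p) := by
  induction p with
  | nil => intro q _ _ _; rw [List.append_nil]; exact Relation.ReflTransGen.refl
  | cons x p ih =>
    intro q hv hI hB
    have pe : (x :: p ++ q).Perm (p ++ (q ++ [x])) := by
      rw [← List.append_assoc]
      exact (List.perm_append_singleton x (p ++ q)).symm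
    have hI' : HIn I (p ++ (q ++ [x])) := fun e he => hI e (pe.mem_iff.2 he)
    have hB' : (p ++ (q ++ [x])).length ≤ B := by rw [← pe.length_eq]; exact hB
    have hs : CH I B (x :: p ++ q) (p ++ (q ++ [x])) := by
      refine Relation.ReflTransGen.single ⟨⟨hv, hv.perm pe, .inl ?_⟩, ⟨hB, hI⟩, hB', hI'⟩
      simpa using Step0.rot x (p ++ q)
    refine hs.trans ?_
    simpa using ih (hv.perm pe) hI' hB'

theorem HIn.fsts {σ : List (α × α)} (h : Valid σ) {s : Set α} : HIn s σ ↔ ∀ x ∈ fsts σ, x ∈ s := by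
  constructor
  · intro hh x hx
    simp only [RD.fsts, List.mem_map] at hx
    obtain ⟨e, he, rfl⟩ := hx
    exact (hh e he).1
  · intro hh e he
    refine ⟨hh _ (List.mem_map_of_mem he), hh _ ?_⟩
    rw [h.2.1.mem_iff]
    exact List.mem_map_of_mem he

theorem slide_up {F : Finset α} {I : Set β} (m : α → β) (hm : StrictMonoOn m F) (hmI : MapsTo m F I)
    (P : (α → β) → Prop)
    (hP : ∀ w x c, P w → StrictMonoOn w F → StrictMonoOn (Function.update w x c) F → MapsTo w F I →
      MapsTo (Function.update w x c) F I → x ∈ F → w x < c → P (Function.update w x c)) :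
    ∀ (n : ℕ) (u : α → β), (F.filter (fun x => u x ≠ m x)).card = n → P u → StrictMonoOn u F →
      MapsTo u F I → (∀ x ∈ F, u x ≤ m x) → ∃ w, EqOn w m F ∧ P w := by
  intro n
  induction n with
  | zero =>
    intro u hn hu _ _ _
    rw [Finset.card_eq_zero, Finset.filter_eq_empty_iff] at hn
    exact ⟨u, fun x hx => not_not.1 (hn hx), hu⟩
  | succ n ih =>
    intro u hn hu hmo hI hle
    have hne : (F.filter (fun x => u x ≠ m x)).Nonempty := by
      rw [← Finset.card_pos]; omega
    obtain ⟨x, hx, hmax⟩ := Finset.exists_max_image _ id hne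
    simp only [Finset.mem_filter, id] at hx hmax
    have hlt : u x < m x := lt_of_le_of_ne (hle x hx.1) hx.2
    have k1 : StrictMonoOn (Function.update u x (m x)) F := by
      intro a ha b hb hab
      by_cases e1 : a = x
      · subst e1
        rw [Function.update_self, Function.update_of_ne hab.ne']
        have : u b = m b := by
          by_contra hc
          exact absurd (hmax b ⟨hb, hc⟩) (not_le.2 hab)
        rw [this]
        exact hm ha hb hab
      · rw [Function.update_of_ne e1]
        by_cases e2 : b = x
        · subst e2
          rw [Function.update_self]
          exact (hmo ha hb hab).trans hlt
        · rw [Function.update_of_ne e2]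
          exact hmo ha hb hab
    have k2 : MapsTo (Function.update u x (m x)) F I := by
      intro a ha
      by_cases e1 : a = x
      · subst e1; rw [Function.update_self]; exact hmI ha
      · rw [Function.update_of_ne e1]; exact hI ha
    refine ih _ ?_ (hP u x (m x) hu hmo k1 hI k2 hx.1 hlt) k1 k2 ?_
    · have : F.filter (fun y => Function.update u x (m x) y ≠ m y) =
          (F.filter (fun y => u y ≠ m y)).erase x := by
        ext y
        simp only [Finset.mem_filter, Finset.mem_erase]
        by_cases e : y = x
        · subst e; simp
        · simp [Function.update_of_ne e, e]
      rw [this, Finset.card_erase_of_mem (by simpa using hx), hn]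
      rfl
    · intro y hy
      by_cases e : y = x
      · subst e; simp
      · rw [Function.update_of_ne e]; exact hle y hy

theorem slide_elem {I : Set β} {B : ℕ} {σ : List (α × α)} (hv : Valid σ) (hB : σ.length ≤ B)
    {w : α → β} {x : α} {c : β} {F : Finset α} (hF : HIn (F : Set α) σ) (h1 : StrictMonoOn w F)
    (h2 : StrictMonoOn (Function.update w x c) F) (h3 : MapsTo w F I)
    (h4 : MapsTo (Function.update w x c) F I) (hx : x ∈ fsts σ) (hc : w x < c) :
    CH I B (mapL w σ) (mapL (Function.update w x c) σ) := by
  set w' := Function.update w x c with hw'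
  have HI : ∀ {f : α → β} {τ : List (α × α)}, MapsTo f F I → HIn (F : Set α) τ → HIn I (mapL f τ) := by
    intro f τ hf hτ e he
    simp only [mapL, List.mem_map] at he
    obtain ⟨g, hg, rfl⟩ := he
    exact ⟨hf (hτ g hg).1, hf (hτ g hg).2⟩
  have len : ∀ (f : α → β) (τ : List (α × α)), (mapL f τ).length = τ.length := by
    intro f τ; simp [mapL]
  -- decompose
  obtain ⟨⟨x', b⟩, he, hxx⟩ := List.mem_map.1 hx
  simp only at hxx
  subst hxx
  obtain ⟨p, q, rfl⟩ := List.append_of_mem he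
  have hv2 : Valid ((x', b) :: (q ++ p)) := hv.perm (by
    have := List.perm_append_comm (l₁ := p) (l₂ := (x', b) :: q)
    simpa using this)
  have hx2 : x' ∈ snds ((x', b) :: (q ++ p)) := by
    rw [← hv2.2.1.mem_iff]; simp [fsts]
  obtain ⟨⟨a, x''⟩, he2, hxx⟩ := List.mem_map.1 hx2
  simp only at hxx
  subst hxx
  have hbx : x'' ≠ b := hv2.2.2 (x'', b) (by simp)
  have he3 : (a, x'') ∈ q ++ p := by
    rcases List.mem_cons.1 he2 with h | h
    · exact absurd (congrArg Prod.snd h) hbx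
    · exact h
  obtain ⟨u, v, huv⟩ := List.append_of_mem he3
  rw [huv] at hv2
  have R1 : ∀ (f : α → β), StrictMonoOn f F → MapsTo f F I →
      CH I B (mapL f (p ++ (x'', b) :: q)) (mapL f ((x'', b) :: (u ++ (a, x'') :: v))) := by
    intro f hf hfI
    have := CH.rot (I := I) (B := B) (mapL f p) (q := mapL f ((x'', b) :: q))
      (by have := hv.map hf hF; simpa [mapL] using this)
      (by have := HI hfI hF; simpa [mapL] using this)
      (by have := len f (p ++ (x'', b) :: q); simp [mapL] at this ⊢; simp at hB; omega)
    rw [← huv]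
    simpa [mapL] using this
  refine (R1 w h1 h3).trans (CH.trans ?_ (R1 w' h2 h4).symm)
  have hF2 : HIn (F : Set α) ((x'', b) :: (u ++ (a, x'') :: v)) := by
    rw [← huv]
    intro e he
    refine hF e ?_
    simp only [List.mem_append, List.mem_cons] at he ⊢
    tauto
  have len2 : ((x'', b) :: (u ++ (a, x'') :: v)).length ≤ B := by
    rw [← huv]; simp at hB ⊢; omega
  have hxF : x'' ∈ F := by simpa using (hF (x'', b) (by simp)).1
  -- other heights
  have nfst : ∀ e ∈ u ++ (a, x'') :: v, e.1 ≠ x'' := by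
    intro e he hh
    have := hv2.1
    simp only [fsts, List.map_cons, List.nodup_cons] at this
    exact this.1 (List.mem_map.2 ⟨e, he, hh⟩)
  have nsnd : ∀ e ∈ u ++ v, e.2 ≠ x'' := by
    intro e he hh
    have h5 : (snds ((x'', b) :: (u ++ (a, x'') :: v))).Nodup := hv2.2.1.nodup_iff.1 hv2.1
    have h6 : (snds ((a, x'') :: (x'', b) :: (u ++ v))).Nodup := by
      refine (List.Perm.nodup_iff ?_).1 h5
      refine List.Perm.map _ ?_
      refine List.Perm.trans (List.Perm.cons _ List.perm_middle) (List.Perm.swap _ _ _)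
    simp only [snds, List.map_cons, List.nodup_cons, List.mem_cons] at h6
    exact h6.1 (.inr (List.mem_map.2 ⟨e, he, hh⟩))
  have out : ∀ y, y ∈ (F : Set α) → y ≠ x'' → ¬ InClosed (w x'') c (w y) := by
    intro y hy hne hh
    have hxF' : x'' ∈ (F : Set α) := by simpa using hxF
    have a1 : y < x'' → w y < w x'' := fun h => h1 hy hxF' h
    have a2 : x'' < y → c < w y := fun h => by
      have := h2 hxF' hy h
      rwa [hw', Function.update_self, Function.update_of_ne hne] at this
    unfold InClosed InOpen at hh
    rcases lt_or_gt_of_ne hne with h | h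
    · have := a1 h
      grind
    · have := a2 h
      grind
  have upd : ∀ y, y ≠ x'' → w' y = w y := fun y hy => Function.update_of_ne hy _ _
  have updx : w' x'' = c := Function.update_self _ _ _
  have mu : mapL w' u = mapL w u := by
    refine List.map_congr_left ?_
    intro e he
    have e1 := nfst e (by simp [he])
    have e2 := nsnd e (by simp [he])
    simp [Prod.map, upd _ e1, upd _ e2]
  have mv : mapL w' v = mapL w v := by
    refine List.map_congr_left ?_
    intro e he
    have e1 := nfst e (by simp [he])
    have e2 := nsnd e (by simp [he])
    simp [Prod.map, upd _ e1, upd _ e2]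
  have hax : a ≠ x'' := nfst (a, x'') (by simp)
  refine Relation.ReflTransGen.single ⟨⟨hv2.map h1 hF2, hv2.map h2 hF2, .inl ?_⟩,
    ⟨by rw [len]; exact len2, HI h3 hF2⟩, by rw [len]; exact len2, HI h4 hF2⟩
  have e1 : mapL w ((x'', b) :: (u ++ (a, x'') :: v)) =
      (w x'', w b) :: (mapL w u ++ (w a, w x'') :: mapL w v) := by simp [mapL]
  have e2 : mapL w' ((x'', b) :: (u ++ (a, x'') :: v)) =
      (c, w b) :: (mapL w u ++ (w a, c) :: mapL w v) := by
    rw [← mu, ← mv, ← upd a hax, ← upd b hbx.symm]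
    simp [mapL, updx]
  rw [e1, e2]
  refine Step0.bigex _ _ _ _ _ _ ?_ ?_ ?_
  · intro e he
    simp only [mapL, List.mem_map] at he
    obtain ⟨g, hg, rfl⟩ := he
    have hgF := hF2 g (by simp [hg])
    exact ⟨out _ hgF.1 (nfst g (by simp [hg])), out _ hgF.2 (nsnd g (by simp [hg]))⟩
  · exact out a (hF2 (a, x'') (by simp)).1 hax
  · exact out b (hF2 (x'', b) (by simp)).2 hbx.symm

theorem slide_half {I : Set β} {B : ℕ} {σ : List (α × α)} (hv : Valid σ) (hB : σ.length ≤ B)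
    {u m : α → β} (h1 : StrictMonoOn u {x | x ∈ fsts σ}) (h2 : StrictMonoOn m {x | x ∈ fsts σ})
    (h3 : MapsTo u {x | x ∈ fsts σ} I) (h4 : MapsTo m {x | x ∈ fsts σ} I)
    (hle : ∀ x ∈ fsts σ, u x ≤ m x) : CH I B (mapL u σ) (mapL m σ) := by
  classical
  let F : Finset α := (fsts σ).toFinset
  have hFc : (F : Set α) = {x | x ∈ fsts σ} := by ext; simp [F]
  have hF : HIn (F : Set α) σ := by
    rw [HIn.fsts hv, hFc]; exact fun x hx => hx
  rw [← hFc] at h1 h2 h3 h4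
  obtain ⟨w, hw, hP⟩ := slide_up (F := F) (I := I) m h2 h4
    (fun w => CH I B (mapL u σ) (mapL w σ))
    (fun w x c hw k1 k2 k3 k4 hx hc => hw.trans
      (slide_elem hv hB hF k1 k2 k3 k4 (by simpa [F] using hx) hc)) _ u rfl .refl h1 h3
    (fun x hx => hle x (by simpa [F] using hx))
  have : mapL w σ = mapL m σ := by
    refine List.map_congr_left ?_
    intro e he
    simp [Prod.map, hw (hF e he).1, hw (hF e he).2]
  rwa [this] at hP

/-- Order-equivalent images are connected. -/
theorem slide {I : Set β} {B : ℕ} {σ : List (α × α)} (hv : Valid σ) (hB : σ.length ≤ B)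
    {u m : α → β} (h1 : StrictMonoOn u {x | x ∈ fsts σ}) (h2 : StrictMonoOn m {x | x ∈ fsts σ})
    (h3 : MapsTo u {x | x ∈ fsts σ} I) (h4 : MapsTo m {x | x ∈ fsts σ} I) :
    CH I B (mapL u σ) (mapL m σ) := by
  have k1 : StrictMonoOn (fun x => max (u x) (m x)) {x | x ∈ fsts σ} := by
    intro a ha b hb hab
    exact max_lt_max (h1 ha hb hab) (h2 ha hb hab)
  have k2 : MapsTo (fun x => max (u x) (m x)) {x | x ∈ fsts σ} I := by
    intro a ha
    rcases max_choice (u a) (m a) with h | h <;> simp only [h]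
    · exact h3 ha
    · exact h4 ha
  exact (slide_half hv hB h1 k1 h3 k2 (fun x _ => le_max_left _ _)).trans
    (slide_half hv hB h2 k1 h4 k2 (fun x _ => le_max_right _ _)).symm

/-- Discretisation of bounded chains. -/
theorem discretize {B N : ℕ} (hN : 2 * B ≤ N) {σ τ : List (α × α)} (h : BR B σ τ) (hvσ : Valid σ)
    (hσ : σ.length ≤ B) {f : α → ℕ} (hf : StrictMonoOn f {x | x ∈ fsts σ})
    (hfI : MapsTo f {x | x ∈ fsts σ} (Iio N)) :
    ∀ {f' : α → ℕ}, StrictMonoOn f' {x | x ∈ fsts τ} → MapsTo f' {x | x ∈ fsts τ} (Iio N) →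
      CH (Iio N) B (mapL f σ) (mapL f' τ) := by
  classical
  induction h with
  | refl => exact fun h1 h2 => slide hvσ hσ hf h1 hfI h2
  | @tail ρ τ _ hs ih =>
    intro f' h1 h2
    obtain ⟨hs, hB1, hB2⟩ := hs
    let F : Finset α := (fsts ρ ++ fsts τ).toFinset
    let g : α → ℕ := fun x => (F.filter (fun y => y < x)).card
    have hFc : (F : Set α) = {x | x ∈ fsts ρ ∨ x ∈ fsts τ} := by ext; simp [F]
    have hg : StrictMonoOn g (F : Set α) := by
      intro a ha b hb hab
      refine Finset.card_lt_card ?_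
      rw [Finset.ssubset_iff_of_subset]
      · exact ⟨a, by simpa using ⟨by simpa using ha, hab⟩, by simp⟩
      · intro y hy
        simp only [Finset.mem_filter] at hy ⊢
        exact ⟨hy.1, hy.2.trans hab⟩
    have hgI : MapsTo g (F : Set α) (Iio N) := by
      intro a ha
      have h1 : g a < F.card := by
        refine Finset.card_lt_card ?_
        rw [Finset.ssubset_iff_of_subset (Finset.filter_subset _ _)]
        exact ⟨a, by simpa using ha, by simp⟩
      have h2 : F.card ≤ 2 * B := by
        refine (List.toFinset_card_le _).trans ?_
        simp [fsts]
        omega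
      exact lt_of_lt_of_le h1 (h2.trans hN)
    have s1 : {x | x ∈ fsts ρ} ⊆ (F : Set α) := by rw [hFc]; exact fun x hx => .inl hx
    have s2 : {x | x ∈ fsts τ} ⊆ (F : Set α) := by rw [hFc]; exact fun x hx => .inr hx
    have i1 : HIn (F : Set α) ρ := by rw [HIn.fsts hs.1]; exact fun x hx => s1 hx
    have i2 : HIn (F : Set α) τ := by rw [HIn.fsts hs.2.1]; exact fun x hx => s2 hx
    have HI : ∀ {τ : List (α × α)}, HIn (F : Set α) τ → HIn (Iio N) (mapL g τ) := by
      intro τ hτ e he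
      simp only [mapL, List.mem_map] at he
      obtain ⟨k, hk, rfl⟩ := he
      exact ⟨hgI (hτ k hk).1, hgI (hτ k hk).2⟩
    refine (ih (hg.mono s1) (hgI.mono_left s1)).trans (CH.trans ?_
      (slide hs.2.1 hB2 (hg.mono s2) h1 (hgI.mono_left s2) h2))
    exact Relation.ReflTransGen.single ⟨hs.map hg i1 i2, ⟨by simpa [mapL] using hB1, HI i1⟩,
      by simpa [mapL] using hB2, HI i2⟩

end M
end RD

namespace RD
section Q

/-- positive vertices of a movie -/
def mP (l : List (ℝ × (ℝ × ℝ))) (t a : ℝ) : Prop := ∃ b, (t, (a, b)) ∈ l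
/-- negative vertices of a movie -/
def mN (l : List (ℝ × (ℝ × ℝ))) (t b : ℝ) : Prop := ∃ a, (t, (a, b)) ∈ l
/-- vertices of a movie -/
def mV (l : List (ℝ × (ℝ × ℝ))) (t y : ℝ) : Prop := mP l t y ∨ mN l t y

variable {R R' : RectDiagram} {l l' : List (ℝ × (ℝ × ℝ))}

theorem rep_pos (h : RepB 0 R l) {t a : 𝕊} : (t, a) ∈ R.pos ↔ mP l (toIco t) (toIco a) := by
  rw [h.pos_iff, sub_zero]; rfl

theorem rep_neg (h : RepB 0 R l) {t a : 𝕊} : (t, a) ∈ R.neg ↔ mN l (toIco t) (toIco a) := by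
  rw [h.neg_iff, sub_zero]; rfl

theorem rep_verts (h : RepB 0 R l) {t a : 𝕊} : (t, a) ∈ R.verts ↔ mV l (toIco t) (toIco a) := by
  rw [mem_verts, rep_pos h, rep_neg h]; rfl

/-- Elementary moves of movies. -/
def EMr (l l' : List (ℝ × (ℝ × ℝ))) (t1 t2 y1 y2 : ℝ) : Prop :=
  t1 ≠ t2 ∧ y1 ≠ y2 ∧
  (mV l' t1 y1 ↔ ¬ mV l t1 y1) ∧ (mV l' t2 y1 ↔ ¬ mV l t2 y1) ∧
  (mV l' t2 y2 ↔ ¬ mV l t2 y2) ∧ (mV l' t1 y2 ↔ ¬ mV l t1 y2) ∧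
  (∀ t y, ¬ ((t = t1 ∨ t = t2) ∧ (y = y1 ∨ y = y2)) →
    ((mP l t y ↔ mP l' t y) ∧ (mN l t y ↔ mN l' t y) ∧
      (mV l t y → ¬ (InClosed t1 t2 t ∧ InClosed y1 y2 y)))) ∧
  Consec (mV l t1 y1) (mV l t2 y1) (mV l t2 y2) (mV l t1 y2)

theorem EMr.em (h : RepB 0 R l) (h' : RepB 0 R' l') {t1 t2 y1 y2 : ℝ} (ht1 : t1 ∈ Ico (0:ℝ) 1)
    (ht2 : t2 ∈ Ico (0:ℝ) 1) (hy1 : y1 ∈ Ico (0:ℝ) 1) (hy2 : y2 ∈ Ico (0:ℝ) 1)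
    (k : EMr l l' t1 t2 y1 y2) : EM R R' (t1 : 𝕊) (t2 : 𝕊) (y1 : 𝕊) (y2 : 𝕊) := by
  obtain ⟨k1, k2, k3, k4, k5, k6, k7, k8⟩ := k
  unfold EM
  simp only [rep_verts h, rep_verts h', rep_pos h, rep_pos h', rep_neg h, rep_neg h', toIco_coe ht1,
    toIco_coe ht2, toIco_coe hy1, toIco_coe hy2, mem_arc]
  refine ⟨by rwa [Ne, coe_inj ht1 ht2], by rwa [Ne, coe_inj hy1 hy2], k3, k4, k5, k6, ?_, k8⟩
  intro t y hh
  refine k7 _ _ ?_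
  intro hc
  apply hh
  have q : ∀ {t : 𝕊} {s : ℝ}, s ∈ Ico (0:ℝ) 1 → (toIco t = s → t = (s : 𝕊)) := by
    intro t s hs h; rw [← h, coe_toIco]
  exact ⟨hc.1.imp (q ht1) (q ht2), hc.2.imp (q hy1) (q hy2)⟩

theorem exch_of (h : RepB 0 R l) (h' : RepB 0 R' l') {t1 t2 y1 y2 : ℝ} (ht1 : t1 ∈ Ico (0:ℝ) 1)
    (ht2 : t2 ∈ Ico (0:ℝ) 1) (hy1 : y1 ∈ Ico (0:ℝ) 1) (hy2 : y2 ∈ Ico (0:ℝ) 1)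
    (k : EMr l l' t1 t2 y1 y2)
    (hc : (mV l t1 y1 ∧ mV l t1 y2 ∧ ¬ mV l t2 y1 ∧ ¬ mV l t2 y2) ∨
      (¬ mV l t1 y1 ∧ ¬ mV l t1 y2 ∧ mV l t2 y1 ∧ mV l t2 y2) ∨
      (mV l t1 y1 ∧ ¬ mV l t1 y2 ∧ mV l t2 y1 ∧ ¬ mV l t2 y2) ∨
      (¬ mV l t1 y1 ∧ mV l t1 y2 ∧ ¬ mV l t2 y1 ∧ mV l t2 y2)) : ExchangeMove R R' := by
  rw [exch_iff]
  refine ⟨t1, t2, y1, y2, k.em h h' ht1 ht2 hy1 hy2, ?_⟩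
  simp only [rep_verts h, toIco_coe ht1,
    toIco_coe ht2, toIco_coe hy1, toIco_coe hy2]
  exact hc

/-- Moving a vertical edge. -/
theorem vmove (h : RepB 0 R l) (h' : RepB 0 R' l') {t t' a b : ℝ} {O : ℝ × (ℝ × ℝ) → Prop}
    (hl : ∀ e, e ∈ l ↔ e = (t, (a, b)) ∨ O e) (hl' : ∀ e, e ∈ l' ↔ e = (t', (a, b)) ∨ O e)
    (htt : t ≠ t') (hab : a ≠ b) (hO : ∀ e, O e → e.1 ≠ t ∧ e.1 ≠ t') {t1 t2 y1 y2 : ℝ}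
    (ht : (t1 = t ∧ t2 = t') ∨ (t1 = t' ∧ t2 = t)) (hy : (y1 = a ∧ y2 = b) ∨ (y1 = b ∧ y2 = a))
    (hav : ∀ e, O e → InClosed t1 t2 e.1 → ¬ InClosed y1 y2 e.2.1 ∧ ¬ InClosed y1 y2 e.2.2) :
    ExchangeMove R R' := by
  have b1 := h.bds ((hl _).2 (.inl rfl))
  have b2 := h'.bds ((hl' _).2 (.inl rfl))
  have P : ∀ s y, mP l s y ↔ (s = t ∧ y = a) ∨ (∃ c, O (s, (y, c))) := by
    intro s y; unfold mP; simp only [hl, Prod.mk.injEq]; grind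
  have N : ∀ s y, mN l s y ↔ (s = t ∧ y = b) ∨ (∃ c, O (s, (c, y))) := by
    intro s y; unfold mN; simp only [hl, Prod.mk.injEq]; grind
  have P' : ∀ s y, mP l' s y ↔ (s = t' ∧ y = a) ∨ (∃ c, O (s, (y, c))) := by
    intro s y; unfold mP; simp only [hl', Prod.mk.injEq]; grind
  have N' : ∀ s y, mN l' s y ↔ (s = t' ∧ y = b) ∨ (∃ c, O (s, (c, y))) := by
    intro s y; unfold mN; simp only [hl', Prod.mk.injEq]; grind
  have O1 : ∀ y c, ¬ O (t, (y, c)) := fun y c hh => (hO _ hh).1 rfl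
  have O2 : ∀ y c, ¬ O (t', (y, c)) := fun y c hh => (hO _ hh).2 rfl
  have em : EMr l l' t1 t2 y1 y2 := by
    unfold EMr mV Consec
    simp only [P, N, P', N']
    refine ⟨by grind, by grind, by grind, by grind, by grind, by grind, ?_, by grind⟩
    intro s y hh
    refine ⟨by grind, by grind, ?_⟩
    rintro ((⟨rfl, rfl⟩ | ⟨c, hc⟩) | (⟨rfl, rfl⟩ | ⟨c, hc⟩)) ⟨q1, q2⟩
    · grind
    · exact (hav _ hc q1).1 q2
    · grind
    · exact (hav _ hc q1).2 q2
  refine exch_of h h' (by grind) (by grind) (by grind) (by grind) em ?_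
  have q1 : ∀ y, y = a ∨ y = b → mV l t y := by
    intro y hy; unfold mV; simp only [P, N]; grind
  have q2 : ∀ y, ¬ mV l t' y := by
    intro y; unfold mV; simp only [P, N]; grind
  rcases ht with ⟨rfl, rfl⟩ | ⟨rfl, rfl⟩
  · exact .inl ⟨q1 _ (by grind), q1 _ (by grind), q2 _, q2 _⟩
  · exact .inr (.inl ⟨q2 _, q2 _, q1 _ (by grind), q1 _ (by grind)⟩)

/-- Moving a horizontal edge. -/
theorem hmove (h : RepB 0 R l) (h' : RepB 0 R' l') {t s g g' a b : ℝ} {O : ℝ × (ℝ × ℝ) → Prop}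
    (hl : ∀ e, e ∈ l ↔ e = (t, (g, b)) ∨ e = (s, (a, g)) ∨ O e)
    (hl' : ∀ e, e ∈ l' ↔ e = (t, (g', b)) ∨ e = (s, (a, g')) ∨ O e)
    (hts : t ≠ s) (hgg : g ≠ g') (hO : ∀ e, O e → e.1 ≠ t ∧ e.1 ≠ s)
    (ha : ¬ InClosed g g' a) (hb : ¬ InClosed g g' b)
    (hav : ∀ e, O e → InClosed t s e.1 → ¬ InClosed g g' e.2.1 ∧ ¬ InClosed g g' e.2.2) :
    ExchangeMove R R' := by
  have b1 := h.bds ((hl _).2 (.inl rfl))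
  have b2 := h.bds ((hl _).2 (.inr (.inl rfl)))
  have b3 := h'.bds ((hl' _).2 (.inl rfl))
  have P : ∀ u y, mP l u y ↔ (u = t ∧ y = g) ∨ (u = s ∧ y = a) ∨ (∃ c, O (u, (y, c))) := by
    intro s y; unfold mP; simp only [hl, Prod.mk.injEq]; grind
  have N : ∀ u y, mN l u y ↔ (u = t ∧ y = b) ∨ (u = s ∧ y = g) ∨ (∃ c, O (u, (c, y))) := by
    intro s y; unfold mN; simp only [hl, Prod.mk.injEq]; grind
  have P' : ∀ u y, mP l' u y ↔ (u = t ∧ y = g') ∨ (u = s ∧ y = a) ∨ (∃ c, O (u, (y, c))) := by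
    intro s y; unfold mP; simp only [hl', Prod.mk.injEq]; grind
  have N' : ∀ u y, mN l' u y ↔ (u = t ∧ y = b) ∨ (u = s ∧ y = g') ∨ (∃ c, O (u, (c, y))) := by
    intro s y; unfold mN; simp only [hl', Prod.mk.injEq]; grind
  have O1 : ∀ y c, ¬ O (t, (y, c)) := fun y c hh => (hO _ hh).1 rfl
  have O2 : ∀ y c, ¬ O (s, (y, c)) := fun y c hh => (hO _ hh).2 rfl
  have na : a ≠ g ∧ a ≠ g' := by unfold InClosed at ha; grind
  have nb : b ≠ g ∧ b ≠ g' := by unfold InClosed at hb; grind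
  have em : EMr l l' t s g g' := by
    unfold EMr mV Consec
    simp only [P, N, P', N']
    refine ⟨by grind, by grind, by grind, by grind, by grind, by grind, ?_, by grind⟩
    intro u y hh
    refine ⟨by grind, by grind, ?_⟩
    rintro ((⟨rfl, rfl⟩ | ⟨rfl, rfl⟩ | ⟨c, hc⟩) | (⟨rfl, rfl⟩ | ⟨rfl, rfl⟩ | ⟨c, hc⟩)) ⟨q1, q2⟩
    · grind
    · grind
    · exact (hav _ hc q1).1 q2
    · grind
    · grind
    · exact (hav _ hc q1).2 q2
  refine exch_of h h' (by grind) (by grind) (by grind) (by grind) em ?_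
  unfold mV
  simp only [P, N]
  grind

/-- Splitting an edge. -/
theorem smove (h : RepB 0 R l) (h' : RepB 0 R' l') {t s a m b : ℝ} {O : ℝ × (ℝ × ℝ) → Prop}
    (hl : ∀ e, e ∈ l ↔ e = (t, (a, b)) ∨ O e)
    (hl' : ∀ e, e ∈ l' ↔ e = (t, (a, m)) ∨ e = (s, (m, b)) ∨ O e)
    (hts : t ≠ s) (hm : InOpen a b m) (hO : ∀ e, O e → ¬ InClosed t s e.1) :
    StabOfType R R' .rII := by
  have b1 := h.bds ((hl _).2 (.inl rfl))
  have b2 := h'.bds ((hl' _).2 (.inl rfl))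
  have b3 := h'.bds ((hl' _).2 (.inr (.inl rfl)))
  have P : ∀ u y, mP l u y ↔ (u = t ∧ y = a) ∨ (∃ c, O (u, (y, c))) := by
    intro s y; unfold mP; simp only [hl, Prod.mk.injEq]; grind
  have N : ∀ u y, mN l u y ↔ (u = t ∧ y = b) ∨ (∃ c, O (u, (c, y))) := by
    intro s y; unfold mN; simp only [hl, Prod.mk.injEq]; grind
  have P' : ∀ u y, mP l' u y ↔ (u = t ∧ y = a) ∨ (u = s ∧ y = m) ∨ (∃ c, O (u, (y, c))) := by
    intro s y; unfold mP; simp only [hl', Prod.mk.injEq]; grind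
  have N' : ∀ u y, mN l' u y ↔ (u = t ∧ y = m) ∨ (u = s ∧ y = b) ∨ (∃ c, O (u, (c, y))) := by
    intro s y; unfold mN; simp only [hl', Prod.mk.injEq]; grind
  have O1 : ∀ y c, ¬ O (t, (y, c)) := fun y c hh => hO _ hh (.inr (.inl rfl))
  have O2 : ∀ y c, ¬ O (s, (y, c)) := fun y c hh => hO _ hh (.inr (.inr rfl))
  obtain ⟨n1, n2, n3⟩ := hm.ne
  have na : ¬ InClosed m b a := by
    unfold InClosed; unfold InOpen at *; grind
  have em : EMr l l' t s m b := by
    unfold EMr mV Consec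
    simp only [P, N, P', N']
    refine ⟨by grind, by grind, by grind, by grind, by grind, by grind, ?_, by grind⟩
    intro u y hh
    refine ⟨by grind, by grind, ?_⟩
    rintro ((⟨rfl, rfl⟩ | ⟨c, hc⟩) | (⟨rfl, rfl⟩ | ⟨c, hc⟩)) ⟨q1, q2⟩
    · grind
    · exact hO _ hc q1
    · grind
    · exact hO _ hc q1
  have EE := em.em h h' b1.1 b3.1 b3.2.1 b1.2.2
  have v1 : ((t : 𝕊), (m : 𝕊)) ∉ R.verts := by
    rw [rep_verts h, toIco_coe b1.1, toIco_coe b3.2.1]; unfold mV; simp only [P, N]; grind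
  have v2 : ((s : 𝕊), (m : 𝕊)) ∉ R.verts := by
    rw [rep_verts h, toIco_coe b3.1, toIco_coe b3.2.1]; unfold mV; simp only [P, N]; grind
  have v3 : ((s : 𝕊), (b : 𝕊)) ∉ R.verts := by
    rw [rep_verts h, toIco_coe b3.1, toIco_coe b3.2.2]; unfold mV; simp only [P, N]; grind
  have v4 : ((t : 𝕊), (b : 𝕊)) ∈ R.verts := by
    rw [rep_verts h, toIco_coe b1.1, toIco_coe b3.2.2]; unfold mV; simp only [P, N]; grind
  refine ⟨t, s, m, b, elem_iff.2 EE, ?_, ?_⟩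
  · obtain ⟨k, k1, k2⟩ := EE.card
    rw [k1, k2]
    simp [v1, v2, v3, v4]
  · refine ⟨((t : 𝕊), (b : 𝕊)), ⟨by simpa using v4, mem_arc_left _ _, mem_arc_right _ _⟩, m,
      by simp, ?_, ?_, .inl rfl, ?_⟩
    · rw [rep_verts h', toIco_coe b1.1, toIco_coe b3.2.1]; unfold mV; simp only [P', N']; grind
    · rw [rep_verts h', toIco_coe b3.1, toIco_coe b3.2.1]; unfold mV; simp only [P', N']; grind
    · rw [rep_pos h', toIco_coe b3.1, toIco_coe b3.2.1]; simp only [P']; grind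

end Q
end RD

namespace RD
section Q
variable {R R' : RectDiagram} {l l' : List (ℝ × (ℝ × ℝ))}

/-- Movies of diagrams. -/
def Mv (l : List (ℝ × (ℝ × ℝ))) : Prop :=
  l.Pairwise (fun e f => e.1 < f.1) ∧
    (∀ e ∈ l, e.1 ∈ Ico (0:ℝ) 1 ∧ e.2.1 ∈ Ico (0:ℝ) 1 ∧ e.2.2 ∈ Ico (0:ℝ) 1) ∧ Valid (hts l) ∧ l ≠ []

theorem RepB.mv (h : RepB 0 R l) : Mv l := ⟨h.1, fun _ he => h.bds he, h.valid, h.ne_nil⟩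

theorem pw_inj (h : l.Pairwise (fun e f => e.1 < f.1)) {e f : ℝ × (ℝ × ℝ)} (he : e ∈ l) (hf : f ∈ l)
    (hh : e.1 = f.1) : e = f := by
  obtain ⟨i, hi, rfl⟩ := List.getElem_of_mem he
  obtain ⟨j, hj, rfl⟩ := List.getElem_of_mem hf
  have k := List.pairwise_iff_getElem.1 h
  rcases lt_trichotomy i j with q | q | q
  · exact absurd hh (k i j hi hj q).ne
  · subst q; rfl
  · exact absurd hh (k j i hj hi q).ne'

theorem ofMv (h : Mv l) : ∃ R, RepB 0 R l := by
  classical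
  obtain ⟨h1, h2, h3, h4⟩ := h
  have inj : ∀ e ∈ l, ∀ f ∈ l, (e.1 : 𝕊) = (f.1 : 𝕊) → e = f := fun e he f hf hh =>
    pw_inj h1 he hf ((coe_inj (h2 e he).1 (h2 f hf).1).1 hh)
  have inja : ∀ e ∈ l, ∀ f ∈ l, (e.2.1 : 𝕊) = (f.2.1 : 𝕊) → e = f := by
    intro e he f hf hh
    have := (coe_inj (h2 e he).2.1 (h2 f hf).2.1).1 hh
    have n : (l.map (fun e => e.2.1)).Nodup := by
      have := h3.1; simpa [fsts, hts, Function.comp_def] using this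
    exact List.inj_on_of_nodup_map n he hf this
  have injb : ∀ e ∈ l, ∀ f ∈ l, (e.2.2 : 𝕊) = (f.2.2 : 𝕊) → e = f := by
    intro e he f hf hh
    have := (coe_inj (h2 e he).2.2 (h2 f hf).2.2).1 hh
    have n : (l.map (fun e => e.2.2)).Nodup := by
      have := h3.2.1.nodup_iff.1 h3.1; simpa [snds, hts, Function.comp_def] using this
    exact List.inj_on_of_nodup_map n he hf this
  have hp : (l.map (fun e => e.2.1)).Perm (l.map (fun e => e.2.2)) := by
    have := h3.2.1; simpa [fsts, snds, hts, Function.comp_def] using this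
  have hne : ∀ e ∈ l, e.2.1 ≠ e.2.2 := fun e he => h3.2.2 e.2 (List.mem_map_of_mem he)
  let p : Finset Torus := (l.map (fun e => ((e.1 : 𝕊), (e.2.1 : 𝕊)))).toFinset
  let n : Finset Torus := (l.map (fun e => ((e.1 : 𝕊), (e.2.2 : 𝕊)))).toFinset
  have mp : ∀ v : Torus, v ∈ p ↔ ∃ e ∈ l, ((e.1 : 𝕊), (e.2.1 : 𝕊)) = v := by intro v; simp [p]
  have mn : ∀ v : Torus, v ∈ n ↔ ∃ e ∈ l, ((e.1 : 𝕊), (e.2.2 : 𝕊)) = v := by intro v; simp [n]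
  refine ⟨⟨p, n, ?_, ?_, ?_, ?_, ?_, ?_, ?_, ?_⟩, h1, ?_⟩
  · rw [Finset.disjoint_left]
    intro v hv hv'
    rw [mp] at hv
    rw [mn] at hv'
    obtain ⟨e, he, rfl⟩ := hv
    obtain ⟨f, hf, hh⟩ := hv'
    have := inj f hf e he (congrArg Prod.fst hh)
    subst this
    have h5 := (coe_inj (h2 f hf).2.2 (h2 f hf).2.1).1 (congrArg Prod.snd hh)
    exact hne f hf h5.symm
  · obtain ⟨e, he⟩ := List.exists_mem_of_ne_nil l h4
    exact ⟨_, Finset.mem_union_left _ ((mp _).2 ⟨e, he, rfl⟩)⟩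
  · ext x
    simp only [Finset.mem_image, mp, mn]
    constructor
    · rintro ⟨_, ⟨e, he, rfl⟩, rfl⟩; exact ⟨_, ⟨e, he, rfl⟩, rfl⟩
    · rintro ⟨_, ⟨e, he, rfl⟩, rfl⟩; exact ⟨_, ⟨e, he, rfl⟩, rfl⟩
  · ext x
    simp only [Finset.mem_image, mp, mn]
    constructor
    · rintro ⟨_, ⟨e, he, rfl⟩, rfl⟩
      have : e.2.1 ∈ l.map (fun e => e.2.2) := hp.mem_iff.1 (List.mem_map.2 ⟨e, he, rfl⟩)
      obtain ⟨f, hf, hh⟩ := List.mem_map.1 this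
      exact ⟨_, ⟨f, hf, rfl⟩, by simp [hh]⟩
    · rintro ⟨_, ⟨e, he, rfl⟩, rfl⟩
      have : e.2.2 ∈ l.map (fun e => e.2.1) := hp.mem_iff.2 (List.mem_map.2 ⟨e, he, rfl⟩)
      obtain ⟨f, hf, hh⟩ := List.mem_map.1 this
      exact ⟨_, ⟨f, hf, rfl⟩, by simp [hh]⟩
  · intro v hv w hw hh
    obtain ⟨e, he, rfl⟩ := (mp _).1 hv
    obtain ⟨f, hf, rfl⟩ := (mp _).1 hw
    rw [inj e he f hf hh]
  · intro v hv w hw hh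
    obtain ⟨e, he, rfl⟩ := (mn _).1 hv
    obtain ⟨f, hf, rfl⟩ := (mn _).1 hw
    rw [inj e he f hf hh]
  · intro v hv w hw hh
    obtain ⟨e, he, rfl⟩ := (mp _).1 hv
    obtain ⟨f, hf, rfl⟩ := (mp _).1 hw
    rw [inja e he f hf hh]
  · intro v hv w hw hh
    obtain ⟨e, he, rfl⟩ := (mn _).1 hv
    obtain ⟨f, hf, rfl⟩ := (mn _).1 hw
    rw [injb e he f hf hh]
  · intro t a b
    simp only [add_zero, mp, mn]
    constructor
    · intro he
      exact ⟨h2 _ he, ⟨_, he, rfl⟩, ⟨_, he, rfl⟩⟩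
    · rintro ⟨⟨k1, k2, k3⟩, ⟨e, he, hh⟩, ⟨f, hf, hh'⟩⟩
      have q1 := (coe_inj (h2 e he).1 k1).1 (congrArg Prod.fst hh)
      have q2 := (coe_inj (h2 e he).2.1 k2).1 (congrArg Prod.snd hh)
      have q3 := (coe_inj (h2 f hf).1 k1).1 (congrArg Prod.fst hh')
      have q4 := (coe_inj (h2 f hf).2.2 k3).1 (congrArg Prod.snd hh')
      have := pw_inj h1 he hf (q1.trans q3.symm)
      subst this
      have : (t, (a, b)) = e := by rw [← q1, ← q2, ← q4]
      rw [this]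
      exact he

theorem RepB.inj (h : RepB 0 R l) (h' : RepB 0 R' l) : R = R' := by
  have e1 : R.pos = R'.pos := by
    ext ⟨t, y⟩; rw [rep_pos h, rep_pos h']
  have e2 : R.neg = R'.neg := by
    ext ⟨t, y⟩; rw [rep_neg h, rep_neg h']
  cases R; cases R'
  simp only at e1 e2
  subst e1 e2
  rfl

/-- Equivalence of movies. -/
def ME (l l' : List (ℝ × (ℝ × ℝ))) : Prop :=
  ∃ R R', RepB 0 R l ∧ RepB 0 R' l' ∧ EquivOfType .rII R R'

theorem ME.refl (h : Mv l) : ME l l := by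
  obtain ⟨R, hR⟩ := ofMv h
  exact ⟨R, R, hR, hR, .refl⟩

theorem ME.symm (h : ME l l') : ME l' l := by
  obtain ⟨R, R', h1, h2, h3⟩ := h
  exact ⟨R', R, h2, h1, equiv_symm h3⟩

theorem ME.trans {l'' : List (ℝ × (ℝ × ℝ))} (h : ME l l') (h' : ME l' l'') : ME l l'' := by
  obtain ⟨R, R', h1, h2, h3⟩ := h
  obtain ⟨S, S', k1, k2, k3⟩ := h'
  obtain rfl := h2.inj k1
  exact ⟨R, S', h1, k2, Relation.ReflTransGen.trans h3 k3⟩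

/-- A list of jumps with times attached. -/
def tl (u : ℕ → ℝ) : ℕ → List (ℝ × ℝ) → List (ℝ × (ℝ × ℝ))
  | _, [] => []
  | k, x :: σ => (u k, x) :: tl u (k + 1) σ

theorem hts_tl (u : ℕ → ℝ) (k : ℕ) (σ : List (ℝ × ℝ)) : hts (tl u k σ) = σ := by
  induction σ generalizing k with
  | nil => rfl
  | cons x σ ih => 
    have := ih (k + 1)
    simp only [hts] at this
    simp [tl, hts, this]

theorem tl_append (u : ℕ → ℝ) (k : ℕ) (p q : List (ℝ × ℝ)) :
    tl u k (p ++ q) = tl u k p ++ tl u (k + p.length) q := by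
  induction p generalizing k with
  | nil => rfl
  | cons x p ih => simp only [List.cons_append, tl, ih, List.length_cons]; congr 3; omega

theorem mem_tl {u : ℕ → ℝ} {k : ℕ} {σ : List (ℝ × ℝ)} {e : ℝ × (ℝ × ℝ)} :
    e ∈ tl u k σ ↔ ∃ i, σ[i]? = some e.2 ∧ e.1 = u (k + i) := by
  induction σ generalizing k with
  | nil => simp [tl]
  | cons x σ ih =>
    simp only [tl, List.mem_cons, ih]
    constructor
    · rintro (rfl | ⟨i, h1, h2⟩)
      · exact ⟨0, by simp⟩
      · exact ⟨i + 1, by simpa using h1, by rw [h2]; congr 1; omega⟩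
    · rintro ⟨i, h1, h2⟩
      cases i with
      | zero => left; ext <;> simp_all
      | succ i => right; exact ⟨i, by simpa using h1, by rw [h2]; congr 1; omega⟩

theorem tl_pw {u : ℕ → ℝ} {k : ℕ} {σ : List (ℝ × ℝ)}
    (h : StrictMonoOn u (Finset.Ico k (k + σ.length))) :
    (tl u k σ).Pairwise (fun e f => e.1 < f.1) := by
  induction σ generalizing k with
  | nil => simp [tl]
  | cons x σ ih =>
    simp only [tl, List.pairwise_cons]
    constructor
    · intro e he
      obtain ⟨i, h1, h2⟩ := mem_tl.1 he
      have : i < σ.length := by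
        by_contra hc
        rw [List.getElem?_eq_none (by omega)] at h1
        simp at h1
      rw [h2]
      exact h (by simp) (by simp; omega) (by omega)
    · refine ih (h.mono ?_)
      intro y hy
      simp at hy ⊢
      omega

theorem tl_mv {u : ℕ → ℝ} {σ : List (ℝ × ℝ)}
    (h : StrictMonoOn u (Finset.range σ.length)) (hI : MapsTo u (Finset.range σ.length) (Ico 0 1))
    (hv : Valid σ) (hne : σ ≠ []) (hσ : HIn (Ico (0:ℝ) 1) σ) : Mv (tl u 0 σ) := by
  refine ⟨tl_pw (by rw [zero_add, ← Finset.range_eq_Ico]; exact h), ?_, by rwa [hts_tl], ?_⟩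
  · intro e he
    obtain ⟨i, h1, h2⟩ := mem_tl.1 he
    have : i < σ.length := by
      by_contra hc
      rw [List.getElem?_eq_none (by omega)] at h1
      simp at h1
    refine ⟨?_, hσ _ (List.mem_of_getElem? h1)⟩
    rw [h2]
    exact hI (by simpa using this)
  · cases σ with
    | nil => exact absurd rfl hne
    | cons => simp [tl]

theorem eq_tl (l : List (ℝ × (ℝ × ℝ))) : ∀ k, ∃ u : ℕ → ℝ, l = tl u k (hts l) ∧
    (∀ i, u (k + i) = (l.getD i (0, (0, 0))).1) := by
  intro k
  refine ⟨fun j => (l.getD (j - k) (0, (0, 0))).1, ?_, fun i => by simp⟩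
  refine List.ext_getElem? ?_
  have gen : ∀ (u : ℕ → ℝ) (σ : List (ℝ × ℝ)) (k i : ℕ), (tl u k σ)[i]? =
      (σ[i]?).map (fun x => (u (k + i), x)) := by
    intro u σ
    induction σ with
    | nil => intro k i; simp [tl]
    | cons x σ ih =>
      intro k i
      cases i with
      | zero => simp [tl]
      | succ i => simp [tl, ih]; rw [show k + 1 + i = k + (i + 1) by omega]
  intro i
  rw [gen]
  simp only [hts, List.getElem?_map, Option.map_map]
  cases hh : l[i]? with
  | none => rfl
  | some x => simp [List.getD, hh]

theorem tl_step {σ : List (ℝ × ℝ)} (hv : Valid σ) (hσ : HIn (Ico (0:ℝ) 1) σ) {w : ℕ → ℝ} {x : ℕ}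
    {c : ℝ} (h1 : StrictMonoOn w (Finset.range σ.length))
    (h2 : StrictMonoOn (Function.update w x c) (Finset.range σ.length))
    (h3 : MapsTo w (Finset.range σ.length) (Ico 0 1))
    (h4 : MapsTo (Function.update w x c) (Finset.range σ.length) (Ico 0 1))
    (hx : x ∈ Finset.range σ.length) (hc : w x < c) : ME (tl w 0 σ) (tl (Function.update w x c) 0 σ) := by
  have hne : σ ≠ [] := by rintro rfl; simp at hx
  obtain ⟨R, hR⟩ := ofMv (tl_mv h1 h3 hv hne hσ)
  obtain ⟨R', hR'⟩ := ofMv (tl_mv h2 h4 hv hne hσ)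
  refine ⟨R, R', hR, hR', Relation.ReflTransGen.single (.inl ?_)⟩
  have hx' : x < σ.length := by simpa using hx
  have hlt : ∀ {i : ℕ} {y}, σ[i]? = some y → i < σ.length := by
    intro i y hh
    by_contra hc
    rw [List.getElem?_eq_none (by omega)] at hh
    simp at hh
  have fx : ∀ i, i < σ.length → i ≠ x → w i < w x ∨ c < w i := by
    intro i hi hne
    rcases lt_or_gt_of_ne hne with h | h
    · exact .inl (h1 (by simpa using hi) (by simpa using hx') h)
    · right
      have := h2 (show x ∈ (↑(Finset.range σ.length) : Set ℕ) by simpa using hx')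
        (show i ∈ (↑(Finset.range σ.length) : Set ℕ) by simpa using hi) h
      rwa [Function.update_self, Function.update_of_ne hne] at this
  have key : ∀ e : ℝ × (ℝ × ℝ), (∃ i, i ≠ x ∧ σ[i]? = some e.2 ∧ e.1 = w i) → e.1 < w x ∨ c < e.1 := by
    rintro e ⟨i, n, k1, k2⟩
    rw [k2]
    exact fx i (hlt k1) n
  refine vmove hR hR' (t := w x) (t' := c) (a := σ[x].1) (b := σ[x].2)
    (O := fun e => ∃ i, i ≠ x ∧ σ[i]? = some e.2 ∧ e.1 = w i) ?_ ?_ hc.ne ?_ ?_ (t1 := w x) (t2 := c)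
    (y1 := σ[x].1) (y2 := σ[x].2) (.inl ⟨rfl, rfl⟩) (.inl ⟨rfl, rfl⟩) ?_
  · intro e
    rw [mem_tl]
    constructor
    · rintro ⟨i, k1, k2⟩
      rw [zero_add] at k2
      by_cases hi : i = x
      · subst hi
        left
        rw [List.getElem?_eq_getElem hx', Option.some.injEq] at k1
        ext <;> simp [k1, k2]
      · exact .inr ⟨i, hi, k1, k2⟩
    · rintro (rfl | ⟨i, _, k1, k2⟩)
      · exact ⟨x, by simp, by simp⟩
      · exact ⟨i, k1, by simpa using k2⟩
  · intro e
    rw [mem_tl]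
    constructor
    · rintro ⟨i, k1, k2⟩
      rw [zero_add] at k2
      by_cases hi : i = x
      · subst hi
        left
        rw [List.getElem?_eq_getElem hx', Option.some.injEq] at k1
        rw [Function.update_self] at k2
        ext <;> simp [k1, k2]
      · rw [Function.update_of_ne hi] at k2
        exact .inr ⟨i, hi, k1, k2⟩
    · rintro (rfl | ⟨i, hi, k1, k2⟩)
      · exact ⟨x, by simp, by simp⟩
      · exact ⟨i, k1, by simpa [Function.update_of_ne hi] using k2⟩
  · exact hv.2.2 _ (List.getElem_mem _)
  · intro e he
    have := key e he
    constructor <;> intro hh <;> rw [hh] at this <;> rcases this with h | h <;> linarith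
  · intro e he hh
    exfalso
    have := key e he
    unfold InClosed InOpen at hh
    grind

theorem tl_slide {σ : List (ℝ × ℝ)} (hv : Valid σ) (hσ : HIn (Ico (0:ℝ) 1) σ) (hne : σ ≠ [])
    {u m : ℕ → ℝ} (h1 : StrictMonoOn u (Finset.range σ.length))
    (h2 : StrictMonoOn m (Finset.range σ.length))
    (h3 : MapsTo u (Finset.range σ.length) (Ico 0 1))
    (h4 : MapsTo m (Finset.range σ.length) (Ico 0 1)) : ME (tl u 0 σ) (tl m 0 σ) := by
  have half : ∀ {u m : ℕ → ℝ}, StrictMonoOn u (Finset.range σ.length) →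
      StrictMonoOn m (Finset.range σ.length) → MapsTo u (Finset.range σ.length) (Ico 0 1) →
      MapsTo m (Finset.range σ.length) (Ico 0 1) → (∀ x ∈ Finset.range σ.length, u x ≤ m x) →
      ME (tl u 0 σ) (tl m 0 σ) := by
    intro u m h1 h2 h3 h4 hle
    obtain ⟨w, hw, hP⟩ := slide_up (F := Finset.range σ.length) (I := Ico (0:ℝ) 1) m h2 h4
      (fun w => ME (tl u 0 σ) (tl w 0 σ))
      (fun w x c hw k1 k2 k3 k4 hx hc => hw.trans (tl_step hv hσ k1 k2 k3 k4 hx hc)) _ u rfl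
      (ME.refl (tl_mv h1 h3 hv hne hσ)) h1 h3 hle
    have gen : ∀ (τ : List (ℝ × ℝ)) (k : ℕ), (∀ i, i < τ.length → w (k + i) = m (k + i)) →
        tl w k τ = tl m k τ := by
      intro τ
      induction τ with
      | nil => intro k _; rfl
      | cons x τ ih =>
        intro k hk
        simp only [tl]
        have h0 := hk 0 (by simp)
        rw [add_zero] at h0
        rw [h0, ih (k + 1)]
        · intro i hi
          have := hk (i + 1) (by simpa using hi)
          rw [show k + 1 + i = k + (i + 1) by omega]
          exact this
    rw [← gen σ 0 (fun i hi => hw (by simpa using hi))]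
    exact hP
  have k1 : StrictMonoOn (fun x => max (u x) (m x)) (Finset.range σ.length) := by
    intro a ha b hb hab
    exact max_lt_max (h1 ha hb hab) (h2 ha hb hab)
  have k2 : MapsTo (fun x => max (u x) (m x)) (Finset.range σ.length) (Ico 0 1) := by
    intro a ha
    rcases max_choice (u a) (m a) with h | h <;> simp only [h]
    · exact h3 ha
    · exact h4 ha
  exact (half h1 k1 h3 k2 (fun x _ => le_max_left _ _)).trans
    (half h2 k1 h4 k2 (fun x _ => le_max_right _ _)).symm

/-- Movies with the same jumps are equivalent. -/
theorem ME.of_hts (h : Mv l) (h' : Mv l') (hh : hts l = hts l') : ME l l' := by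
  have key : ∀ {l}, Mv l → ∃ u : ℕ → ℝ, l = tl u 0 (hts l) ∧
      StrictMonoOn u (Finset.range (hts l).length) ∧ MapsTo u (Finset.range (hts l).length) (Ico 0 1) := by
    intro l h
    obtain ⟨u, h1, h2⟩ := eq_tl l 0
    refine ⟨u, h1, ?_, ?_⟩
    · intro a ha b hb hab
      have ha' : a < l.length := by simpa [hts] using ha
      have hb' : b < l.length := by simpa [hts] using hb
      have e1 := h2 a
      have e2 := h2 b
      rw [zero_add] at e1 e2
      rw [e1, e2, List.getD_eq_getElem _ _ ha', List.getD_eq_getElem _ _ hb']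
      exact List.pairwise_iff_getElem.1 h.1 a b ha' hb' hab
    · intro a ha
      have ha' : a < l.length := by simpa [hts] using ha
      have e1 := h2 a
      rw [zero_add] at e1
      rw [e1, List.getD_eq_getElem _ _ ha']
      exact (h.2.1 _ (List.getElem_mem _)).1
  obtain ⟨u, e, k1, k2⟩ := key h
  obtain ⟨u', e', k1', k2'⟩ := key h'
  rw [← hh] at e' k1' k2'
  rw [e, e']
  refine tl_slide h.2.2.1 ?_ ?_ k1 k1' k2 k2'
  · intro x hx
    obtain ⟨y, hy, rfl⟩ := List.mem_map.1 hx
    exact (h.2.1 y hy).2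
  · intro hc
    simp only [hts, List.map_eq_nil_iff] at hc
    exact h.2.2.2 hc

end Q
end RD

namespace RD
section Q

theorem tl_congr {u w : ℕ → ℝ} (τ : List (ℝ × ℝ)) : ∀ {k k' : ℕ},
    (∀ i, i < τ.length → u (k + i) = w (k' + i)) → tl u k τ = tl w k' τ := by
  induction τ with
  | nil => intro k k' _; rfl
  | cons x τ ih =>
    intro k k' hk
    simp only [tl]
    have h0 := hk 0 (by simp)
    rw [add_zero, add_zero] at h0
    rw [h0, ih (k := k + 1) (k' := k' + 1)]
    intro i hi
    have := hk (i + 1) (by simpa using hi)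
    rw [show k + 1 + i = k + (i + 1) by omega, show k' + 1 + i = k' + (i + 1) by omega]
    exact this

theorem mem_tl_bd {u : ℕ → ℝ} {k : ℕ} {σ : List (ℝ × ℝ)} {e : ℝ × (ℝ × ℝ)} (h : e ∈ tl u k σ) :
    ∃ i, k ≤ i ∧ i < k + σ.length ∧ e.1 = u i ∧ e.2 ∈ σ := by
  obtain ⟨i, h1, h2⟩ := mem_tl.1 h
  refine ⟨k + i, by omega, ?_, h2, List.mem_of_getElem? h1⟩
  by_contra hc
  rw [List.getElem?_eq_none (by omega)] at h1
  simp at h1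

/-- Equally spaced times. -/
def UU (N : ℕ) (i : ℕ) : ℝ := (i : ℝ) / (N : ℝ)

theorem UU_mono {N : ℕ} (hN : 0 < N) : StrictMono (UU N) := by
  intro i j h
  unfold UU
  have : (0:ℝ) < N := by exact_mod_cast hN
  gcongr

theorem UU_mem {N i : ℕ} (h : i < N) : UU N i ∈ Ico (0:ℝ) 1 := by
  have : (0:ℝ) < N := by exact_mod_cast (Nat.zero_le i).trans_lt h
  refine ⟨by unfold UU; positivity, ?_⟩
  unfold UU
  rw [div_lt_one this]
  exact_mod_cast h

theorem tlg_rep {N : ℕ} {g : ℕ → ℕ} {σ : List (ℝ × ℝ)} (hg : StrictMono g)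
    (hN : ∀ i, i < σ.length → g i < N) (hv : Valid σ) (hne : σ ≠ []) (hσ : HIn (Ico (0:ℝ) 1) σ) :
    ∃ R, RepB 0 R (tl (fun i => UU N (g i)) 0 σ) := by
  have hl : 0 < σ.length := List.length_pos_of_ne_nil hne
  have hN0 : 0 < N := by have := hN 0 hl; omega
  refine ofMv (tl_mv ?_ ?_ hv hne hσ)
  · exact ((UU_mono hN0).comp hg).strictMonoOn _
  · intro i hi
    exact UU_mem (hN i (by simpa using hi))

theorem UU_cl {N : ℕ} (hN : 0 < N) {a b c : ℕ} : InClosed (UU N a) (UU N b) (UU N c) ↔ InClosed a b c :=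
  inClosed_map ((UU_mono hN).strictMonoOn univ) (mem_univ _) (mem_univ _) (mem_univ _)

/-- Equivalence of lists of jumps through movies. -/
def SE (σ τ : List (ℝ × ℝ)) : Prop := ∃ l l', hts l = σ ∧ hts l' = τ ∧ ME l l'

theorem SE.symm {σ τ : List (ℝ × ℝ)} (h : SE σ τ) : SE τ σ := by
  obtain ⟨l, l', h1, h2, h3⟩ := h
  exact ⟨l', l, h2, h1, h3.symm⟩

theorem ME.mv {l l' : List (ℝ × (ℝ × ℝ))} (h : ME l l') : Mv l ∧ Mv l' := by
  obtain ⟨R, R', h1, h2, h3⟩ := h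
  exact ⟨h1.mv, h2.mv⟩

theorem SE.trans {σ τ ρ : List (ℝ × ℝ)} (h : SE σ τ) (h' : SE τ ρ) : SE σ ρ := by
  obtain ⟨l, l', h1, h2, h3⟩ := h
  obtain ⟨k, k', k1, k2, k3⟩ := h'
  exact ⟨l, k', h1, k2, h3.trans ((ME.of_hts h3.mv.2 k3.mv.1 (h2.trans k1.symm)).trans k3)⟩

theorem se_swap {u v : List (ℝ × ℝ)} {x y : ℝ × ℝ} (h : Unlinked x y)
    (hv : Valid (u ++ x :: y :: v)) (hv' : Valid (u ++ y :: x :: v))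
    (hI : HIn (Ico (0:ℝ) 1) (u ++ x :: y :: v)) (hI' : HIn (Ico (0:ℝ) 1) (u ++ y :: x :: v)) :
    SE (u ++ x :: y :: v) (u ++ y :: x :: v) := by
  set k := u.length with hk
  set N := u.length + v.length + 5 with hNd
  have hN : 0 < N := by omega
  let g : ℕ → ℕ := fun i => if i < k + 2 then i else i + 1
  let g' : ℕ → ℕ := fun i => if i < k then i else i + 1
  have hg : StrictMono g := by intro a b hab; simp only [g]; split_ifs <;> omega
  have hg' : StrictMono g' := by intro a b hab; simp only [g']; split_ifs <;> omega
  obtain ⟨R, hR⟩ := tlg_rep (N := N) hg (by intro i hi; simp at hi; simp only [g]; split_ifs <;> omega) hv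
    (by simp) hI
  obtain ⟨R', hR'⟩ := tlg_rep (N := N) hg' (by intro i hi; simp at hi; simp only [g']; split_ifs <;> omega) hv'
    (by simp) hI'
  refine ⟨_, _, hts_tl _ _ _, hts_tl _ _ _, R, R', hR, hR', Relation.ReflTransGen.single (.inl ?_)⟩
  have e1 : tl (fun i => UU N (g i)) 0 (u ++ x :: y :: v) =
      tl (UU N) 0 u ++ (UU N k, x) :: (UU N (k + 1), y) :: tl (UU N) (k + 3) v := by
    rw [tl_append, ← hk]
    simp only [tl, zero_add]
    congr 1
    · refine tl_congr u ?_
      intro i hi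
      simp only [g]; rw [if_pos (by omega)]
    · congr 1
      · simp [g]
      · congr 1
        · simp [g]
        · refine tl_congr v ?_
          intro i hi
          simp only [g]; rw [if_neg (by omega)]; congr 1; omega
  have e2 : tl (fun i => UU N (g' i)) 0 (u ++ y :: x :: v) =
      tl (UU N) 0 u ++ (UU N (k + 1), y) :: (UU N (k + 2), x) :: tl (UU N) (k + 3) v := by
    rw [tl_append, ← hk]
    simp only [tl, zero_add]
    congr 1
    · refine tl_congr u ?_
      intro i hi
      simp only [g']; rw [if_pos (by omega)]
    · congr 1
      · simp [g']
      · congr 1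
        · simp [g']
        · refine tl_congr v ?_
          intro i hi
          simp only [g']; rw [if_neg (by omega)]; congr 1; omega
  rw [e1] at hR
  rw [e2] at hR'
  have um := UU_mono hN
  have key : ∀ e, (e ∈ tl (UU N) 0 u ∨ e = (UU N (k + 1), y) ∨ e ∈ tl (UU N) (k + 3) v) →
      e = (UU N (k + 1), y) ∨ ∃ i, e.1 = UU N i ∧ (i < k ∨ k + 3 ≤ i) := by
    rintro e (he | he | he)
    · obtain ⟨i, h1, h2, h3, _⟩ := mem_tl_bd he
      exact .inr ⟨i, h3, by omega⟩
    · exact .inl he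
    · obtain ⟨i, h1, h2, h3, _⟩ := mem_tl_bd he
      exact .inr ⟨i, h3, by omega⟩
  have hne : x.1 ≠ x.2 := hv.2.2 x (by simp)
  obtain ⟨k1, k2, k3, k4, k5⟩ := h
  have hyy : ∃ y1 y2, ((y1 = x.1 ∧ y2 = x.2) ∨ (y1 = x.2 ∧ y2 = x.1)) ∧
      ¬ InClosed y1 y2 y.1 ∧ ¬ InClosed y1 y2 y.2 := by
    by_cases hc : InOpen x.1 x.2 y.1
    · refine ⟨x.2, x.1, .inr ⟨rfl, rfl⟩, ?_⟩
      have := k5.1 hc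
      unfold InClosed
      unfold InOpen at *
      constructor <;> grind
    · refine ⟨x.1, x.2, .inl ⟨rfl, rfl⟩, ?_⟩
      have : ¬ InOpen x.1 x.2 y.2 := fun h => hc (k5.2 h)
      unfold InClosed
      constructor <;> grind
  obtain ⟨y1, y2, hy, hy1, hy2⟩ := hyy
  refine vmove hR hR' (t := UU N k) (t' := UU N (k + 2)) (a := x.1) (b := x.2)
    (O := fun e => e ∈ tl (UU N) 0 u ∨ e = (UU N (k + 1), y) ∨ e ∈ tl (UU N) (k + 3) v)
    ?_ ?_ (um (by omega)).ne hne ?_ (.inl ⟨rfl, rfl⟩) hy ?_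
  · intro e
    simp only [List.mem_append, List.mem_cons]
    grind
  · intro e
    simp only [List.mem_append, List.mem_cons]
    grind
  · intro e he
    rcases key e he with rfl | ⟨i, h1, h2⟩
    · exact ⟨(um (by omega)).ne', (um (by omega)).ne⟩
    · rw [h1]
      exact ⟨um.injective.ne (by omega), um.injective.ne (by omega)⟩
  · intro e he hh
    rcases key e he with rfl | ⟨i, h1, h2⟩
    · exact ⟨hy1, hy2⟩
    · rw [h1, UU_cl hN] at hh
      unfold InClosed InOpen at hh
      omega

theorem se_rot {v : List (ℝ × ℝ)} {x : ℝ × ℝ} (hv : Valid (x :: v)) (hv' : Valid (v ++ [x]))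
    (hI : HIn (Ico (0:ℝ) 1) (x :: v)) (hI' : HIn (Ico (0:ℝ) 1) (v ++ [x])) :
    SE (x :: v) (v ++ [x]) := by
  set n := v.length with hn
  set N := v.length + 5 with hNd
  have hN : 0 < N := by omega
  obtain ⟨R, hR⟩ := tlg_rep (N := N) (g := id) strictMono_id (by intro i hi; simp at hi; simp; omega) hv
    (by simp) hI
  obtain ⟨R', hR'⟩ := tlg_rep (N := N) (g := fun i => i + 1) (by intro a b hab; simpa using hab)
    (by intro i hi; simp at hi; show i + 1 < N; omega) hv' (by simp) hI'
  refine ⟨_, _, hts_tl _ _ _, hts_tl _ _ _, R, R', hR, hR', Relation.ReflTransGen.single (.inl ?_)⟩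
  have e1 : tl (fun i => UU N (id i)) 0 (x :: v) = (UU N 0, x) :: tl (UU N) 1 v := by
    simp [tl]
  have e2 : tl (fun i => UU N (i + 1)) 0 (v ++ [x]) = tl (UU N) 1 v ++ [(UU N (n + 1), x)] := by
    rw [tl_append]
    simp only [tl, zero_add]
    congr 1
    refine tl_congr v ?_
    intro i hi
    show UU N (0 + i + 1) = UU N (1 + i)
    congr 1; omega
  rw [e1] at hR
  rw [e2] at hR'
  have um := UU_mono hN
  have key : ∀ e, e ∈ tl (UU N) 1 v → ∃ i, e.1 = UU N i ∧ 1 ≤ i ∧ i ≤ n := by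
    intro e he
    obtain ⟨i, h1, h2, h3, _⟩ := mem_tl_bd he
    exact ⟨i, h3, by omega, by omega⟩
  refine vmove hR hR' (t := UU N 0) (t' := UU N (n + 1)) (a := x.1) (b := x.2)
    (O := fun e => e ∈ tl (UU N) 1 v)
    ?_ ?_ (um (by omega)).ne (hv.2.2 x (by simp)) ?_ (.inr ⟨rfl, rfl⟩) (.inl ⟨rfl, rfl⟩) ?_
  · intro e
    simp only [List.mem_cons]
  · intro e
    simp only [List.mem_append, List.mem_singleton]
    grind
  · intro e he
    obtain ⟨i, h1, h2⟩ := key e he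
    rw [h1]
    exact ⟨um.injective.ne (by omega), um.injective.ne (by omega)⟩
  · intro e he hh
    obtain ⟨i, h1, h2⟩ := key e he
    rw [h1, UU_cl hN] at hh
    unfold InClosed InOpen at hh
    omega

theorem se_bigex {h h' a b : ℝ} {u v : List (ℝ × ℝ)}
    (hu : ∀ e ∈ u, ¬ InClosed h h' e.1 ∧ ¬ InClosed h h' e.2)
    (ha : ¬ InClosed h h' a) (hb : ¬ InClosed h h' b)
    (hv : Valid ((h, b) :: (u ++ (a, h) :: v))) (hv' : Valid ((h', b) :: (u ++ (a, h') :: v)))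
    (hI : HIn (Ico (0:ℝ) 1) ((h, b) :: (u ++ (a, h) :: v)))
    (hI' : HIn (Ico (0:ℝ) 1) ((h', b) :: (u ++ (a, h') :: v))) :
    SE ((h, b) :: (u ++ (a, h) :: v)) ((h', b) :: (u ++ (a, h') :: v)) := by
  set k := u.length with hk
  set N := u.length + v.length + 5 with hNd
  have hN : 0 < N := by omega
  obtain ⟨R, hR⟩ := tlg_rep (N := N) (g := id) strictMono_id (by intro i hi; simp at hi; simp; omega) hv
    (by simp) hI
  obtain ⟨R', hR'⟩ := tlg_rep (N := N) (g := id) strictMono_id (by intro i hi; simp at hi; simp; omega) hv'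
    (by simp) hI'
  by_cases hhh : h = h'
  · subst hhh
    exact ⟨_, _, hts_tl _ _ _, hts_tl _ _ _, R, R, hR, hR, .refl⟩
  refine ⟨_, _, hts_tl _ _ _, hts_tl _ _ _, R, R', hR, hR', Relation.ReflTransGen.single (.inl ?_)⟩
  have e1 : ∀ h, tl (fun i => UU N (id i)) 0 ((h, b) :: (u ++ (a, h) :: v)) =
      (UU N 0, (h, b)) :: (tl (UU N) 1 u ++ (UU N (1 + k), (a, h)) :: tl (UU N) (1 + k + 1) v) := by
    intro h
    simp [tl, tl_append, hk]
  rw [e1] at hR hR'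
  have um := UU_mono hN
  refine hmove hR hR' (t := UU N 0) (s := UU N (1 + k)) (g := h) (g' := h') (a := a) (b := b)
    (O := fun e => e ∈ tl (UU N) 1 u ∨ e ∈ tl (UU N) (1 + k + 1) v)
    ?_ ?_ (um (by omega)).ne hhh ?_ ha hb ?_
  · intro e
    simp only [List.mem_append, List.mem_cons]
    grind
  · intro e
    simp only [List.mem_append, List.mem_cons]
    grind
  · rintro e (he | he)
    · obtain ⟨i, h1, h2, h3, _⟩ := mem_tl_bd he
      rw [h3]
      exact ⟨um.injective.ne (by omega), um.injective.ne (by omega)⟩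
    · obtain ⟨i, h1, h2, h3, _⟩ := mem_tl_bd he
      rw [h3]
      exact ⟨um.injective.ne (by omega), um.injective.ne (by omega)⟩
  · rintro e (he | he) hh
    · obtain ⟨i, h1, h2, h3, h4⟩ := mem_tl_bd he
      exact hu _ h4
    · obtain ⟨i, h1, h2, h3, _⟩ := mem_tl_bd he
      rw [h3, UU_cl hN] at hh
      unfold InClosed InOpen at hh
      omega

theorem se_merge {u v : List (ℝ × ℝ)} {a m b : ℝ} (h : InOpen a b m)
    (hv : Valid (u ++ (a, m) :: (m, b) :: v)) (hv' : Valid (u ++ (a, b) :: v))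
    (hI : HIn (Ico (0:ℝ) 1) (u ++ (a, m) :: (m, b) :: v)) (hI' : HIn (Ico (0:ℝ) 1) (u ++ (a, b) :: v)) :
    SE (u ++ (a, b) :: v) (u ++ (a, m) :: (m, b) :: v) := by
  set k := u.length with hk
  set N := u.length + v.length + 5 with hNd
  have hN : 0 < N := by omega
  let g' : ℕ → ℕ := fun i => if i ≤ k then i else i + 1
  have hg' : StrictMono g' := by intro a b hab; simp only [g']; split_ifs <;> omega
  obtain ⟨R, hR⟩ := tlg_rep (N := N) hg' (by intro i hi; simp at hi; simp only [g']; split_ifs <;> omega) hv'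
    (by simp) hI'
  obtain ⟨R', hR'⟩ := tlg_rep (N := N) (g := id) strictMono_id (by intro i hi; simp at hi; simp; omega) hv
    (by simp) hI
  refine ⟨_, _, hts_tl _ _ _, hts_tl _ _ _, R, R', hR, hR', Relation.ReflTransGen.single (.inr (.inl ?_))⟩
  have e1 : tl (fun i => UU N (g' i)) 0 (u ++ (a, b) :: v) =
      tl (UU N) 0 u ++ (UU N k, (a, b)) :: tl (UU N) (k + 2) v := by
    rw [tl_append, ← hk]
    simp only [tl, zero_add]
    congr 1
    · refine tl_congr u ?_
      intro i hi
      simp only [g']; rw [if_pos (by omega)]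
    · congr 1
      · simp [g']
      · refine tl_congr v ?_
        intro i hi
        simp only [g']; rw [if_neg (by omega)]; congr 1; omega
  have e2 : tl (fun i => UU N (id i)) 0 (u ++ (a, m) :: (m, b) :: v) =
      tl (UU N) 0 u ++ (UU N k, (a, m)) :: (UU N (k + 1), (m, b)) :: tl (UU N) (k + 2) v := by
    simp [tl, tl_append, hk]
  rw [e1] at hR
  rw [e2] at hR'
  have um := UU_mono hN
  refine smove hR hR' (t := UU N k) (s := UU N (k + 1)) (a := a) (b := b) (m := m)
    (O := fun e => e ∈ tl (UU N) 0 u ∨ e ∈ tl (UU N) (k + 2) v)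
    ?_ ?_ (um (by omega)).ne h ?_
  · intro e
    simp only [List.mem_append, List.mem_cons]
    grind
  · intro e
    simp only [List.mem_append, List.mem_cons]
    grind
  · rintro e (he | he) hh
    · obtain ⟨i, h1, h2, h3, h4⟩ := mem_tl_bd he
      rw [h3, UU_cl hN] at hh
      unfold InClosed InOpen at hh
      omega
    · obtain ⟨i, h1, h2, h3, _⟩ := mem_tl_bd he
      rw [h3, UU_cl hN] at hh
      unfold InClosed InOpen at hh
      omega

theorem se_step0 {σ τ : List (ℝ × ℝ)} (h : Step0 σ τ) (hv : Valid σ) (hv' : Valid τ)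
    (hI : HIn (Ico (0:ℝ) 1) σ) (hI' : HIn (Ico (0:ℝ) 1) τ) : SE σ τ := by
  cases h with
  | red _ _ h =>
    cases h with
    | swap u v x y h => exact se_swap h hv hv' hI hI'
    | merge u v a m b h => exact (se_merge h hv hv' hI hI').symm
  | rot x v => exact se_rot hv hv' hI hI'
  | bigex h h' a b u v hu ha hb => exact se_bigex hu ha hb hv hv' hI hI'

theorem se_ch {B : ℕ} {σ τ : List (ℝ × ℝ)} (h : CH (Ico (0:ℝ) 1) B σ τ) : σ = τ ∨ SE σ τ := by
  induction h with
  | refl => exact .inl rfl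
  | tail _ hs ih =>
    obtain ⟨⟨h1, h2, h3⟩, ⟨_, h4⟩, ⟨_, h5⟩⟩ := hs
    have : SE _ _ := h3.elim (fun h => se_step0 h h1 h2 h4 h5) (fun h => (se_step0 h h2 h1 h5 h4).symm)
    rcases ih with rfl | ih
    · exact .inr this
    · exact .inr (ih.trans this)

/-- Related movies come from equivalent diagrams. -/
theorem equiv_of_ch {B : ℕ} {R R' : RectDiagram} {l l' : List (ℝ × (ℝ × ℝ))} (h : RepB 0 R l)
    (h' : RepB 0 R' l') (hc : CH (Ico (0:ℝ) 1) B (hts l) (hts l')) : EquivOfType .rII R R' := by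
  have : ME l l' := by
    rcases se_ch hc with he | ⟨k, k', h1, h2, h3⟩
    · exact ME.of_hts h.mv h'.mv he
    · exact (ME.of_hts h.mv h3.mv.1 h1.symm).trans (h3.trans (ME.of_hts h3.mv.2 h'.mv h2))
  obtain ⟨S, S', k1, k2, k3⟩ := this
  rwa [h.inj k1, h'.inj k2]

end Q
end RD

namespace RD
section Q

/-- Bound of the heights of an encoding. -/
def MM (L : List ((ℕ × ℕ) × Bool)) : ℕ := (L.map (fun e => e.1.1 + e.1.2 + 1)).sum

theorem lt_MM {L : List ((ℕ × ℕ) × Bool)} {e} (h : e ∈ L) : e.1.1 < MM L ∧ e.1.2 < MM L := by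
  have : e.1.1 + e.1.2 + 1 ≤ MM L :=
    List.single_le_sum (by simp) _ (List.mem_map.2 ⟨e, h, rfl⟩)
  omega

/-- All triples below `M`, in lexicographic order. -/
def triples (M : ℕ) : List (ℕ × (ℕ × ℕ)) :=
  (List.range M).flatMap fun x => (List.range M).flatMap fun a => (List.range M).map fun b => (x, (a, b))

theorem mem_triples {M : ℕ} {e : ℕ × (ℕ × ℕ)} : e ∈ triples M ↔ e.1 < M ∧ e.2.1 < M ∧ e.2.2 < M := by
  obtain ⟨x, a, b⟩ := e
  simp [triples]

theorem triples_sorted (M : ℕ) : (triples M).Pairwise (fun e f => e.1 < f.1 ∨ (e.1 = f.1 ∧ e ≠ f)) := by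
  unfold triples
  rw [List.pairwise_flatMap]
  constructor
  · intro x _
    rw [List.pairwise_flatMap]
    constructor
    · intro a _
      rw [List.pairwise_map]
      refine List.pairwise_lt_range.imp ?_
      intro b c h
      right; simp; omega
    · refine List.pairwise_lt_range.imp ?_
      intro b c h y hy z hz
      simp only [List.mem_map] at hy hz
      obtain ⟨_, _, rfl⟩ := hy
      obtain ⟨_, _, rfl⟩ := hz
      right; simp; omega
  · refine List.pairwise_lt_range.imp ?_
    intro b c h y hy z hz
    simp only [List.mem_map, List.mem_flatMap] at hy hz
    obtain ⟨_, _, _, _, rfl⟩ := hy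
    obtain ⟨_, _, _, _, rfl⟩ := hz
    left; exact h

open Classical in
/-- The movie of an encoding. -/
def mvL (L : List ((ℕ × ℕ) × Bool)) : List (ℕ × (ℕ × ℕ)) :=
  (triples (MM L)).filter (fun e => ((e.1, e.2.1), true) ∈ L ∧ ((e.1, e.2.2), false) ∈ L)

/-- The list of jumps of an encoding. -/
def jl (L : List ((ℕ × ℕ) × Bool)) : List (ℕ × ℕ) := (mvL L).map Prod.snd

theorem mem_mvL {L : List ((ℕ × ℕ) × Bool)} {e : ℕ × (ℕ × ℕ)} :
    e ∈ mvL L ↔ ((e.1, e.2.1), true) ∈ L ∧ ((e.1, e.2.2), false) ∈ L := by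
  simp only [mvL, List.mem_filter, mem_triples, decide_eq_true_eq]
  constructor
  · exact fun h => h.2
  · intro h
    exact ⟨⟨(lt_MM h.1).1, (lt_MM h.1).2, (lt_MM h.2).2⟩, h⟩

theorem jl_hin (L : List ((ℕ × ℕ) × Bool)) : HIn (Iio (MM L)) (jl L) := by
  intro e he
  simp only [jl, List.mem_map] at he
  obtain ⟨f, hf, rfl⟩ := he
  rw [mem_mvL] at hf
  exact ⟨(lt_MM hf.1).2, (lt_MM hf.2).2⟩

theorem grid_inj {N a b : ℕ} (ha : a < N) (hb : b < N) (h : gridPt N a = gridPt N b) : a = b := by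
  have := (coe_inj (UU_mem ha) (UU_mem hb)).1 h
  exact (UU_mono (by omega)).injective this

/-- Scaling a movie. -/
def scal (N : ℕ) (e : ℕ × (ℕ × ℕ)) : ℝ × (ℝ × ℝ) := (UU N e.1, (UU N e.2.1, UU N e.2.2))

/-- Realization up to a rotation. -/
def RealB (β : 𝕊) (L : List ((ℕ × ℕ) × Bool)) (R : RectDiagram) (N : ℕ) : Prop :=
  (∀ e ∈ L, e.1.1 < N ∧ e.1.2 < N) ∧
    (∀ p, p ∈ R.pos ↔ ∃ e ∈ L, e.2 = true ∧ p = (gridPt N e.1.1 + β, gridPt N e.1.2)) ∧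
    (∀ p, p ∈ R.neg ↔ ∃ e ∈ L, e.2 = false ∧ p = (gridPt N e.1.1 + β, gridPt N e.1.2))

theorem realB_of {L : List ((ℕ × ℕ) × Bool)} {R : RectDiagram} (h : Realizes L R) :
    ∃ N, RealB 0 L R N := by
  obtain ⟨N, hL, hp, hn⟩ := h
  refine ⟨N, hL, ?_, ?_⟩
  · intro p; rw [← Finset.mem_coe, hp]; simp only [add_zero]; rfl
  · intro p; rw [← Finset.mem_coe, hn]; simp only [add_zero]; rfl

theorem realizes_rep {L : List ((ℕ × ℕ) × Bool)} {R : RectDiagram} {β : 𝕊} {N : ℕ} (h : RealB β L R N) :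
    0 < N ∧ HIn (Iio N) (jl L) ∧ RepB β R ((mvL L).map (scal N)) := by
  obtain ⟨hL, mp, mn⟩ := h
  have hN : 0 < N := by
    obtain ⟨p, hp⟩ := R.nonempty
    rw [Finset.mem_union, mp, mn] at hp
    rcases hp with ⟨e, he, _⟩ | ⟨e, he, _⟩ <;> have := hL e he <;> omega
  refine ⟨hN, ?_, ?_, ?_⟩
  · intro e he
    simp only [jl, List.mem_map] at he
    obtain ⟨f, hf, rfl⟩ := he
    rw [mem_mvL] at hf
    exact ⟨(hL _ hf.1).2, (hL _ hf.2).2⟩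
  · rw [List.pairwise_map]
    refine List.Pairwise.imp_of_mem ?_ ((triples_sorted (MM L)).filter _)
    intro e f he hf h
    change e ∈ mvL L at he
    change f ∈ mvL L at hf
    rw [mem_mvL] at he hf
    rcases h with h | ⟨h, h'⟩
    · exact UU_mono hN h
    · exfalso
      apply h'
      have e1 := col_pos R ((mp _).2 ⟨_, he.1, rfl, rfl⟩) ((mp _).2 ⟨_, hf.1, rfl, rfl⟩) (by simp [h])
      have e2 := col_neg R ((mn _).2 ⟨_, he.2, rfl, rfl⟩) ((mn _).2 ⟨_, hf.2, rfl, rfl⟩) (by simp [h])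
      simp only [Prod.mk.injEq] at e1 e2
      have e3 := grid_inj (hL _ he.1).2 (hL _ hf.1).2 e1.2
      have e4 := grid_inj (hL _ he.2).2 (hL _ hf.2).2 e2.2
      exact Prod.ext h (Prod.ext e3 e4)
  · intro t a b
    constructor
    · intro h
      rw [List.mem_map] at h
      obtain ⟨e, he, h⟩ := h
      rw [mem_mvL] at he
      unfold scal at h
      simp only [Prod.mk.injEq] at h
      obtain ⟨rfl, rfl, rfl⟩ := h
      exact ⟨⟨UU_mem (hL _ he.1).1, UU_mem (hL _ he.1).2, UU_mem (hL _ he.2).2⟩,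
        (mp _).2 ⟨_, he.1, rfl, rfl⟩, (mn _).2 ⟨_, he.2, rfl, rfl⟩⟩
    · rintro ⟨⟨ht, ha, hb⟩, h1, h2⟩
      rw [mp] at h1
      rw [mn] at h2
      obtain ⟨⟨⟨x, y⟩, _⟩, h1, rfl, h1'⟩ := h1
      obtain ⟨⟨⟨x', z⟩, _⟩, h2, rfl, h2'⟩ := h2
      simp only [Prod.mk.injEq, add_left_inj] at h1' h2'
      have b1 := hL _ h1
      have b2 := hL _ h2
      have k1 := (coe_inj ht (UU_mem b1.1)).1 h1'.1
      have k2 := (coe_inj ha (UU_mem b1.2)).1 h1'.2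
      have k3 := (coe_inj hb (UU_mem b2.2)).1 h2'.2
      have k4 := grid_inj b1.1 b2.1 (h1'.1.symm.trans h2'.1)
      simp only at k1 k2 k3 k4
      subst k4
      rw [List.mem_map]
      exact ⟨(x, (y, z)), mem_mvL.2 ⟨h1, h2⟩, by simp [scal, k1, k2, k3]⟩

theorem hts_scal (N : ℕ) (L : List ((ℕ × ℕ) × Bool)) :
    hts ((mvL L).map (scal N)) = mapL (UU N) (jl L) := by
  simp [hts, jl, mapL, scal, Function.comp_def, Prod.map]

/-- The inverse of scaling. -/
def iU (N : ℕ) : ℝ → ℕ := Function.invFun (UU N)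

theorem iU_UU {N : ℕ} (hN : 0 < N) (a : ℕ) : iU N (UU N a) = a :=
  Function.leftInverse_invFun (UU_mono hN).injective a

theorem iU_mono {N : ℕ} (hN : 0 < N) : StrictMonoOn (iU N) (range (UU N)) := by
  rintro _ ⟨a, rfl⟩ _ ⟨b, rfl⟩ h
  rw [iU_UU hN, iU_UU hN]
  exact (UU_mono hN).lt_iff_lt.1 h

theorem mapL_iU {N : ℕ} (hN : 0 < N) (σ : List (ℕ × ℕ)) : mapL (iU N) (mapL (UU N) σ) = σ := by
  unfold mapL
  rw [List.map_map]
  refine (List.map_congr_left ?_).trans (List.map_id _)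
  intro e _
  simp [Prod.map, iU_UU hN]

theorem hin_range (N : ℕ) (σ : List (ℕ × ℕ)) : HIn (range (UU N)) (mapL (UU N) σ) := by
  intro e he
  simp only [mapL, List.mem_map] at he
  obtain ⟨f, _, rfl⟩ := he
  exact ⟨⟨_, rfl⟩, ⟨_, rfl⟩⟩

theorem valid_of_map {N : ℕ} (hN : 0 < N) {σ : List (ℕ × ℕ)} (h : Valid (mapL (UU N) σ)) : Valid σ := by
  have := h.map (iU_mono hN) (hin_range N σ)
  rwa [mapL_iU hN] at this

theorem CH.mapUU {N B : ℕ} (hN : 0 < N) {σ τ : List (ℕ × ℕ)} (h : CH (Iio N) B σ τ) :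
    CH (Ico (0:ℝ) 1) B (mapL (UU N) σ) (mapL (UU N) τ) := by
  have hh : ∀ {ρ : List (ℕ × ℕ)}, HIn (Iio N) ρ → HIn (Ico (0:ℝ) 1) (mapL (UU N) ρ) := by
    intro ρ hρ e he
    simp only [mapL, List.mem_map] at he
    obtain ⟨f, hf, rfl⟩ := he
    exact ⟨UU_mem (hρ f hf).1, UU_mem (hρ f hf).2⟩
  induction h with
  | refl => exact Relation.ReflTransGen.refl
  | tail _ hs ih =>
    refine ih.tail ⟨hs.1.map ((UU_mono hN).strictMonoOn (Iio N)) hs.2.1.2 hs.2.2.2, ⟨?_, hh hs.2.1.2⟩, ?_, hh hs.2.2.2⟩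
    · simpa [mapL] using hs.2.1.1
    · simpa [mapL] using hs.2.2.1

/-- The length bound. -/
def BB (L L' : List ((ℕ × ℕ) × Bool)) : ℕ := bigB ((jl L).length + (jl L').length)
/-- The height bound. -/
def NN (L L' : List ((ℕ × ℕ) × Bool)) : ℕ := 2 * BB L L' + MM L + MM L'

theorem equiv_of_ch_base {B : ℕ} {R R' : RectDiagram} {β β' : 𝕊} {l l' : List (ℝ × (ℝ × ℝ))}
    (h : RepB β R l) (h' : RepB β' R' l') (hl : l.length ≤ B) (hl' : l'.length ≤ B)
    (hc : CH (Ico (0:ℝ) 1) B (hts l) (hts l')) : EquivOfType .rII R R' := by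
  have key : ∀ {R : RectDiagram} {β : 𝕊} {l : List (ℝ × (ℝ × ℝ))}, RepB β R l → l.length ≤ B →
      ∃ k, RepB 0 R k ∧ CH (Ico (0:ℝ) 1) B (hts l) (hts k) := by
    intro R β l h hl
    obtain ⟨k, hk⟩ := RepB.exists 0 R
    obtain ⟨l1, l2, e1, e2⟩ := h.base hk
    refine ⟨k, hk, ?_⟩
    have hv := h.valid
    have hI : HIn (Ico (0:ℝ) 1) (hts l) := by
      intro e he
      simp only [hts, List.mem_map] at he
      obtain ⟨f, hf, rfl⟩ := he
      exact (h.bds hf).2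
    have hlen : (hts l).length ≤ B := by simpa [hts] using hl
    rw [e1] at hv hI hlen ⊢
    rw [e2]
    exact CH.rot l1 hv hI hlen
  obtain ⟨k, hk, c⟩ := key h hl
  obtain ⟨k', hk', c'⟩ := key h' hl'
  exact equiv_of_ch hk hk' ((c.symm.trans hc).trans c')

theorem main_rII {L L' : List ((ℕ × ℕ) × Bool)} {R R' : RectDiagram} {β β' : 𝕊} {N N' : ℕ}
    (h : RealB β L R N) (h' : RealB β' L' R' N') :
    EquivOfType .rII R R' ↔ CH (Iio (NN L L')) (BB L L') (jl L) (jl L') := by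
  obtain ⟨hN, hI, hr⟩ := realizes_rep h
  obtain ⟨hN', hI', hr'⟩ := realizes_rep h'
  have v := hr.valid
  have v' := hr'.valid
  rw [hts_scal] at v v'
  have w := valid_of_map hN v
  have w' := valid_of_map hN' v'
  set m := (jl L).length + (jl L').length with hm
  have hmB : m ≤ BB L L' := Nat.le_add_left _ _
  have lm : ∀ (k : ℕ) (σ : List (ℕ × ℕ)), (mapL (UU k) σ).length = σ.length := by
    intro k σ; simp [mapL]
  have hj : HIn (Iio (NN L L')) (jl L) := fun e he => by
    have := jl_hin L e he
    simp only [mem_Iio] at this ⊢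
    unfold NN; omega
  have hj' : HIn (Iio (NN L L')) (jl L') := fun e he => by
    have := jl_hin L' e he
    simp only [mem_Iio] at this ⊢
    unfold NN; omega
  have fm : ∀ {k : ℕ} {σ : List (ℕ × ℕ)}, 0 < k → StrictMonoOn (iU k) {x | x ∈ fsts (mapL (UU k) σ)} := by
    intro k σ hk
    refine (iU_mono hk).mono ?_
    intro x hx
    simp only [mem_ofPred_eq, fsts, List.mem_map] at hx
    obtain ⟨e, he, rfl⟩ := hx
    exact (hin_range k σ e he).1
  have fi : ∀ {k M : ℕ} {σ : List (ℕ × ℕ)}, 0 < k → HIn (Iio M) σ →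
      MapsTo (iU k) {x | x ∈ fsts (mapL (UU k) σ)} (Iio M) := by
    intro k M σ hk hσ x hx
    simp only [mem_ofPred_eq, fsts, mapL, List.map_map, List.mem_map] at hx
    obtain ⟨e, he, rfl⟩ := hx
    simp only [Function.comp_apply, Prod.map_fst, iU_UU hk]
    exact (hσ e he).1
  have gi : ∀ {k : ℕ} {σ : List (ℕ × ℕ)}, HIn (Iio k) σ →
      MapsTo (UU k) {x | x ∈ fsts σ} (Ico (0:ℝ) 1) := by
    intro k σ hσ x hx
    simp only [mem_ofPred_eq, fsts, List.mem_map] at hx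
    obtain ⟨e, he, rfl⟩ := hx
    exact UU_mem (hσ e he).1
  constructor
  · intro he
    have c := chR_equiv he _ _ _ _ hr hr'
    rw [hts_scal, hts_scal] at c
    have b := chain_bounded (m := m) v v' (by rw [lm]; omega) (by rw [lm]; omega) c
    have d := discretize (N := NN L L') (B := BB L L') (by unfold NN; omega) b v (by rw [lm]; omega)
      (fm hN) (fi hN hj) (f' := iU N') (fm hN') (fi hN' hj')
    rwa [mapL_iU hN, mapL_iU hN'] at d
  · intro hc
    have hK : 0 < NN L L' := by
      have : 0 < (jl L).length := by
        have := hr.ne_nil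
        rw [List.length_pos_iff]
        intro h0
        apply this
        unfold jl at h0
        rw [List.map_eq_nil_iff] at h0
        simp [h0]
      unfold NN; omega
    have c := hc.mapUU hK
    have j1 : (jl L).length = (mvL L).length := by simp [jl]
    have j2 : (jl L').length = (mvL L').length := by simp [jl]
    refine equiv_of_ch_base (B := BB L L') hr hr' (by rw [List.length_map]; omega)
      (by rw [List.length_map]; omega) ?_
    rw [hts_scal, hts_scal]
    have s1 := slide (B := BB L L') (I := Ico (0:ℝ) 1) w (by omega) ((UU_mono hN).strictMonoOn _)
      ((UU_mono hK).strictMonoOn _) (gi hI) (gi hj)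
    have s2 := slide (B := BB L L') (I := Ico (0:ℝ) 1) w' (by omega) ((UU_mono hK).strictMonoOn _)
      ((UU_mono hN').strictMonoOn _) (gi hj') (gi hI')
    exact (s1.trans c).trans s2

end Q
end RD

namespace RD
section Q

/-- Switching the signs. -/
def sw (R : RectDiagram) : RectDiagram where
  pos := R.neg
  neg := R.pos
  disj := R.disj.symm
  nonempty := by rw [Finset.union_comm]; exact R.nonempty
  thetaEq := R.thetaEq.symm
  phiEq := R.phiEq.symm
  thetaInjPos := R.thetaInjNeg
  thetaInjNeg := R.thetaInjPos
  phiInjPos := R.phiInjNeg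
  phiInjNeg := R.phiInjPos

/-- Reflection of the torus. -/
def rfl0 : Torus ↪ Torus := ⟨fun p => (-p.1, p.2), by rintro ⟨a, b⟩ ⟨c, d⟩ h; simpa using h⟩

theorem rfl0_apply (p : Torus) : rfl0 p = (-p.1, p.2) := rfl

theorem img_fst (s : Finset Torus) : (s.map rfl0).image Prod.fst = (s.image Prod.fst).image (fun x => -x) := by
  classical
  rw [Finset.map_eq_image, Finset.image_image, Finset.image_image]; rfl

theorem img_snd (s : Finset Torus) : (s.map rfl0).image Prod.snd = s.image Prod.snd := by
  classical
  rw [Finset.map_eq_image, Finset.image_image]; rfl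

theorem inj_fst {s : Finset Torus} (h : Set.InjOn Prod.fst (s : Set Torus)) :
    Set.InjOn Prod.fst ((s.map rfl0 : Finset Torus) : Set Torus) := by
  intro p hp q hq e
  rw [Finset.mem_coe, Finset.mem_map] at hp hq
  obtain ⟨p, hp, rfl⟩ := hp
  obtain ⟨q, hq, rfl⟩ := hq
  rw [h hp hq (by simpa [rfl0_apply] using e)]

theorem inj_snd {s : Finset Torus} (h : Set.InjOn Prod.snd (s : Set Torus)) :
    Set.InjOn Prod.snd ((s.map rfl0 : Finset Torus) : Set Torus) := by
  intro p hp q hq e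
  rw [Finset.mem_coe, Finset.mem_map] at hp hq
  obtain ⟨p, hp, rfl⟩ := hp
  obtain ⟨q, hq, rfl⟩ := hq
  rw [h hp hq (by simpa [rfl0_apply] using e)]

/-- Reflection of a diagram. -/
def rf (R : RectDiagram) : RectDiagram where
  pos := R.pos.map rfl0
  neg := R.neg.map rfl0
  disj := by rw [Finset.disjoint_map]; exact R.disj
  nonempty := by rw [← Finset.map_union, Finset.map_nonempty]; exact R.nonempty
  thetaEq := by rw [img_fst, img_fst, R.thetaEq]
  phiEq := by rw [img_snd, img_snd, R.phiEq]
  thetaInjPos := inj_fst R.thetaInjPos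
  thetaInjNeg := inj_fst R.thetaInjNeg
  phiInjPos := inj_snd R.phiInjPos
  phiInjNeg := inj_snd R.phiInjNeg

theorem mem_map0 {s : Finset Torus} {t y : 𝕊} : (t, y) ∈ s.map rfl0 ↔ (-t, y) ∈ s := by
  rw [Finset.mem_map]
  constructor
  · rintro ⟨⟨a, b⟩, h, e⟩
    rw [rfl0_apply] at e
    simp only [Prod.mk.injEq] at e
    obtain ⟨rfl, rfl⟩ := e
    simpa using h
  · intro h
    exact ⟨_, h, by simp [rfl0_apply]⟩

theorem rf_pos {R : RectDiagram} {t y : 𝕊} : (t, y) ∈ (rf R).pos ↔ (-t, y) ∈ R.pos := mem_map0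
theorem rf_neg {R : RectDiagram} {t y : 𝕊} : (t, y) ∈ (rf R).neg ↔ (-t, y) ∈ R.neg := mem_map0
theorem rf_verts {R : RectDiagram} {t y : 𝕊} : (t, y) ∈ (rf R).verts ↔ (-t, y) ∈ R.verts := by
  rw [mem_verts, mem_verts, rf_pos, rf_neg]

theorem rf_card (R : RectDiagram) : (rf R).verts.card = R.verts.card := by
  have : (rf R).verts = R.verts.map rfl0 := by
    unfold RectDiagram.verts
    rw [Finset.map_union]; rfl
  rw [this, Finset.card_map]

theorem sw_verts (R : RectDiagram) : (sw R).verts = R.verts := Finset.union_comm _ _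

theorem rfext {R R' : RectDiagram} (h : R.pos = R'.pos) (h' : R.neg = R'.neg) : R = R' := by
  cases R; cases R'; simp only at h h'; subst h; subst h'; rfl

theorem sw_sw (R : RectDiagram) : sw (sw R) = R := rfl

theorem rf_rf (R : RectDiagram) : rf (rf R) = R := by
  refine rfext ?_ ?_
  · ext ⟨t, y⟩; rw [rf_pos, rf_pos, neg_neg]
  · ext ⟨t, y⟩; rw [rf_neg, rf_neg, neg_neg]

theorem arc_neg {a b x : 𝕊} : x ∈ closedArc (-b) (-a) ↔ -x ∈ closedArc a b := by
  have e1 : x - -b = b - -x := by abel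
  have e2 : -a - -b = b - a := by abel
  show toIco (x - -b) ≤ toIco (-a - -b) ↔ toIco (-x - a) ≤ toIco (b - a)
  rw [e1, e2]
  generalize -x = s
  have h1 := toIco_mem a
  have h2 := toIco_mem b
  have h3 := toIco_mem s
  simp only [mem_Ico] at h1 h2 h3
  simp only [toIco_sub]
  split_ifs <;> grind

theorem EM.sw {R R' : RectDiagram} {t1 t2 y1 y2 : 𝕊} (h : EM R R' t1 t2 y1 y2) :
    EM (sw R) (sw R') t1 t2 y1 y2 := by
  unfold EM at *
  simp only [sw_verts]
  refine ⟨h.1, h.2.1, h.2.2.1, h.2.2.2.1, h.2.2.2.2.1, h.2.2.2.2.2.1, ?_, h.2.2.2.2.2.2.2⟩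
  intro t y hh
  obtain ⟨k1, k2, k3⟩ := h.2.2.2.2.2.2.1 t y hh
  exact ⟨k2, k1, k3⟩

theorem EM.rf {R R' : RectDiagram} {t1 t2 y1 y2 : 𝕊} (h : EM R R' t1 t2 y1 y2) :
    EM (rf R) (rf R') (-t2) (-t1) y1 y2 := by
  obtain ⟨h1, h2, h3, h4, h5, h6, h7, h8⟩ := h
  unfold EM
  simp only [rf_verts, neg_neg, rf_pos, rf_neg, arc_neg]
  refine ⟨fun e => h1 (neg_injective e).symm, h2, h4, h3, h6, h5, ?_, ?_⟩
  · intro t y hh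
    refine h7 (-t) y ?_
    rintro ⟨a | a, b⟩
    · exact hh ⟨.inr (by rw [← a, neg_neg]), b⟩
    · exact hh ⟨.inl (by rw [← a, neg_neg]), b⟩
  · unfold Consec at *
    grind

/-- Type change under `sw`. -/
def swT : OType → OType
  | .rI => .lI
  | .lI => .rI
  | .rII => .lII
  | .lII => .rII

/-- Type change under `rf`. -/
def rfT : OType → OType
  | .rI => .lII
  | .lI => .rII
  | .rII => .lI
  | .lII => .rI

theorem std_sw {R R' : RectDiagram} {t1 t2 y1 y2 : 𝕊} {T : OType} (h : StabTypeData R R' t1 t2 y1 y2 T) :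
    StabTypeData (sw R) (sw R') t1 t2 y1 y2 (swT T) := by
  obtain ⟨v, hv, y0, hy, k1, k2, k3⟩ := h
  refine ⟨v, by rwa [sw_verts], y0, hy, by rwa [sw_verts], by rwa [sw_verts], ?_⟩
  cases T <;> exact k3

theorem std_rf {R R' : RectDiagram} {t1 t2 y1 y2 : 𝕊} {T : OType} (ht : t1 ≠ t2)
    (h : StabTypeData R R' t1 t2 y1 y2 T) :
    StabTypeData (rf R) (rf R') (-t2) (-t1) y1 y2 (rfT T) := by
  obtain ⟨⟨a, b⟩, hv, y0, hy, k1, k2, k3⟩ := h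
  have n1 : (t2, y0) ∈ R'.pos → (t1, y0) ∈ R'.neg := by
    intro h
    rcases (mem_verts R').1 k1 with h' | h'
    · exact absurd (congrArg Prod.fst (row_pos R' h h' rfl)).symm ht
    · exact h'
  have n2 : (t2, y0) ∈ R'.neg → (t1, y0) ∈ R'.pos := by
    intro h
    rcases (mem_verts R').1 k1 with h' | h'
    · exact h'
    · exact absurd (congrArg Prod.fst (row_neg R' h h' rfl)).symm ht
  refine ⟨(-a, b), ?_, y0, hy, by rwa [rf_verts, neg_neg], by rwa [rf_verts, neg_neg], ?_⟩
  · simp only [mem_inter_iff, mem_prod, Finset.mem_coe] at hv ⊢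
    rw [rf_verts, arc_neg, neg_neg]
    exact hv
  · cases T <;> simp only [rfT, rf_pos, rf_neg, neg_neg, Prod.mk.injEq, neg_inj] at k3 ⊢ <;> tauto

theorem stab_sw {R R' : RectDiagram} {T : OType} (h : StabOfType R R' T) :
    StabOfType (sw R) (sw R') (swT T) := by
  obtain ⟨t1, t2, y1, y2, h1, h2, h3⟩ := h
  exact ⟨t1, t2, y1, y2, elem_iff.2 (elem_iff.1 h1).sw, by rw [sw_verts, sw_verts, h2], std_sw h3⟩

theorem stab_rf {R R' : RectDiagram} {T : OType} (h : StabOfType R R' T) :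
    StabOfType (rf R) (rf R') (rfT T) := by
  obtain ⟨t1, t2, y1, y2, h1, h2, h3⟩ := h
  exact ⟨-t2, -t1, y1, y2, elem_iff.2 (elem_iff.1 h1).rf, by rw [rf_card, rf_card, h2], std_rf h1.1 h3⟩

theorem equiv_sw {R R' : RectDiagram} {T : OType} (h : EquivOfType T R R') :
    EquivOfType (swT T) (sw R) (sw R') := by
  refine Relation.ReflTransGen.lift sw ?_ _ _ h
  rintro R R' (⟨⟨t1, t2, y1, y2, h⟩, hc⟩ | h | h)
  · exact .inl ⟨⟨t1, t2, y1, y2, elem_iff.2 (elem_iff.1 h).sw⟩, by rw [sw_verts, sw_verts, hc]⟩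
  · exact .inr (.inl (stab_sw h))
  · exact .inr (.inr (destab_iff.2 (stab_sw (destab_iff.1 h))))

theorem equiv_rf {R R' : RectDiagram} {T : OType} (h : EquivOfType T R R') :
    EquivOfType (rfT T) (rf R) (rf R') := by
  refine Relation.ReflTransGen.lift rf ?_ _ _ h
  rintro R R' (⟨⟨t1, t2, y1, y2, h⟩, hc⟩ | h | h)
  · exact .inl ⟨⟨-t2, -t1, y1, y2, elem_iff.2 (elem_iff.1 h).rf⟩, by rw [rf_card, rf_card, hc]⟩
  · exact .inr (.inl (stab_rf h))
  · exact .inr (.inr (destab_iff.2 (stab_rf (destab_iff.1 h))))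

theorem equiv_sw_iff {R R' : RectDiagram} {T : OType} :
    EquivOfType T R R' ↔ EquivOfType (swT T) (sw R) (sw R') := by
  refine ⟨equiv_sw, fun h => ?_⟩
  have := equiv_sw h
  rw [sw_sw, sw_sw] at this
  cases T <;> exact this

theorem equiv_rf_iff {R R' : RectDiagram} {T : OType} :
    EquivOfType T R R' ↔ EquivOfType (rfT T) (rf R) (rf R') := by
  refine ⟨equiv_rf, fun h => ?_⟩
  have := equiv_rf h
  rw [rf_rf, rf_rf] at this
  cases T <;> exact this

/-- Switching the signs of an encoding. -/
def swL (L : List ((ℕ × ℕ) × Bool)) : List ((ℕ × ℕ) × Bool) := L.map (fun e => (e.1, !e.2))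

/-- The largest first coordinate. -/
def MX (L : List ((ℕ × ℕ) × Bool)) : ℕ := L.foldr (fun e n => max e.1.1 n) 0

/-- Reflecting an encoding. -/
def rfL (L : List ((ℕ × ℕ) × Bool)) : List ((ℕ × ℕ) × Bool) := L.map (fun e => ((MX L - e.1.1, e.1.2), e.2))

theorem le_MX {L : List ((ℕ × ℕ) × Bool)} : ∀ {e}, e ∈ L → e.1.1 ≤ MX L := by
  induction L with
  | nil => intro e h; simp at h
  | cons a L ih =>
    intro e h
    rcases List.mem_cons.1 h with rfl | h
    · exact le_max_left _ _
    · exact (ih h).trans (le_max_right _ _)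

theorem MX_lt {L : List ((ℕ × ℕ) × Bool)} {N : ℕ} (hN : 0 < N) (h : ∀ e ∈ L, e.1.1 < N) : MX L < N := by
  induction L with
  | nil => exact hN
  | cons a L ih =>
    exact max_lt (h a (by simp)) (ih (fun e he => h e (by simp [he])))

theorem realB_sw {L : List ((ℕ × ℕ) × Bool)} {R : RectDiagram} {β : 𝕊} {N : ℕ} (h : RealB β L R N) :
    RealB β (swL L) (sw R) N := by
  obtain ⟨h1, h2, h3⟩ := h
  refine ⟨?_, ?_, ?_⟩
  · intro e he
    simp only [swL, List.mem_map] at he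
    obtain ⟨f, hf, rfl⟩ := he
    exact h1 f hf
  · intro p
    refine (h3 p).trans ?_
    simp [swL]
  · intro p
    refine (h2 p).trans ?_
    simp [swL]

theorem grid_refl {N M x : ℕ} (h : x ≤ M) :
    gridPt N (M - x) + -gridPt N M = -gridPt N x := by
  unfold gridPt
  rw [← AddCircle.coe_neg, ← AddCircle.coe_neg, ← AddCircle.coe_add]
  congr 1
  rw [Nat.cast_sub h]
  ring

theorem realB_rf {L : List ((ℕ × ℕ) × Bool)} {R : RectDiagram} {N : ℕ} (h : RealB 0 L R N) :
    ∃ β, RealB β (rfL L) (rf R) N := by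
  have hN := (realizes_rep h).1
  obtain ⟨h1, h2, h3⟩ := h
  have hM := MX_lt hN (fun e he => (h1 e he).1)
  have key : ∀ (b : Bool) (s : Finset Torus),
      (∀ p, p ∈ s ↔ ∃ e ∈ L, e.2 = b ∧ p = (gridPt N e.1.1 + 0, gridPt N e.1.2)) →
      ∀ p, p ∈ s.map rfl0 ↔ ∃ e ∈ rfL L, e.2 = b ∧
        p = (gridPt N e.1.1 + -gridPt N (MX L), gridPt N e.1.2) := by
    rintro b s hs ⟨t, y⟩
    rw [mem_map0, hs]
    constructor
    · rintro ⟨e, he, e1, e2⟩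
      refine ⟨_, List.mem_map.2 ⟨e, he, rfl⟩, e1, ?_⟩
      simp only [Prod.mk.injEq, add_zero] at e2 ⊢
      rw [grid_refl (le_MX he), ← e2.1, neg_neg]
      exact ⟨rfl, e2.2⟩
    · rintro ⟨f, hf, e1, e2⟩
      obtain ⟨e, he, rfl⟩ := List.mem_map.1 hf
      refine ⟨e, he, e1, ?_⟩
      simp only [Prod.mk.injEq, add_zero] at e2 ⊢
      rw [grid_refl (le_MX he)] at e2
      rw [e2.1, neg_neg]
      exact ⟨rfl, e2.2⟩
  refine ⟨-gridPt N (MX L), ?_, key true _ h2, key false _ h3⟩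
  intro e he
  simp only [rfL, List.mem_map] at he
  obtain ⟨f, hf, rfl⟩ := he
  have := h1 f hf
  exact ⟨by dsimp only; omega, this.2⟩

/-- The transformation of encodings for a type. -/
def trL : OType → List ((ℕ × ℕ) × Bool) → List ((ℕ × ℕ) × Bool)
  | .rII => id
  | .lII => swL
  | .lI => rfL
  | .rI => fun L => swL (rfL L)

theorem main_T (T : OType) {L L' : List ((ℕ × ℕ) × Bool)} {R R' : RectDiagram}
    (h : Realizes L R) (h' : Realizes L' R') :
    EquivOfType T R R' ↔ CH (Iio (NN (trL T L) (trL T L'))) (BB (trL T L) (trL T L'))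
      (jl (trL T L)) (jl (trL T L')) := by
  obtain ⟨N, h⟩ := realB_of h
  obtain ⟨N', h'⟩ := realB_of h'
  obtain ⟨β, k⟩ := realB_rf h
  obtain ⟨β', k'⟩ := realB_rf h'
  cases T
  · rw [equiv_rf_iff, equiv_sw_iff]
    exact main_rII (realB_sw k) (realB_sw k')
  · rw [equiv_rf_iff]
    exact main_rII k k'
  · exact main_rII h h'
  · rw [equiv_sw_iff]
    exact main_rII (realB_sw h) (realB_sw h')

end Q
end RD

namespace RD
section P
variable {γ δ : Type*} [Primcodable γ] [Primcodable δ]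

theorem pr_ex {f : γ → List δ} {P : γ → δ → Prop} (hf : Primrec f)
    (hP : PrimrecPred (fun q : γ × δ => P q.1 q.2)) : PrimrecPred (fun x => ∃ a ∈ f x, P x a) := by
  have h : PrimrecRel (fun (a : δ) (x : γ) => P x a) :=
    PrimrecPred.comp (p := fun q : γ × δ => P q.1 q.2) hP (Primrec.snd.pair Primrec.fst)
  exact h.exists_mem_list.comp hf Primrec.id

theorem pr_all {f : γ → List δ} {P : γ → δ → Prop} (hf : Primrec f)
    (hP : PrimrecPred (fun q : γ × δ => P q.1 q.2)) : PrimrecPred (fun x => ∀ a ∈ f x, P x a) := by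
  have h : PrimrecRel (fun (a : δ) (x : γ) => P x a) :=
    PrimrecPred.comp (p := fun q : γ × δ => P q.1 q.2) hP (Primrec.snd.pair Primrec.fst)
  exact h.forall_mem_list.comp hf Primrec.id

open Classical in
theorem pr_filter {f : γ → List δ} {P : γ → δ → Prop} (hf : Primrec f)
    (hP : PrimrecPred (fun q : γ × δ => P q.1 q.2)) :
    Primrec (fun x => (f x).filter (fun a => P x a)) := by
  have h : PrimrecRel (fun (a : δ) (x : γ) => P x a) :=
    PrimrecPred.comp (p := fun q : γ × δ => P q.1 q.2) hP (Primrec.snd.pair Primrec.fst)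
  exact h.listFilter.comp hf Primrec.id

theorem pr_eq {f g : γ → δ} (hf : Primrec f) (hg : Primrec g) : PrimrecPred (fun x => f x = g x) :=
  Primrec.eq.comp hf hg

theorem pr_lt {f g : γ → ℕ} (hf : Primrec f) (hg : Primrec g) : PrimrecPred (fun x => f x < g x) :=
  Primrec.nat_lt.comp hf hg

theorem pr_iff {p q : γ → Prop} (hp : PrimrecPred p) (hq : PrimrecPred q) :
    PrimrecPred (fun x => p x ↔ q x) :=
  ((hp.and hq).or (hp.not.and hq.not)).of_eq (fun x => by tauto)

theorem pr_cons {f : γ → δ} {g : γ → List δ} (hf : Primrec f) (hg : Primrec g) :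
    Primrec (fun x => f x :: g x) := Primrec.list_cons.comp hf hg

theorem pr_app {f : γ → List δ} {g : γ → List δ} (hf : Primrec f) (hg : Primrec g) :
    Primrec (fun x => f x ++ g x) := Primrec.list_append.comp hf hg

theorem pr_take {f : γ → ℕ} {g : γ → List δ} (hf : Primrec f) (hg : Primrec g) :
    Primrec (fun x => (g x).take (f x)) := Primrec.list_take.comp hf hg

theorem pr_drop {f : γ → ℕ} {g : γ → List δ} (hf : Primrec f) (hg : Primrec g) :
    Primrec (fun x => (g x).drop (f x)) := Primrec.list_drop.comp hf hg

theorem pr_add {f g : γ → ℕ} (hf : Primrec f) (hg : Primrec g) : Primrec (fun x => f x + g x) :=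
  Primrec.nat_add.comp hf hg

theorem pr_mul {f g : γ → ℕ} (hf : Primrec f) (hg : Primrec g) : Primrec (fun x => f x * g x) :=
  Primrec.nat_mul.comp hf hg

theorem pr_open {a b x : γ → ℕ} (ha : Primrec a) (hb : Primrec b) (hx : Primrec x) :
    PrimrecPred (fun q => InOpen (a q) (b q) (x q)) :=
  ((pr_lt ha hx).and (pr_lt hx hb)).or ((pr_lt hb ha).and ((pr_lt ha hx).or (pr_lt hx hb)))

theorem pr_closed {a b x : γ → ℕ} (ha : Primrec a) (hb : Primrec b) (hx : Primrec x) :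
    PrimrecPred (fun q => InClosed (a q) (b q) (x q)) :=
  (pr_open ha hb hx).or ((pr_eq hx ha).or (pr_eq hx hb))

theorem pr_unl {x y : γ → ℕ × ℕ} (hx : Primrec x) (hy : Primrec y) :
    PrimrecPred (fun q => Unlinked (x q) (y q)) := by
  have x1 := Primrec.fst.comp hx
  have x2 := Primrec.snd.comp hx
  have y1 := Primrec.fst.comp hy
  have y2 := Primrec.snd.comp hy
  exact (pr_eq y1 x1).not.and ((pr_eq y1 x2).not.and ((pr_eq y2 x1).not.and ((pr_eq y2 x2).not.and
    (pr_iff (pr_open x1 x2 y1) (pr_open x1 x2 y2)))))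

theorem valid_iff {α : Type*} [LinearOrder α] {σ : List (α × α)} : Valid σ ↔
    (∀ i ∈ List.range σ.length, ∀ j ∈ List.range i, (fsts σ)[i]? ≠ (fsts σ)[j]?) ∧
    (∀ e ∈ σ, ∃ f ∈ σ, f.2 = e.1) ∧ ∀ e ∈ σ, e.1 ≠ e.2 := by
  unfold Valid
  have hl : (fsts σ).length = (snds σ).length := by simp [fsts, snds]
  have hl' : (fsts σ).length = σ.length := by simp [fsts]
  have n : (fsts σ).Nodup ↔
      (∀ i ∈ List.range σ.length, ∀ j ∈ List.range i, (fsts σ)[i]? ≠ (fsts σ)[j]?) := by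
    rw [List.nodup_iff_getElem?_ne_getElem?]
    simp only [List.mem_range]
    constructor
    · intro h i hi j hj
      exact (h j i hj (by omega)).symm
    · intro h i j hij hj
      exact (h j (by omega) i hij).symm
  rw [n]
  refine and_congr_right (fun h => and_congr_left (fun _ => ?_))
  rw [← n] at h
  constructor
  · intro hp e he
    have : e.1 ∈ snds σ := hp.mem_iff.1 (List.mem_map.2 ⟨e, he, rfl⟩)
    simpa [snds] using List.mem_map.1 this
  · intro hh
    refine (List.subperm_of_subset h ?_).perm_of_length_le hl.ge
    intro x hx
    obtain ⟨e, he, rfl⟩ := List.mem_map.1 hx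
    obtain ⟨f, hf, h⟩ := hh e he
    exact List.mem_map.2 ⟨f, hf, h⟩

theorem pr_fsts {s : γ → List (ℕ × ℕ)} (hs : Primrec s) : Primrec (fun q => fsts (s q)) :=
  Primrec.list_map hs (Primrec.fst.comp Primrec.snd).to₂

theorem pr_getE {s : γ → List δ} {i : γ → ℕ} (hs : Primrec s) (hi : Primrec i) :
    Primrec (fun q => (s q)[i q]?) := Primrec.list_getElem?.comp hs hi

theorem pr_valid {s : γ → List (ℕ × ℕ)} (hs : Primrec s) : PrimrecPred (fun q => Valid (s q)) := by
  refine PrimrecPred.of_eq ?_ (fun q => valid_iff.symm)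
  refine PrimrecPred.and ?_ (PrimrecPred.and ?_ ?_)
  · refine pr_all (Primrec.list_range.comp (Primrec.list_length.comp hs)) ?_
    refine pr_all (Primrec.list_range.comp Primrec.snd) ?_
    have hf := (pr_fsts hs).comp (Primrec.fst.comp (Primrec.fst (α := γ × ℕ) (β := ℕ)))
    exact (pr_eq (pr_getE hf (Primrec.snd.comp Primrec.fst)) (pr_getE hf Primrec.snd)).not
  · refine pr_all hs ?_
    refine pr_ex (hs.comp Primrec.fst) ?_
    exact pr_eq (Primrec.snd.comp Primrec.snd) (Primrec.fst.comp (Primrec.snd.comp Primrec.fst))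
  · exact pr_all hs (pr_eq (Primrec.fst.comp Primrec.snd) (Primrec.snd.comp Primrec.snd)).not

end P

section S
variable {α : Type*} [LinearOrder α]

theorem step0_iff {σ τ : List (α × α)} : Step0 σ τ ↔
    (∃ i ∈ List.range (σ.length + 1), ∃ x ∈ σ, ∃ y ∈ σ, Unlinked x y ∧
      σ = σ.take i ++ x :: y :: σ.drop (i + 2) ∧ τ = σ.take i ++ y :: x :: σ.drop (i + 2)) ∨
    (∃ i ∈ List.range (σ.length + 1), ∃ x ∈ σ, ∃ y ∈ σ, (InOpen x.1 y.2 x.2 ∧ y.1 = x.2) ∧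
      σ = σ.take i ++ x :: y :: σ.drop (i + 2) ∧ τ = σ.take i ++ (x.1, y.2) :: σ.drop (i + 2)) ∨
    (∃ x ∈ σ, σ = x :: σ.drop 1 ∧ τ = σ.drop 1 ++ [x]) ∨
    (∃ i ∈ List.range (σ.length + 1), ∃ x ∈ σ, ∃ y ∈ σ, ∃ z ∈ τ,
      (y.2 = x.1 ∧ (∀ e ∈ (σ.drop 1).take i, ¬ InClosed x.1 z.1 e.1 ∧ ¬ InClosed x.1 z.1 e.2) ∧
        ¬ InClosed x.1 z.1 y.1 ∧ ¬ InClosed x.1 z.1 x.2) ∧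
      σ = x :: ((σ.drop 1).take i ++ y :: σ.drop (i + 2)) ∧
      τ = (z.1, x.2) :: ((σ.drop 1).take i ++ (y.1, z.1) :: σ.drop (i + 2))) := by
  constructor
  · rintro (⟨_, _, ⟨u, v, x, y, h⟩ | ⟨u, v, a, h, b, hh⟩⟩ | ⟨x, v⟩ | ⟨h, h', a, b, u, v, hu, ha, hb⟩)
    · refine .inl ⟨u.length, by simp, x, by simp, y, by simp, h, ?_, ?_⟩ <;>
        simp [List.drop_append]
    · refine .inr (.inl ⟨u.length, by simp, (a, h), by simp, (h, b), by simp, ⟨hh, rfl⟩, ?_, ?_⟩) <;>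
        simp [List.drop_append]
    · exact .inr (.inr (.inl ⟨x, by simp, by simp, by simp⟩))
    · refine .inr (.inr (.inr ⟨u.length, by simp; omega, (h, b), by simp, (a, h), by simp,
        (h', b), by simp, ⟨rfl, ?_, ha, hb⟩, ?_, ?_⟩))
      · intro e he
        exact hu e (by simpa using he)
      · simp [List.drop_append]
      · simp [List.drop_append]
  · rintro (⟨i, _, x, _, y, _, h, h1, h2⟩ | ⟨i, _, ⟨a, h⟩, _, ⟨h0, b⟩, _, ⟨hh, h3⟩, h1, h2⟩ |
      ⟨x, _, h1, h2⟩ | ⟨i, _, ⟨h, b⟩, _, ⟨a, h0⟩, _, ⟨h', b'⟩, _, ⟨h3, hu, ha, hb⟩, h1, h2⟩)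
    · have := Step0.red _ _ (Red1.swap (σ.take i) (σ.drop (i + 2)) x y h)
      rwa [← h1, ← h2] at this
    · simp only at h3 hh
      subst h3
      have := Step0.red _ _ (Red1.merge (σ.take i) (σ.drop (i + 2)) a h0 b hh)
      rwa [← h1, ← h2] at this
    · have := Step0.rot x (σ.drop 1)
      rwa [← h1, ← h2] at this
    · simp only at h3 hu ha hb h2
      subst h3
      have := Step0.bigex h0 h' a b ((σ.drop 1).take i) (σ.drop (i + 2)) hu ha hb
      rwa [← h1, ← h2] at this

end S

section P
variable {γ δ : Type*} [Primcodable γ] [Primcodable δ]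

theorem pr_step0 : PrimrecPred (fun q : List (ℕ × ℕ) × List (ℕ × ℕ) => Step0 q.1 q.2) := by
  refine PrimrecPred.of_eq ?_ (fun q => step0_iff.symm)
  have rg : Primrec (fun q : List (ℕ × ℕ) × List (ℕ × ℕ) => List.range (q.1.length + 1)) :=
    Primrec.list_range.comp (pr_add (Primrec.list_length.comp Primrec.fst) (Primrec.const 1))
  have c1 : Primrec (fun q : (((List (ℕ × ℕ) × List (ℕ × ℕ)) × ℕ) × (ℕ × ℕ)) × (ℕ × ℕ) => q.1.1.1.1) :=
    Primrec.fst.comp (Primrec.fst.comp (Primrec.fst.comp Primrec.fst))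
  have c2 : Primrec (fun q : (((List (ℕ × ℕ) × List (ℕ × ℕ)) × ℕ) × (ℕ × ℕ)) × (ℕ × ℕ) => q.1.1.1.2) :=
    Primrec.snd.comp (Primrec.fst.comp (Primrec.fst.comp Primrec.fst))
  have ci : Primrec (fun q : (((List (ℕ × ℕ) × List (ℕ × ℕ)) × ℕ) × (ℕ × ℕ)) × (ℕ × ℕ) => q.1.1.2) :=
    Primrec.snd.comp (Primrec.fst.comp Primrec.fst)
  have cx : Primrec (fun q : (((List (ℕ × ℕ) × List (ℕ × ℕ)) × ℕ) × (ℕ × ℕ)) × (ℕ × ℕ) => q.1.2) :=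
    Primrec.snd.comp Primrec.fst
  have cy : Primrec (fun q : (((List (ℕ × ℕ) × List (ℕ × ℕ)) × ℕ) × (ℕ × ℕ)) × (ℕ × ℕ) => q.2) :=
    Primrec.snd
  have s1 : Primrec (fun q : (List (ℕ × ℕ) × List (ℕ × ℕ)) × ℕ => q.1.1) := Primrec.fst.comp Primrec.fst
  have s2 : Primrec (fun q : ((List (ℕ × ℕ) × List (ℕ × ℕ)) × ℕ) × (ℕ × ℕ) => q.1.1.1) :=
    Primrec.fst.comp (Primrec.fst.comp Primrec.fst)
  have ct := pr_take ci c1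
  have cd := pr_drop (pr_add ci (Primrec.const 2)) c1
  have ce := pr_eq c1 (pr_app ct (pr_cons cx (pr_cons cy cd)))
  refine PrimrecPred.or ?_ (PrimrecPred.or ?_ (PrimrecPred.or ?_ ?_))
  · refine pr_ex rg (pr_ex s1 (pr_ex s2 ?_))
    exact (pr_unl cx cy).and (ce.and (pr_eq c2 (pr_app ct (pr_cons cy (pr_cons cx cd)))))
  · refine pr_ex rg (pr_ex s1 (pr_ex s2 ?_))
    have x1 := Primrec.fst.comp cx
    have x2 := Primrec.snd.comp cx
    have y1 := Primrec.fst.comp cy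
    have y2 := Primrec.snd.comp cy
    exact ((pr_open x1 y2 x2).and (pr_eq y1 x2)).and
      (ce.and (pr_eq c2 (pr_app ct (pr_cons (x1.pair y2) cd))))
  · refine pr_ex Primrec.fst ?_
    have d1 : Primrec (fun q : (List (ℕ × ℕ) × List (ℕ × ℕ)) × (ℕ × ℕ) => q.1.1) :=
      Primrec.fst.comp Primrec.fst
    have d2 : Primrec (fun q : (List (ℕ × ℕ) × List (ℕ × ℕ)) × (ℕ × ℕ) => q.1.2) :=
      Primrec.snd.comp Primrec.fst
    have dd := pr_drop (Primrec.const 1) d1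
    exact (pr_eq d1 (pr_cons Primrec.snd dd)).and
      (pr_eq d2 (pr_app dd (pr_cons Primrec.snd (Primrec.const []))))
  · refine pr_ex rg (pr_ex s1 (pr_ex s2 (pr_ex c2 ?_)))
    have f0 : Primrec (Prod.fst : ((((List (ℕ × ℕ) × List (ℕ × ℕ)) × ℕ) × (ℕ × ℕ)) × (ℕ × ℕ)) × (ℕ × ℕ) → _) :=
      Primrec.fst
    have e1 := c1.comp f0
    have e2 := c2.comp f0
    have x1 := Primrec.fst.comp (cx.comp f0)
    have x2 := Primrec.snd.comp (cx.comp f0)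
    have y1 := Primrec.fst.comp (cy.comp f0)
    have y2 := Primrec.snd.comp (cy.comp f0)
    have z1 : Primrec (fun q : ((((List (ℕ × ℕ) × List (ℕ × ℕ)) × ℕ) × (ℕ × ℕ)) × (ℕ × ℕ)) × (ℕ × ℕ) => q.2.1) :=
      Primrec.fst.comp Primrec.snd
    have u := pr_take (ci.comp f0) (pr_drop (Primrec.const 1) e1)
    have d := cd.comp f0
    refine PrimrecPred.and (PrimrecPred.and (pr_eq y2 x1) (PrimrecPred.and ?_
      ((pr_closed x1 z1 y1).not.and (pr_closed x1 z1 x2).not))) (PrimrecPred.and ?_ ?_)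
    · refine pr_all u ?_
      exact (pr_closed (x1.comp Primrec.fst) (z1.comp Primrec.fst) (Primrec.fst.comp Primrec.snd)).not.and
        (pr_closed (x1.comp Primrec.fst) (z1.comp Primrec.fst) (Primrec.snd.comp Primrec.snd)).not
    · exact pr_eq e1 (pr_cons (cx.comp f0) (pr_app u (pr_cons (cy.comp f0) d)))
    · exact pr_eq e2 (pr_cons (z1.pair x2) (pr_app u (pr_cons (y1.pair z1) d)))

theorem pr_lstep {f g : γ → List (ℕ × ℕ)} (hf : Primrec f) (hg : Primrec g) :
    PrimrecPred (fun q => LStep (f q) (g q)) :=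
  (pr_valid hf).and ((pr_valid hg).and
    ((pr_step0.comp (hf.pair hg)).or (pr_step0.comp (hg.pair hf))))

end P
end RD

namespace RD
section P
variable {γ δ : Type*} [Primcodable γ] [Primcodable δ]

/-- All pairs of heights below `N`. -/
def prs (N : ℕ) : List (ℕ × ℕ) := (List.range N).flatMap fun a => (List.range N).map fun b => (a, b)

theorem mem_prs {N : ℕ} {e : ℕ × ℕ} : e ∈ prs N ↔ e.1 < N ∧ e.2 < N := by
  obtain ⟨a, b⟩ := e
  simp [prs]

theorem pr_prs : Primrec prs := by
  refine Primrec.list_flatMap Primrec.list_range ?_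
  refine Primrec.list_map (Primrec.list_range.comp Primrec.fst) ?_
  exact (Primrec.snd.comp Primrec.fst).pair Primrec.snd

/-- All lists of jumps of bounded length and height. -/
def VV (N B : ℕ) : List (List (ℕ × ℕ)) :=
  Nat.rec [[]] (fun _ l => [] :: l.flatMap fun s => (prs N).map fun e => e :: s) B

theorem mem_VV {N B : ℕ} : ∀ {s : List (ℕ × ℕ)}, s ∈ VV N B ↔ s.length ≤ B ∧ HIn (Iio N) s := by
  induction B with
  | zero =>
    intro s
    have : VV N 0 = [[]] := rfl
    rw [this]
    cases s with
    | nil => simp [HIn]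
    | cons a s => simp
  | succ B ih =>
    intro s
    have : VV N (B + 1) = [] :: (VV N B).flatMap fun s => (prs N).map fun e => e :: s := rfl
    rw [this]
    cases s with
    | nil => simp [HIn]
    | cons a s =>
      simp only [List.mem_cons, List.mem_flatMap, List.mem_map, mem_prs, reduceCtorEq, false_or,
        List.cons.injEq, List.length_cons, Nat.add_le_add_iff_right]
      constructor
      · rintro ⟨s', h1, e, h2, rfl, rfl⟩
        rw [ih] at h1
        refine ⟨h1.1, ?_⟩
        intro f hf
        rcases List.mem_cons.1 hf with rfl | hf
        · exact h2
        · exact h1.2 f hf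
      · rintro ⟨h1, h2⟩
        refine ⟨s, ih.2 ⟨h1, fun f hf => h2 f (by simp [hf])⟩, a, h2 a (by simp), rfl, rfl⟩

theorem pr_VV {N B : γ → ℕ} (hN : Primrec N) (hB : Primrec B) : Primrec (fun q => VV (N q) (B q)) := by
  refine Primrec.nat_rec' (h := fun q p => [] :: p.2.flatMap fun s => (prs (N q)).map fun e => e :: s)
    hB (Primrec.const [[]]) ?_
  refine pr_cons (Primrec.const []) ?_
  refine Primrec.list_flatMap (Primrec.snd.comp Primrec.snd) ?_
  refine Primrec.list_map (pr_prs.comp (hN.comp (Primrec.fst.comp Primrec.fst))) ?_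
  exact pr_cons Primrec.snd (Primrec.snd.comp Primrec.fst)

open Classical in
/-- The lists reachable in `k` steps. -/
def SS (V : List (List (ℕ × ℕ))) (σ : List (ℕ × ℕ)) (k : ℕ) : List (List (ℕ × ℕ)) :=
  Nat.rec [σ] (fun _ s => V.filter fun b => ∃ a ∈ s, a = b ∨ LStep a b) k

theorem SS_succ {V : List (List (ℕ × ℕ))} {σ : List (ℕ × ℕ)} {k : ℕ} {b : List (ℕ × ℕ)} :
    b ∈ SS V σ (k + 1) ↔ b ∈ V ∧ ∃ a ∈ SS V σ k, a = b ∨ LStep a b := by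
  classical
  have : SS V σ (k + 1) = V.filter fun b => ∃ a ∈ SS V σ k, a = b ∨ LStep a b := rfl
  rw [this, List.mem_filter, decide_eq_true_eq]

theorem pr_filter2 {δ : Type} [Primcodable δ] {f : γ → List δ} {P : γ → δ → Prop} (hf : Primrec f)
    (hP : PrimrecPred (fun q : γ × δ => P q.1 q.2)) (b : γ → δ → Bool)
    (hb : ∀ x a, b x a = true ↔ P x a) :
    Primrec (fun x => (f x).filter (b x)) := by
  classical
  refine (pr_filter hf hP).of_eq ?_
  intro x
  refine congrArg (fun g => List.filter g (f x)) (funext fun a => ?_)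
  rw [Bool.eq_iff_iff, hb, decide_eq_true_eq]

theorem pr_SS {V : γ → List (List (ℕ × ℕ))} {σ : γ → List (ℕ × ℕ)} {k : γ → ℕ} (hV : Primrec V)
    (hσ : Primrec σ) (hk : Primrec k) : Primrec (fun q => SS (V q) (σ q) (k q)) := by
  classical
  refine Primrec.nat_rec' (h := fun q p => (V q).filter fun b => ∃ a ∈ p.2, a = b ∨ LStep a b)
    hk (pr_cons hσ (Primrec.const [])) ?_
  refine pr_filter2 (P := fun (q : γ × (ℕ × List (List (ℕ × ℕ)))) b => ∃ a ∈ q.2.2, a = b ∨ LStep a b)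
    (hV.comp Primrec.fst) ?_ _ (fun x a => decide_eq_true_iff)
  refine pr_ex (Primrec.snd.comp (Primrec.snd.comp Primrec.fst)) ?_
  exact (pr_eq Primrec.snd (Primrec.snd.comp Primrec.fst)).or
    (pr_lstep Primrec.snd (Primrec.snd.comp Primrec.fst))

theorem SS_reach {V : List (List (ℕ × ℕ))} {σ τ : List (ℕ × ℕ)} (hσ : σ ∈ V) :
    Relation.ReflTransGen (fun a b => LStep a b ∧ a ∈ V ∧ b ∈ V) σ τ ↔ τ ∈ SS V σ V.length := by
  classical
  have sub : ∀ k, ∀ x ∈ SS V σ k, x ∈ V := by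
    intro k x hx
    cases k with
    | zero =>
      have : x = σ := List.mem_singleton.1 hx
      rwa [this]
    | succ k => exact (SS_succ.1 hx).1
  have mono : ∀ k, ∀ x ∈ SS V σ k, x ∈ SS V σ (k + 1) := fun k x hx =>
    SS_succ.2 ⟨sub k x hx, x, hx, .inl rfl⟩
  have base : ∀ k, σ ∈ SS V σ k := by
    intro k
    induction k with
    | zero => exact List.mem_singleton.2 rfl
    | succ k ih => exact mono k _ ih
  have key : ∀ k, k + 1 ≤ (SS V σ k).toFinset.card ∨ ∀ x ∈ SS V σ (k + 1), x ∈ SS V σ k := by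
    intro k
    induction k with
    | zero =>
      left
      exact Finset.card_pos.2 ⟨σ, List.mem_toFinset.2 (base 0)⟩
    | succ k ih =>
      by_cases st : ∀ x ∈ SS V σ (k + 1), x ∈ SS V σ k
      · right
        intro x hx
        obtain ⟨h1, a, h2, h3⟩ := SS_succ.1 hx
        exact SS_succ.2 ⟨h1, a, st a h2, h3⟩
      · left
        have h := ih.resolve_right st
        push Not at st
        obtain ⟨x, h1, h2⟩ := st
        have : (SS V σ k).toFinset ⊂ (SS V σ (k + 1)).toFinset := by
          rw [Finset.ssubset_iff_of_subset]
          · exact ⟨x, List.mem_toFinset.2 h1, fun h => h2 (List.mem_toFinset.1 h)⟩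
          · intro y hy
            exact List.mem_toFinset.2 (mono k y (List.mem_toFinset.1 hy))
        have := Finset.card_lt_card this
        omega
  constructor
  · have st : ∀ x ∈ SS V σ (V.length + 1), x ∈ SS V σ V.length := by
      refine (key V.length).resolve_left ?_
      have h1 : (SS V σ V.length).toFinset ⊆ V.toFinset := fun y hy =>
        List.mem_toFinset.2 (sub _ y (List.mem_toFinset.1 hy))
      have h2 := Finset.card_le_card h1
      have h3 := V.toFinset_card_le
      omega
    intro h
    induction h with
    | refl => exact base _
    | tail _ hs ih => exact st _ (SS_succ.2 ⟨hs.2.2, _, ih, .inr hs.1⟩)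
  · have : ∀ k, ∀ x ∈ SS V σ k, Relation.ReflTransGen (fun a b => LStep a b ∧ a ∈ V ∧ b ∈ V) σ x := by
      intro k
      induction k with
      | zero =>
        intro x hx
        have : x = σ := List.mem_singleton.1 hx
        rw [this]
      | succ k ih =>
        intro x hx
        obtain ⟨h1, a, h2, rfl | h3⟩ := SS_succ.1 hx
        · exact ih a h2
        · exact (ih a h2).tail ⟨h3, sub k a h2, h1⟩
    exact this _ _

theorem CH_iff {N B : ℕ} {σ τ : List (ℕ × ℕ)} (h1 : σ.length ≤ B) (h2 : HIn (Iio N) σ) :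
    CH (Iio N) B σ τ ↔ ∃ x ∈ SS (VV N B) σ (VV N B).length, x = τ := by
  have := SS_reach (V := VV N B) (σ := σ) (τ := τ) (mem_VV.2 ⟨h1, h2⟩)
  simp only [mem_VV] at this
  rw [exists_eq_right, ← this]
  rfl

theorem pr_MM : Primrec MM := by
  have : Primrec (fun L : List ((ℕ × ℕ) × Bool) => L.foldr (fun e n => (e.1.1 + e.1.2 + 1) + n) 0) := by
    refine Primrec.list_foldr (h := fun _ (p : ((ℕ × ℕ) × Bool) × ℕ) => (p.1.1.1 + p.1.1.2 + 1) + p.2) Primrec.id (Primrec.const 0) ?_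
    have a : Primrec (fun q : List ((ℕ × ℕ) × Bool) × (((ℕ × ℕ) × Bool) × ℕ) => q.2.1.1) :=
      Primrec.fst.comp (Primrec.fst.comp Primrec.snd)
    exact pr_add (pr_add (pr_add (Primrec.fst.comp a) (Primrec.snd.comp a)) (Primrec.const 1))
      (Primrec.snd.comp Primrec.snd)
  refine this.of_eq ?_
  intro L
  unfold MM
  induction L with
  | nil => rfl
  | cons a L ih => simp [ih]

theorem pr_MX : Primrec MX := by
  refine Primrec.list_foldr (h := fun _ (p : ((ℕ × ℕ) × Bool) × ℕ) => max p.1.1.1 p.2) Primrec.id (Primrec.const 0) ?_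
  have a : Primrec (fun q : List ((ℕ × ℕ) × Bool) × (((ℕ × ℕ) × Bool) × ℕ) => q.2.1.1) :=
    Primrec.fst.comp (Primrec.fst.comp Primrec.snd)
  exact Primrec.nat_max.comp (Primrec.fst.comp a) (Primrec.snd.comp Primrec.snd)

theorem pr_swL : Primrec swL :=
  Primrec.list_map Primrec.id
    ((Primrec.fst.comp Primrec.snd).pair (Primrec.not.comp (Primrec.snd.comp Primrec.snd)))

theorem pr_rfL : Primrec rfL := by
  refine Primrec.list_map Primrec.id ?_
  have a : Primrec (fun q : List ((ℕ × ℕ) × Bool) × ((ℕ × ℕ) × Bool) => q.2.1) :=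
    Primrec.fst.comp Primrec.snd
  exact ((Primrec.nat_sub.comp (pr_MX.comp Primrec.fst) (Primrec.fst.comp a)).pair (Primrec.snd.comp a)).pair
    (Primrec.snd.comp Primrec.snd)

theorem pr_trL (T : OType) : Primrec (trL T) := by
  cases T
  · exact pr_swL.comp pr_rfL
  · exact pr_rfL
  · exact Primrec.id
  · exact pr_swL

theorem pr_triples : Primrec triples := by
  refine Primrec.list_flatMap Primrec.list_range ?_
  refine Primrec.list_flatMap (Primrec.list_range.comp Primrec.fst) ?_
  refine Primrec.list_map (Primrec.list_range.comp (Primrec.fst.comp Primrec.fst)) ?_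
  exact (Primrec.snd.comp (Primrec.fst.comp Primrec.fst)).pair
    ((Primrec.snd.comp Primrec.fst).pair Primrec.snd)

theorem pr_mem {f : γ → δ} {g : γ → List δ} (hf : Primrec f) (hg : Primrec g) :
    PrimrecPred (fun q => f q ∈ g q) := by
  refine PrimrecPred.of_eq (pr_ex (P := fun q a => a = f q) hg
    (pr_eq Primrec.snd (hf.comp Primrec.fst))) ?_
  intro q; simp

theorem pr_mvL : Primrec mvL := by
  refine pr_filter2 (P := fun (L : List ((ℕ × ℕ) × Bool)) e =>
    ((e.1, e.2.1), true) ∈ L ∧ ((e.1, e.2.2), false) ∈ L) (pr_triples.comp pr_MM) ?_ _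
    (fun x a => decide_eq_true_iff)
  have x : Primrec (fun q : List ((ℕ × ℕ) × Bool) × (ℕ × (ℕ × ℕ)) => q.2.1) :=
    Primrec.fst.comp Primrec.snd
  have a : Primrec (fun q : List ((ℕ × ℕ) × Bool) × (ℕ × (ℕ × ℕ)) => q.2.2.1) :=
    Primrec.fst.comp (Primrec.snd.comp Primrec.snd)
  have b : Primrec (fun q : List ((ℕ × ℕ) × Bool) × (ℕ × (ℕ × ℕ)) => q.2.2.2) :=
    Primrec.snd.comp (Primrec.snd.comp Primrec.snd)
  exact (pr_mem ((x.pair a).pair (Primrec.const true)) Primrec.fst).and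
    (pr_mem ((x.pair b).pair (Primrec.const false)) Primrec.fst)

theorem pr_jl : Primrec jl := Primrec.list_map pr_mvL (Primrec.snd.comp Primrec.snd)

theorem pr_bigB : Primrec bigB := by
  have i : Primrec (fun m : ℕ => m) := Primrec.id
  have i1 := pr_add i (Primrec.const 1)
  exact pr_add (pr_add (pr_add (pr_mul (Primrec.const 4) (pr_mul (pr_mul i i1) i1))
    (pr_mul (Primrec.const 2) i)) (Primrec.const 3)) i

theorem pr_BB {f g : γ → List ((ℕ × ℕ) × Bool)} (hf : Primrec f) (hg : Primrec g) :
    Primrec (fun q => BB (f q) (g q)) :=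
  pr_bigB.comp (pr_add (Primrec.list_length.comp (pr_jl.comp hf)) (Primrec.list_length.comp (pr_jl.comp hg)))

theorem pr_NN {f g : γ → List ((ℕ × ℕ) × Bool)} (hf : Primrec f) (hg : Primrec g) :
    Primrec (fun q => NN (f q) (g q)) :=
  pr_add (pr_add (pr_mul (Primrec.const 2) (pr_BB hf hg)) (pr_MM.comp hf)) (pr_MM.comp hg)

theorem pr_main {f g : γ → List ((ℕ × ℕ) × Bool)} (hf : Primrec f) (hg : Primrec g) :
    PrimrecPred (fun q => CH (Iio (NN (f q) (g q))) (BB (f q) (g q)) (jl (f q)) (jl (g q))) := by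
  refine PrimrecPred.of_eq (p := fun q => ∃ x ∈ SS (VV (NN (f q) (g q)) (BB (f q) (g q))) (jl (f q))
    (VV (NN (f q) (g q)) (BB (f q) (g q))).length, x = jl (g q)) ?_ ?_
  · have v := pr_VV (pr_NN hf hg) (pr_BB hf hg)
    refine pr_ex (pr_SS v (pr_jl.comp hf) (Primrec.list_length.comp v)) ?_
    exact pr_eq Primrec.snd ((pr_jl.comp hg).comp Primrec.fst)
  · intro q
    refine (CH_iff ?_ ?_).symm
    · exact (Nat.le_add_right _ _).trans (Nat.le_add_left _ _)
    · intro e he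
      have := jl_hin _ e he
      simp only [mem_Iio] at this ⊢
      unfold NN; omega

end P

theorem final (T : OType) :
    ∃ f : List ((ℕ × ℕ) × Bool) × List ((ℕ × ℕ) × Bool) → Bool, Computable f ∧
      ∀ L₁ L₂ R₁ R₂, Realizes L₁ R₁ → Realizes L₂ R₂ → (f (L₁, L₂) = true ↔ EquivOfType T R₁ R₂) := by
  classical
  have h := pr_main ((pr_trL T).comp (Primrec.fst (α := List ((ℕ × ℕ) × Bool)) (β := List ((ℕ × ℕ) × Bool))))
    ((pr_trL T).comp Primrec.snd)
  refine ⟨_, h.decide.to_comp, ?_⟩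
  intro L₁ L₂ R₁ R₂ h1 h2
  rw [decide_eq_true_eq, main_T T h1 h2]

end RD

/-- for each oriented type `T`, it is decidable (by an algorithm acting
on the combinatorial data of the diagrams) whether `[R₁]_T = [R₂]_T`, i.e. whether
`R₁` and `R₂` are related by a finite sequence of exchange moves and type-`T`
(de)stabilizations. -/
theorem stmt19 (T : OType) :
    ∃ f : List ((ℕ × ℕ) × Bool) × List ((ℕ × ℕ) × Bool) → Bool,
      Computable f ∧
      ∀ (L₁ L₂ : List ((ℕ × ℕ) × Bool)) (R₁ R₂ : RectDiagram),
        Realizes L₁ R₁ → Realizes L₂ R₂ →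
        (f (L₁, L₂) = true ↔ EquivOfType T R₁ R₂) := by
  exact RD.final T

end
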